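/- arXiv:1903.06210 — 14 statements merged into one kernel-verified Lean document; each statement's English description precedes it below -/
import Mathlib

section
/- Let C be an [n,k] MDS code over a finite field F, let 1 ≤ l ≤ k, and let P be an l × n matrix whose rows c_0, ..., c_{l-1} are linearly independent codewords of C. If the union of the supports of c_0, ..., c_{l-1} has cardinality exactly n - k + l, then every collection of at most l nonzero columns of P is linearly independent. -/
/-- Let `C` be an `[n,k]` MDS code over a finite field `F`
(`k`-dimensional subspace of `F^n` all of whose nonzero codewords have Hamming
weight at least `n-k+1`), let `1 ≤ l ≤ k`, and let `P` be an `l × n` matrix whose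
rows are linearly independent codewords of `C`.  If the union of the supports of
the rows has cardinality exactly `n - k + l`, then every collection of at most `l`
nonzero columns of `P` is linearly independent. -/
theorem statement0 {F : Type*} [Field F] [Fintype F] {n k l : ℕ}
    (C : Submodule F (Fin n → F))
    (hdim : Module.finrank F C = k)
    (hMDS : ∀ c ∈ C, c ≠ 0 → n - k + 1 ≤ {i : Fin n | c i ≠ 0}.ncard)
    (hl1 : 1 ≤ l) (hlk : l ≤ k)
    (P : Matrix (Fin l) (Fin n) F)
    (hrows : ∀ i, P i ∈ C)
    (hindep : LinearIndependent F P)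
    (hsupp : {j : Fin n | ∃ i, P i j ≠ 0}.ncard = n - k + l)
    (S : Finset (Fin n)) (hScard : S.card ≤ l)
    (hSnz : ∀ j ∈ S, (fun i => P i j) ≠ (0 : Fin l → F)) :
    LinearIndependent F (fun j : S => fun i => P i j.1) := by
  classical
  set U : Finset (Fin n) := {j | ∃ i, P i j ≠ 0} with hU
  have hUcard : U.card = n - k + l := by
    rw [← hsupp, ← Set.ncard_coe_finset]
    simp [hU]
  have hSU : S ⊆ U := fun j hj => by
    simpa [hU] using Function.ne_iff.mp (hSnz j hj)
  obtain ⟨T, hST, hTU, hTcard⟩ :=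
    Finset.exists_subsuperset_card_eq hSU hScard (by omega)
  let e : Fin l ≃ T := (T.equivFinOfCardEq hTcard).symm
  let A : Matrix (Fin l) (Fin l) F := P.submatrix id (fun i => (e i : Fin n))
  have hA : IsUnit A := by
    rw [← Matrix.vecMul_injective_iff_isUnit, ← Matrix.coe_vecMulLinear,
      injective_iff_map_eq_zero]
    intro v hv
    by_contra hv0
    have hc : Matrix.vecMul v P ∈ C := by
      rw [Matrix.vecMul_eq_sum]
      exact C.sum_mem fun i _ => C.smul_mem _ (hrows i)
    have hc0 : Matrix.vecMul v P ≠ 0 := fun h =>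
      hv0 (Matrix.vecMul_injective_iff.mpr hindep (h.trans (Matrix.zero_vecMul P).symm))
    have hsub : {i : Fin n | Matrix.vecMul v P i ≠ 0} ⊆ ((U \ T : Finset (Fin n)) : Set (Fin n)) := by
      intro j hj
      rw [Finset.mem_coe, Finset.mem_sdiff]
      refine ⟨?_, fun hjT => hj ?_⟩
      · by_contra hjU
        have hz : ∀ i, P i j = 0 := by simpa [hU] using hjU
        exact hj (by simp [Matrix.vecMul, dotProduct, hz])
      · simpa [A, Matrix.vecMul, dotProduct] using congrFun hv (e.symm ⟨j, hjT⟩)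
    have hle := Set.ncard_le_ncard hsub (Finset.finite_toSet _)
    rw [Set.ncard_coe_finset, Finset.card_sdiff_of_subset hTU] at hle
    have := hMDS _ hc hc0
    omega
  have hcols := Matrix.linearIndependent_cols_iff_isUnit.mpr hA
  have hinj : Function.Injective fun j : S => e.symm ⟨j, hST j.2⟩ := fun a b h =>
    Subtype.ext (congrArg (fun t : T => (t : Fin n)) (e.symm.injective h))
  convert hcols.comp _ hinj using 2 with j
  ext i
  simp [A, Function.comp_apply, Matrix.col_apply]
end

section
/- Let C be an [n,k] MDS code over a finite field F with 1 ≤ k ≤ n, and let S be any set of exactly k-1 coordinates from {0,...,n-1}. Then there exists a codeword c ∈ C with c_j = 0 for every j ∈ S and c_j ≠ 0 for every j ∉ S. -/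
/-- A subspace of `ι → F` whose dimension exceeds `#S` contains a nonzero vector vanishing
on `S`. -/
theorem Submodule.exists_mem_ne_zero_forall_eq_zero_of_card_lt_finrank {F ι : Type*} [Field F]
    [Finite ι] (C : Submodule F (ι → F)) (S : Finset ι) (h : S.card < Module.finrank F C) :
    ∃ c ∈ C, c ≠ 0 ∧ ∀ j ∈ S, c j = 0 := by
  let f : C →ₗ[F] (S → F) := (LinearMap.funLeft F F ((↑) : S → ι)).comp C.subtype
  have hker : LinearMap.ker f ≠ ⊥ := LinearMap.ker_ne_bot_of_finrank_lt (by simpa using h)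
  obtain ⟨c, hc, hc0⟩ := Submodule.exists_mem_ne_zero_of_ne_bot hker
  exact ⟨c, c.2, by simpa using hc0, fun j hj => congrFun (LinearMap.mem_ker.mp hc) ⟨j, hj⟩⟩

/-- Let `C` be an `[n,k]` MDS code over a finite field `F` with
`1 ≤ k ≤ n`, and let `S` be any set of exactly `k-1` coordinates.  Then there is a
codeword of `C` vanishing exactly on `S`. -/
theorem statement1 {F : Type*} [Field F] [Fintype F] {n k : ℕ}
    (C : Submodule F (Fin n → F))
    (hdim : Module.finrank F C = k)
    (hMDS : ∀ c ∈ C, c ≠ 0 → n - k + 1 ≤ {i : Fin n | c i ≠ 0}.ncard)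
    (hk1 : 1 ≤ k) (hkn : k ≤ n)
    (S : Finset (Fin n)) (hScard : S.card = k - 1) :
    ∃ c ∈ C, (∀ j ∈ S, c j = 0) ∧ (∀ j ∉ S, c j ≠ 0) := by
  obtain ⟨c, hcC, hc0, hcS⟩ :=
    C.exists_mem_ne_zero_forall_eq_zero_of_card_lt_finrank S (by omega)
  refine ⟨c, hcC, hcS, fun j hj => ?_⟩
  have hsub : {i : Fin n | c i ≠ 0} ⊆ ((Sᶜ : Finset (Fin n)) : Set (Fin n)) := fun i hi => by
    simpa using fun hiS => hi (hcS i hiS)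
  have hcard : ((Sᶜ : Finset (Fin n)) : Set (Fin n)).ncard ≤ {i : Fin n | c i ≠ 0}.ncard := by
    have := hMDS c hcC hc0
    rw [Set.ncard_coe_finset, Finset.card_compl, Fintype.card_fin]
    omega
  have hj' : j ∈ {i : Fin n | c i ≠ 0} := by
    rw [Set.eq_of_subset_of_ncard_le hsub hcard]
    simpa using hj
  exact hj'
end

section
/- Every [n,k] MDS code over a finite field (with 1 ≤ k ≤ n) admits a zero-band (ZB) generator matrix. -/
open Finset in
/-- A code of dimension greater than `#S` whose nonzero words have at most `#S` zeros contains a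
word vanishing exactly on `S`. -/
theorem exists_mem_forall_eq_zero_iff {F ι : Type*} [Field F] [Fintype ι] [DecidableEq ι]
    (C : Submodule F (ι → F)) (S : Finset ι) (hS : #S < Module.finrank F C)
    (hC : ∀ c ∈ C, c ≠ 0 → Fintype.card ι ≤ {i | c i ≠ 0}.ncard + #S) :
    ∃ c ∈ C, ∀ j, c j = 0 ↔ j ∈ S := by
  classical
  let f : C →ₗ[F] (S → F) := LinearMap.funLeft F F (fun j : S ↦ (j : ι)) ∘ₗ C.subtype
  have hker : LinearMap.ker f ≠ ⊥ :=
    LinearMap.ker_ne_bot_of_finrank_lt (by simpa using hS)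
  obtain ⟨c, hc, hc0⟩ := (Submodule.ne_bot_iff _).1 hker
  have hsub : S ⊆ ({j | (c : ι → F) j = 0} : Finset ι) := fun j hj ↦ by
    have hj0 : (c : ι → F) j = 0 := congrFun (LinearMap.mem_ker.1 hc) ⟨j, hj⟩
    simpa using hj0
  have hw := hC c c.2 (by simpa using hc0)
  rw [Set.ncard_eq_toFinset_card', Set.toFinset_ofPred] at hw
  have hsum := card_filter_add_card_filter_not (s := (univ : Finset ι)) (fun j ↦ (c : ι → F) j = 0)
  rw [card_univ] at hsum
  have heq := eq_of_subset_of_card_le hsub (by simp only [ne_eq] at hw; omega)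
  exact ⟨c, c.2, fun j ↦ by rw [heq]; simp⟩

open Finset Classical in
theorem card_filter_exists_mod_eq {n k : ℕ} (hk : 1 ≤ k) (hkn : k ≤ n) (i : ℕ) :
    #{j : Fin n | ∃ m : ℕ, 1 ≤ m ∧ m ≤ k - 1 ∧ (j : ℕ) % n = (i + m) % n} = k - 1 := by
  have hn : 0 < n := by omega
  have himage : ({j : Fin n | ∃ m : ℕ, 1 ≤ m ∧ m ≤ k - 1 ∧ (j : ℕ) % n = (i + m) % n} : Finset _) =
      (Icc 1 (k - 1)).image fun m ↦ (⟨(i + m) % n, Nat.mod_lt _ hn⟩ : Fin n) := by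
    ext j
    simp only [mem_filter, mem_univ, true_and, mem_image, mem_Icc, Fin.ext_iff,
      Nat.mod_eq_of_lt j.isLt, and_assoc, eq_comm]
  rw [himage, card_image_of_injOn, Nat.card_Icc, Nat.add_sub_cancel]
  intro a ha b hb hab
  simp only [coe_Icc, Set.mem_Icc] at ha hb
  have hmod : a ≡ b [MOD n] := Nat.ModEq.add_left_cancel' i (Fin.ext_iff.1 hab)
  exact hmod.eq_of_lt_of_lt (by omega) (by omega)

theorem linearIndependent_of_zeroBand {F : Type*} [Field F] {n k : ℕ} (hkn : k ≤ n)
    (Z : Matrix (Fin k) (Fin n) F)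
    (hZ : ∀ (i : Fin k) (j : Fin n),
      (Z i j = 0 ↔ ∃ m : ℕ, 1 ≤ m ∧ m ≤ k - 1 ∧ (j : ℕ) % n = ((i : ℕ) + m) % n)) :
    LinearIndependent F Z := by
  let A : Matrix (Fin k) (Fin k) F := Z.submatrix id (Fin.castLE hkn)
  have hlow : A.BlockTriangular OrderDual.toDual := fun i j hij ↦ by
    have hij' : (i : ℕ) < j := hij
    refine (hZ i _).2 ⟨j - i, by omega, by omega, ?_⟩
    rw [Nat.add_sub_cancel' hij'.le, Fin.val_castLE]
  have hdiag : ∀ i, A i i ≠ 0 := fun i hi ↦ by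
    obtain ⟨m, hm, hmk, h⟩ := (hZ i _).1 hi
    have hmod : 0 ≡ m [MOD n] := Nat.ModEq.add_left_cancel' (i : ℕ) h
    have := hmod.eq_of_lt_of_lt (by omega) (by omega)
    omega
  have hdet : A.det ≠ 0 := by
    rw [Matrix.det_of_isLowerTriangular A hlow]
    exact Finset.prod_ne_zero_iff.2 fun i _ ↦ hdiag i
  exact LinearIndependent.of_comp (LinearMap.funLeft F F (Fin.castLE hkn))
    (Matrix.linearIndependent_rows_of_det_ne_zero hdet)


/-- Every `[n,k]` MDS code (with `1 ≤ k ≤ n`) over a finite field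
admits a zero-band generator matrix: a `k × n` matrix `Z` whose rows form a basis
of the code and such that `Z i j = 0` exactly when `j ≡ i + m (mod n)` for some
`m ∈ {1, …, k-1}` (and `Z i j ≠ 0` for every other column index `j`). -/
theorem statement2 {F : Type*} [Field F] [Fintype F] {n k : ℕ}
    (C : Submodule F (Fin n → F))
    (hdim : Module.finrank F C = k)
    (hMDS : ∀ c ∈ C, c ≠ 0 → n - k + 1 ≤ {i : Fin n | c i ≠ 0}.ncard)
    (hk1 : 1 ≤ k) (hkn : k ≤ n) :
    ∃ Z : Matrix (Fin k) (Fin n) F,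
      LinearIndependent F Z ∧
      Submodule.span F (Set.range Z) = C ∧
      ∀ (i : Fin k) (j : Fin n),
        (Z i j = 0 ↔ ∃ m : ℕ, 1 ≤ m ∧ m ≤ k - 1 ∧ (j : ℕ) % n = ((i : ℕ) + m) % n) := by
  classical
  choose Z hZC hZ using fun i : Fin k ↦ exists_mem_forall_eq_zero_iff C
    {j : Fin n | ∃ m : ℕ, 1 ≤ m ∧ m ≤ k - 1 ∧ (j : ℕ) % n = ((i : ℕ) + m) % n}
    (by rw [card_filter_exists_mod_eq hk1 hkn, hdim]; omega)
    (fun c hc hc0 ↦ by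
      have := hMDS c hc hc0
      rw [card_filter_exists_mod_eq hk1 hkn, Fintype.card_fin]
      omega)
  have hband : ∀ (i : Fin k) (j : Fin n),
      (Z i j = 0 ↔ ∃ m : ℕ, 1 ≤ m ∧ m ≤ k - 1 ∧ (j : ℕ) % n = ((i : ℕ) + m) % n) :=
    fun i j ↦ by simpa using hZ i j
  have hli : LinearIndependent F Z := linearIndependent_of_zeroBand hkn Z hband
  refine ⟨Z, hli, ?_, hband⟩
  refine Submodule.eq_of_le_of_finrank_eq (Submodule.span_le.2 (Set.range_subset_iff.2 hZC)) ?_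
  rw [hdim]
  exact (finrank_span_eq_card hli).trans (Fintype.card_fin k)
end

section
/- Let Z be a ZB generator matrix of an [n,k] MDS code over a finite field F, and fix integers i, j with 0 ≤ i ≤ k-1 and 1 ≤ j ≤ k-i. Then every collection of at most j nonzero columns of the j × n submatrix of Z formed by rows i, i+1, ..., i+j-1 is linearly independent. -/
/-- A matrix with as many rows as columns whose rows are linearly independent has
linearly independent columns. -/
theorem Matrix.linearIndependent_col_of_row {K m n : Type*} [Field K] [Fintype m] [Fintype n]
    (h : Fintype.card m = Fintype.card n) (A : Matrix m n K) (hA : LinearIndependent K A.row) :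
    LinearIndependent K A.col := by
  classical
  let e : n ≃ m := (Fintype.equivOfCardEq h).symm
  have hrow : LinearIndependent K (A.submatrix e id).row := hA.comp e e.injective
  have hcol := Matrix.linearIndependent_cols_iff_isUnit.mpr
    (Matrix.linearIndependent_rows_iff_isUnit.mp hrow)
  rw [Fintype.linearIndependent_iff] at hcol ⊢
  intro g hg
  refine hcol g (funext fun r => ?_)
  simpa [Matrix.col] using congrFun hg (e r)

/-- Let `v` be linearly independent vectors all vanishing on `T`. If a linear combination of `v`
is zero as soon as it vanishes on `#T + #ι` coordinates, then any at most `#ι` coordinates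
outside of `T` give linearly independent columns. -/
theorem linearIndependent_columns_of_zeros {K ι κ : Type*} [Field K] [Fintype ι] [Fintype κ]
    [DecidableEq κ] {v : ι → κ → K} (hv : LinearIndependent K v) {S T : Finset κ}
    (hST : Disjoint S T) (hT : ∀ r, ∀ t ∈ T, v r t = 0) (hS : S.card ≤ Fintype.card ι)
    (hcard : T.card + Fintype.card ι ≤ Fintype.card κ)
    (hzero : ∀ c ∈ Submodule.span K (Set.range v), ∀ U : Finset κ,
      U.card = T.card + Fintype.card ι → (∀ u ∈ U, c u = 0) → c = 0) :
    LinearIndependent K (fun (s : S) (r : ι) => v r s) := by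
  obtain ⟨S', hSS', hS'T, hS'card⟩ :=
    Finset.exists_subsuperset_card_eq (t := Tᶜ) (Finset.subset_compl_iff_disjoint_right.mpr hST) hS
      (by rw [Finset.card_compl]; omega)
  have hrow : LinearIndependent K (Matrix.of fun (r : ι) (s : S') => v r s).row := by
    rw [Fintype.linearIndependent_iff] at hv ⊢
    intro g hg
    refine hv g (hzero _ ?_ (T ∪ S') ?_ ?_)
    · exact Submodule.sum_mem _ fun r _ =>
        Submodule.smul_mem _ _ (Submodule.subset_span (Set.mem_range_self r))
    · rw [Finset.card_union_of_disjoint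
        (Finset.subset_compl_iff_disjoint_right.mp hS'T).symm, hS'card]
    · intro u hu
      rcases Finset.mem_union.mp hu with hu | hu
      · simp [hT _ u hu]
      · simpa [Matrix.row] using congrFun hg ⟨u, hu⟩
  have hcol := Matrix.linearIndependent_col_of_row (by simp [hS'card]) _ hrow
  exact hcol.comp (fun s : S => (⟨s, hSS' s.2⟩ : S'))
    fun a b hab => Subtype.ext (congrArg (fun x : S' => (x : κ)) hab)


/-- Let `Z` be a zero-band generator matrix of an `[n,k]` MDS code
over a finite field `F`, and fix `i, j` with `0 ≤ i ≤ k-1` and `1 ≤ j ≤ k-i`.  Then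
every collection of at most `j` nonzero columns of the `j × n` submatrix of `Z`
formed by rows `i, i+1, …, i+j-1` is linearly independent. -/
theorem statement3 {F : Type*} [Field F] [Fintype F] {n k : ℕ}
    (C : Submodule F (Fin n → F))
    (hdim : Module.finrank F C = k)
    (hMDS : ∀ c ∈ C, c ≠ 0 → n - k + 1 ≤ {i : Fin n | c i ≠ 0}.ncard)
    (hk1 : 1 ≤ k) (hkn : k ≤ n)
    (Z : Matrix (Fin k) (Fin n) F)
    (hZindep : LinearIndependent F Z)
    (hZspan : Submodule.span F (Set.range Z) = C)
    (hZband : ∀ (i : Fin k) (j : Fin n),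
      (Z i j = 0 ↔ ∃ m : ℕ, 1 ≤ m ∧ m ≤ k - 1 ∧ (j : ℕ) % n = ((i : ℕ) + m) % n))
    (i j : ℕ) (hi : i ≤ k - 1) (hj1 : 1 ≤ j) (hj2 : j ≤ k - i)
    (S : Finset (Fin n)) (hScard : S.card ≤ j)
    (hSnz : ∀ s ∈ S,
      (fun r : Fin j => Z ⟨i + (r : ℕ), by have := r.isLt; omega⟩ s) ≠ (0 : Fin j → F)) :
    LinearIndependent F
      (fun s : S => fun r : Fin j => Z ⟨i + (r : ℕ), by have := r.isLt; omega⟩ s.1) := by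
  classical
  have hn : 0 < n := by omega
  let T : Finset (Fin n) :=
    (Finset.Ico (i + j) (i + k)).image fun m => ⟨m % n, Nat.mod_lt _ hn⟩
  have hTcard : T.card = k - j := by
    rw [Finset.card_image_of_injOn, Nat.card_Ico]
    · omega
    · intro a ha b hb hab
      simp only [Finset.coe_Ico, Set.mem_Ico] at ha hb
      exact Nat.mod_injOn_Ico (i + j) n (by simp; omega) (by simp; omega)
        (congrArg Fin.val hab)
  have hTzero : ∀ r : Fin j, ∀ t ∈ T,
      Z ⟨i + (r : ℕ), by have := r.isLt; omega⟩ t = 0 := by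
    intro r t ht
    obtain ⟨m, hm, rfl⟩ := Finset.mem_image.mp ht
    rw [Finset.mem_Ico] at hm
    have := r.isLt
    refine (hZband _ _).mpr ⟨m - (i + r), by omega, by omega, ?_⟩
    rw [Nat.mod_mod, Nat.add_sub_cancel' (show i + (r : ℕ) ≤ m by omega)]
  refine linearIndependent_columns_of_zeros
    (v := fun r : Fin j => Z ⟨i + (r : ℕ), by have := r.isLt; omega⟩) (T := T)
    (hZindep.comp (fun r : Fin j => (⟨i + (r : ℕ), by have := r.isLt; omega⟩ : Fin k)) ?_)
    ?_ hTzero (by simpa using hScard) (by simp; omega) ?_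
  · intro a b hab
    have := congrArg Fin.val hab
    exact Fin.ext (by simpa using this)
  · exact Finset.disjoint_left.mpr fun s hs hsT => hSnz s hs (funext fun r => hTzero r s hsT)
  · intro c hc U hU hcU
    have hcC : c ∈ C := by
      rw [← hZspan]
      refine Submodule.span_mono ?_ hc
      rintro _ ⟨r, rfl⟩
      exact Set.mem_range_self _
    by_contra hne
    have hweight := hMDS c hcC hne
    have hle : {i : Fin n | c i ≠ 0}.ncard ≤ Uᶜ.card := by
      rw [← Set.ncard_coe_finset]
      refine Set.ncard_le_ncard (fun u hu => ?_)
      simpa using fun huU => hu (hcU u huU)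
    rw [Finset.card_compl, Fintype.card_fin, hU, Fintype.card_fin] at hle
    omega
end

section
/- Let H be an m × n matrix over a finite field F with columns h_0, ..., h_{n-1}, let C = {x ∈ F^n : Hx = 0}, let E ⊆ {0,...,n-1} and let i ∈ E. Then the following are equivalent: (1) for any two codewords c, c' ∈ C with c_j = c'_j for all j ∉ E, one has c_i = c'_i; (2) the column h_i does not lie in the linear span of the columns {h_j : j ∈ E, j ≠ i}. -/
/-- A vector lies in the span of the columns of `H` indexed by `S` if and only if it is the image
under `H` of a vector supported on `S`. -/
theorem Matrix.mem_span_image_col_iff {R m n : Type*} [CommSemiring R] [Fintype n]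
    (H : Matrix m n R) (S : Set n) (v : m → R) :
    v ∈ Submodule.span R ((fun j : n => fun r => H r j) '' S) ↔
      ∃ x : n → R, (∀ j ∉ S, x j = 0) ∧ H.mulVec x = v := by
  have mulVec_eq (l : n →₀ R) :
      Finsupp.linearCombination R (fun j : n => fun r => H r j) l = H.mulVec l := by
    ext r
    simp [Finsupp.linearCombination_apply, Finsupp.sum_fintype, Matrix.mulVec, dotProduct,
      mul_comm]
  rw [Finsupp.mem_span_image_iff_linearCombination]
  constructor
  · rintro ⟨l, hl, rfl⟩
    exact ⟨l, fun j hj => (Finsupp.mem_supported' R l).1 hl j hj, (mulVec_eq l).symm⟩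
  · rintro ⟨x, hx, rfl⟩
    refine ⟨Finsupp.equivFunOnFinite.symm x, (Finsupp.mem_supported' R _).2 hx, ?_⟩
    rw [mulVec_eq]
    rfl

/-- Let `H` be an `m × n` matrix over a finite field `F`, let
`C = {x : Hx = 0}` be its kernel code, let `E ⊆ {0,…,n-1}` and `i ∈ E`.  Then the
`i`-th symbol of any codeword is determined by the symbols outside `E` (condition
(1)) if and only if the column `h_i` does not lie in the span of the columns
`{h_j : j ∈ E, j ≠ i}` (condition (2)). -/
theorem statement4 {F : Type*} [Field F] [Fintype F] {m n : ℕ}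
    (H : Matrix (Fin m) (Fin n) F)
    (E : Set (Fin n)) (i : Fin n) (hi : i ∈ E) :
    (∀ c c' : Fin n → F, H.mulVec c = 0 → H.mulVec c' = 0 →
        (∀ j : Fin n, j ∉ E → c j = c' j) → c i = c' i) ↔
      (fun r => H r i) ∉
        Submodule.span F ((fun j : Fin n => fun r => H r j) '' (E \ {i})) := by
  have hcol : (fun r => H r i) = H.mulVec (Pi.single i 1) := (H.mulVec_single_one i).symm
  rw [Matrix.mem_span_image_col_iff, hcol]
  constructor
  · rintro h ⟨x, hx, hHx⟩
    have hxi : x i = 0 := hx i (by simp)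
    have heq := h (Pi.single i 1 - x) 0 (by rw [Matrix.mulVec_sub, hHx, sub_self])
      (Matrix.mulVec_zero H) fun j hj => by
        have hji : j ≠ i := fun hji => hj (hji ▸ hi)
        simp [hji, hx j fun hjE => hj hjE.1]
    simp [hxi] at heq
  · intro h c c' hc hc' hcc'
    by_contra hne
    have hd : c i - c' i ≠ 0 := sub_ne_zero.2 hne
    refine h ⟨Pi.single i 1 - (c i - c' i)⁻¹ • (c - c'), fun j hj => ?_, ?_⟩
    · by_cases hji : j = i
      · subst hji
        simp [hd]
      · have hjE : j ∉ E := fun hjE => hj ⟨hjE, hji⟩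
        simp [hji, hcc' j hjE]
    · simp [Matrix.mulVec_sub, Matrix.mulVec_smul, hc, hc']
end

section
/- Let F be a finite field, let 1 ≤ a ≤ b ≤ min(τ, w-1) with k ≥ 1, and suppose a (k,n) streaming code over F recovers every packet with delay τ from every erasure set admissible for the sliding-window channel with parameters (a,b,w), i.e., for every such admissible E ⊆ ℕ and every t ∈ ℕ the code recovers packet t from E with delay τ. Then, writing τ_eff = min(τ, w-1), the rate satisfies k·(τ_eff + b - a + 1) ≤ n·(τ_eff - a + 1). -/
/-- An erasure set `E ⊆ ℕ` is admissible for the sliding-window channel with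
parameters `(a, b, w)` if in every window of `w` consecutive time slots, the
erasures are either contained in a single interval of at most `b` consecutive
integers (a burst), or number at most `a` (random erasures). -/
def SWAdmissible (a b w : ℕ) (E : Set ℕ) : Prop :=
  ∀ j : ℕ,
    (∃ i : ℕ, E ∩ Set.Ico j (j + w) ⊆ Set.Ico i (i + b)) ∨
    (E ∩ Set.Ico j (j + w)).ncard ≤ a

/-- If the messages supported on `[0, N)` are determined by the coded packets at the times in `O`,
then `k * N ≤ n * |O|`. -/
theorem mul_le_mul_card_of_determined {F : Type*} [Field F] [Fintype F] {k n : ℕ}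
    (enc : (ℕ → Fin k → F) → ℕ → Fin n → F) (N : ℕ) (O : Finset ℕ)
    (h : ∀ s s' : ℕ → Fin k → F, (∀ t, N ≤ t → s t = s' t) →
      (∀ t ∈ O, enc s t = enc s' t) → ∀ t < N, s t = s' t) :
    k * N ≤ n * O.card := by
  classical
  let ext : (Fin N → Fin k → F) → ℕ → Fin k → F :=
    fun m t => if ht : t < N then m ⟨t, ht⟩ else 0
  let f : (Fin N → Fin k → F) → (O → Fin n → F) := fun m t => enc (ext m) t
  have hf : Function.Injective f := by
    intro m m' hmm
    have hext := h (ext m) (ext m') (fun t ht => by simp [ext, Nat.not_lt.mpr ht])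
      (fun t ht => congrFun hmm ⟨t, ht⟩)
    funext t
    simpa [ext] using hext t t.2
  have hcard := Fintype.card_le_of_injective f hf
  simp only [Fintype.card_fun, Fintype.card_fin, Fintype.card_coe, ← pow_mul] at hcard
  exact (Nat.pow_le_pow_iff_right Fintype.one_lt_card).mp hcard

/-- The tail `[t, b)` of a burst at `0`, followed by the part of a burst at `τ + (b - a) + 1` that
lies within the decoding deadline `t + τ`, is admissible. -/
theorem swAdmissible_burst_tail_union {a b τ t : ℕ} (w : ℕ) (hab : a ≤ b) (ht : t < b) :
    SWAdmissible a b w (Set.Ico t b ∪ Set.Ico (τ + (b - a) + 1) (t + τ + 1)) := by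
  intro j
  by_cases h : t + τ < τ + (b - a) + 1
  · left
    refine ⟨t, ?_⟩
    rintro x ⟨hx | hx, -⟩ <;> simp only [Set.mem_Ico] at hx ⊢ <;> omega
  · right
    have hsub : (Set.Ico t b ∪ Set.Ico (τ + (b - a) + 1) (t + τ + 1)) ∩ Set.Ico j (j + w) ⊆
        ((Finset.Ico t b ∪ Finset.Ico (τ + (b - a) + 1) (t + τ + 1) : Finset ℕ) : Set ℕ) := by
      rw [Finset.coe_union, Finset.coe_Ico, Finset.coe_Ico]
      exact Set.inter_subset_left
    have hcard := Set.ncard_le_ncard hsub (Finset.finite_toSet _)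
    rw [Set.ncard_coe_finset] at hcard
    refine hcard.trans ((Finset.card_union_le _ _).trans ?_)
    simp only [Nat.card_Ico]
    omega

/-- Periodic bursts of length `b` separated by gaps of length `w - a` are admissible. -/
theorem swAdmissible_periodic {a b w : ℕ} (hab : a ≤ b) (hbw : b < w) :
    SWAdmissible a b w {t | t % (w + (b - a)) < b} := by
  intro j
  obtain ⟨P, hP⟩ : ∃ P, P = w + (b - a) := ⟨_, rfl⟩
  rw [← hP]
  have hpos : 0 < P := by omega
  have hj := Nat.div_add_mod j P
  have hjP := Nat.mod_lt j hpos
  have key : ∀ x ∈ {t | t % P < b} ∩ Set.Ico j (j + w),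
      (P * (j / P) ≤ x ∧ x < P * (j / P) + b) ∨
      (P * (j / P) + P ≤ x ∧ x < P * (j / P) + P + b) := by
    rintro x ⟨hx, hx1, hx2⟩
    simp only [Set.mem_ofPred_eq] at hx
    have hxd := Nat.div_add_mod x P
    have h1 : j / P ≤ x / P := Nat.div_le_div_right hx1
    have h2 : x / P ≤ j / P + 1 := by
      rw [← Nat.add_div_right j hpos]
      exact Nat.div_le_div_right (by omega)
    rcases (by omega : x / P = j / P ∨ x / P = j / P + 1) with h | h <;> rw [h] at hxd
    · left; omega
    · right
      rw [mul_add, mul_one] at hxd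
      omega
  by_cases hr : j % P < b
  · by_cases hw : j + w ≤ P * (j / P) + P
    · left
      refine ⟨P * (j / P), fun x hx => ?_⟩
      have := key x hx
      have := hx.2.2
      simp only [Set.mem_Ico]
      omega
    · right
      have hsub : {t | t % P < b} ∩ Set.Ico j (j + w) ⊆
          ((Finset.Ico j (P * (j / P) + b) ∪ Finset.Ico (P * (j / P) + P) (j + w) :
            Finset ℕ) : Set ℕ) := by
        intro x hx
        have := key x hx
        have := hx.2.1
        have := hx.2.2
        simp only [Finset.coe_union, Finset.coe_Ico, Set.mem_union, Set.mem_Ico]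
        omega
      have hcard := Set.ncard_le_ncard hsub (Finset.finite_toSet _)
      rw [Set.ncard_coe_finset] at hcard
      refine hcard.trans ((Finset.card_union_le _ _).trans ?_)
      simp only [Nat.card_Ico]
      omega
  · left
    refine ⟨P * (j / P) + P, fun x hx => ?_⟩
    have := key x hx
    have := hx.2.1
    simp only [Set.mem_Ico]
    omega

/-- The number of times outside periodic bursts of length `b` and period `P` during `M` periods. -/
theorem card_filter_range_le_mod {b P : ℕ} (M : ℕ) :
    ((Finset.range (M * P)).filter (fun t => b ≤ t % P)).card = M * (P - b) := by
  induction M with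
  | zero => simp
  | succ M ih =>
    have hper : Function.Periodic (fun t => b ≤ t % P) P := fun t => by simp
    have hcount : P.count (fun t => b ≤ t % P) = P - b := by
      rw [Nat.count_eq_card_filter_range, ← Nat.card_Ico]
      congr 1
      ext x
      simp only [Finset.mem_filter, Finset.mem_range, Finset.mem_Ico]
      constructor
      · rintro ⟨h1, h2⟩
        rw [Nat.mod_eq_of_lt h1] at h2
        exact ⟨h2, h1⟩
      · rintro ⟨h1, h2⟩
        rw [Nat.mod_eq_of_lt h2]
        exact ⟨h2, h1⟩
    have hblock := Nat.filter_Ico_card_eq_of_periodic (M * P) P _ hper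
    rw [add_mul, one_mul, add_mul, one_mul, ← ih, ← hcount, ← hblock, Finset.range_eq_Ico,
      Finset.range_eq_Ico, ← Finset.card_union_of_disjoint, ← Finset.filter_union,
      Finset.Ico_union_Ico_eq_Ico (Nat.zero_le _) (Nat.le_add_right _ _)]
    exact Finset.disjoint_filter_filter (Finset.Ico_disjoint_Ico_consecutive _ _ _)

/-- Rate upper bound for streaming codes over the delay-constrained
sliding-window channel: if a `(k,n)` streaming code (a causal systematic encoder
`enc`) recovers every packet with delay `τ` from every erasure set admissible for
the sliding-window channel with parameters `(a,b,w)`, where `1 ≤ a ≤ b ≤ min(τ, w-1)`,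
then, with `τ_eff = min τ (w-1)`, one has `k (τ_eff + b - a + 1) ≤ n (τ_eff - a + 1)`,
i.e. `k/n ≤ (τ_eff - a + 1)/(τ_eff + (b-a) + 1)`. -/
theorem statement5 {F : Type*} [Field F] [Fintype F]
    (k n a b τ w : ℕ) (hk : 1 ≤ k) (hkn : k ≤ n)
    (ha : 1 ≤ a) (hab : a ≤ b) (hbτ : b ≤ τ) (hbw : b ≤ w - 1)
    (enc : (ℕ → Fin k → F) → ℕ → Fin n → F)
    (hcausal : ∀ (s s' : ℕ → Fin k → F) (t : ℕ),
      (∀ t' ≤ t, s t' = s' t') → enc s t = enc s' t)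
    (hsystematic : ∀ (s : ℕ → Fin k → F) (t : ℕ) (i : Fin k),
      enc s t (Fin.castLE hkn i) = s t i)
    (hrecover : ∀ E : Set ℕ, SWAdmissible a b w E →
      ∀ (t : ℕ) (s s' : ℕ → Fin k → F),
        (∀ t' ≤ t + τ, t' ∉ E → enc s t' = enc s' t') → s t = s' t) :
    k * (min τ (w - 1) + (b - a) + 1) ≤ n * (min τ (w - 1) - a + 1) := by
  have hsys : ∀ (s s' : ℕ → Fin k → F) (t : ℕ), enc s t = enc s' t → s t = s' t := by
    intro s s' t h
    funext i
    rw [← hsystematic s t i, ← hsystematic s' t i, h]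
  rcases Nat.lt_or_ge (w - 1) τ with hτ | hτ
  · rw [min_eq_right hτ.le]
    have hadm := swAdmissible_periodic (w := w) hab (by omega)
    obtain ⟨P, hP⟩ : ∃ P, P = w + (b - a) := ⟨_, rfl⟩
    rw [← hP] at hadm
    have hbound : ∀ M : ℕ, k * (M * P) ≤ n * (M * (P - b) + τ) := by
      intro M
      let O := (Finset.range (M * P)).filter (fun t => b ≤ t % P) ∪
        Finset.Ico (M * P) (M * P + τ)
      have hdet : k * (M * P) ≤ n * O.card := by
        refine mul_le_mul_card_of_determined enc (M * P) O fun s s' _ hO t ht => ?_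
        refine hrecover _ hadm t s s' fun t' ht' hE => hO t' ?_
        simp only [Set.mem_ofPred_eq, not_lt] at hE
        simp only [O, Finset.mem_union, Finset.mem_filter, Finset.mem_range, Finset.mem_Ico]
        omega
      refine hdet.trans (Nat.mul_le_mul_left n ((Finset.card_union_le _ _).trans ?_))
      rw [card_filter_range_le_mod, Nat.card_Ico, Nat.add_sub_cancel_left]
    have hP1 : w - 1 + (b - a) + 1 = P := by omega
    have hP2 : w - 1 - a + 1 = P - b := by omega
    rw [hP1, hP2]
    by_contra! hlt
    have hM := hbound (n * τ + 1)
    nlinarith [Nat.mul_le_mul_left (n * τ + 1) (Nat.succ_le_of_lt hlt)]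
  · rw [min_eq_left hτ]
    have hdet : k * (τ + (b - a) + 1) ≤ n * (Finset.Ico b (τ + (b - a) + 1)).card := by
      refine mul_le_mul_card_of_determined enc _ _ fun s s' _ hO t => ?_
      induction t using Nat.strong_induction_on with
      | _ t ih =>
        intro ht
        by_cases htb : t < b
        · refine hrecover _ (swAdmissible_burst_tail_union (τ := τ) w hab htb) t s s'
            fun t' ht' hE => ?_
          simp only [Set.mem_union, Set.mem_Ico] at hE
          rcases Nat.lt_or_ge t' t with h | h
          · exact hcausal s s' t' fun u hu => ih u (by omega) (by omega)
          · exact hO t' (Finset.mem_Ico.mpr (by omega))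
        · exact hsys s s' t (hO t (Finset.mem_Ico.mpr (by omega)))
    rw [Nat.card_Ico] at hdet
    rwa [show τ - a + 1 = τ + (b - a) + 1 - b by omega]
end

section
/- Let 1 ≤ a ≤ b ≤ τ be integers, set δ = b - a and ν = τ + δ + 1, and let E = {t ∈ ℕ : (t mod ν) ≤ b-1} be the periodic erasure pattern of period ν erasing the first b slots of each period. Then for every t ∈ E, the set E ∩ [t, t+τ] is either contained in a single interval of at most b consecutive integers, or has cardinality at most a. -/
/-- A member of the residue pattern `{x | x % ν ≤ b - 1}` that is at least `q * ν` lies either in the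
first `b` slots of the `q`-th period or beyond that period. -/
theorem lt_add_or_succ_mul_le_of_mod_le {ν b q x : ℕ} (hb : 1 ≤ b) (hx : x % ν ≤ b - 1)
    (hq : q * ν ≤ x) : x < q * ν + b ∨ q * ν + ν ≤ x := by
  by_contra! h
  obtain ⟨y, rfl⟩ := Nat.exists_eq_add_of_le hq
  rw [Nat.add_comm (q * ν), Nat.add_mul_mod_self_right, Nat.mod_eq_of_lt (by omega)] at hx
  omega

/-- Let `1 ≤ a ≤ b ≤ τ`, `δ = b - a`, `ν = τ + δ + 1`, and let
`E = {t : t mod ν ≤ b-1}` be the periodic erasure pattern of period `ν` erasing the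
first `b` slots of each period.  Then for every `t ∈ E`, the erasures in the
decoding window `[t, t+τ]` are either contained in a single interval of at most `b`
consecutive integers, or number at most `a`. -/
theorem statement6 (a b τ : ℕ) (ha : 1 ≤ a) (hab : a ≤ b) (hbτ : b ≤ τ) :
    ∀ t ∈ {t : ℕ | t % (τ + (b - a) + 1) ≤ b - 1},
      (∃ i : ℕ,
          {t' : ℕ | t' % (τ + (b - a) + 1) ≤ b - 1} ∩ Set.Icc t (t + τ) ⊆
            Set.Ico i (i + b)) ∨
      ({t' : ℕ | t' % (τ + (b - a) + 1) ≤ b - 1} ∩ Set.Icc t (t + τ)).ncard ≤ a := by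
  intro t ht
  have hb : 1 ≤ b := ha.trans hab
  obtain ⟨ν, hν⟩ : ∃ ν, ν = τ + (b - a) + 1 := ⟨_, rfl⟩
  rw [← hν] at ht ⊢
  obtain ⟨s, hs⟩ : ∃ s, s = t / ν * ν := ⟨_, rfl⟩
  have hdiv : s + t % ν = t := hs ▸ Nat.div_add_mod' t ν
  have hcases : ∀ x, x % ν ≤ b - 1 → t ≤ x → x < s + b ∨ s + ν ≤ x := fun x hx htx => by
    rw [hs]
    exact lt_add_or_succ_mul_le_of_mod_le hb hx ((Nat.div_mul_le_self t ν).trans htx)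
  simp only [Set.mem_ofPred_eq] at ht
  by_cases hr : t % ν ≤ b - a
  · refine Or.inl ⟨s, ?_⟩
    rintro x ⟨hx, htx, hxt⟩
    have := hcases x hx htx
    exact ⟨by omega, by omega⟩
  · right
    have hsub : {t' : ℕ | t' % ν ≤ b - 1} ∩ Set.Icc t (t + τ) ⊆
        ↑(Finset.Ico t (s + b) ∪ Finset.Icc (s + ν) (t + τ)) := by
      rintro x ⟨hx, htx, hxt⟩
      have := hcases x hx htx
      simp only [Finset.mem_coe, Finset.mem_union, Finset.mem_Ico, Finset.mem_Icc]
      omega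
    refine (Set.ncard_le_ncard hsub (Finset.finite_toSet _)).trans ?_
    rw [Set.ncard_coe_finset]
    refine (Finset.card_union_le _ _).trans ?_
    rw [Nat.card_Ico, Nat.card_Icc]
    omega
end

section
/- Let 1 ≤ a ≤ b < w be integers, set ν = w + b - a, and let E = {t ∈ ℕ : (t mod ν) ≤ b-1} be the periodic erasure pattern of period ν erasing the first b slots of each period. Then E is admissible for the sliding-window channel with parameters (a,b,w): for every set J of w consecutive integers, E ∩ J is either contained in a single interval of at most b consecutive integers, or has cardinality at most a. -/
/-- Within the two periods starting at `n * q`, the residue condition `t % n < b` places `t`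
in the first `b` slots of one of them. -/
theorem lt_or_mem_of_mod_lt {n q t b : ℕ} (h₁ : n * q ≤ t) (h₂ : t < n * q + 2 * n)
    (h : t % n < b) : t < n * q + b ∨ (n * q + n ≤ t ∧ t < n * q + n + b) := by
  obtain ⟨s, rfl⟩ := Nat.exists_eq_add_of_le h₁
  rw [Nat.mul_add_mod] at h
  rcases lt_or_ge s n with hs | hs
  · rw [Nat.mod_eq_of_lt hs] at h
    omega
  · rw [Nat.mod_eq_sub_mod hs, Nat.mod_eq_of_lt (by omega)] at h
    omega

/-- Let `1 ≤ a ≤ b < w`, `ν = w + (b - a)`, and let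
`E = {t : t mod ν ≤ b-1}` be the periodic erasure pattern of period `ν` erasing the
first `b` slots of each period.  Then `E` is admissible for the sliding-window
channel with parameters `(a,b,w)`. -/
theorem statement7 (a b w : ℕ) (ha : 1 ≤ a) (hab : a ≤ b) (hbw : b < w) :
    SWAdmissible a b w {t : ℕ | t % (w + (b - a)) ≤ b - 1} := by
  intro j
  obtain ⟨n, hn⟩ : ∃ n, n = w + (b - a) := ⟨_, rfl⟩
  rw [← hn]
  have hr : j % n < n := Nat.mod_lt _ (by omega)
  have hj : n * (j / n) + j % n = j := Nat.div_add_mod j n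
  have key : ∀ t ∈ {t : ℕ | t % n ≤ b - 1} ∩ Set.Ico j (j + w), j ≤ t ∧ t < j + w ∧
      (t < n * (j / n) + b ∨ (n * (j / n) + n ≤ t ∧ t < n * (j / n) + n + b)) := by
    rintro t ⟨ht, h₁, h₂⟩
    rw [Set.mem_ofPred_eq] at ht
    exact ⟨h₁, h₂, lt_or_mem_of_mod_lt (by omega) (by omega) (by omega)⟩
  generalize n * (j / n) = c at hj key
  generalize j % n = r at hr hj
  rcases le_or_gt b r with hbr | hbr
  · refine Or.inl ⟨c + n, fun t ht => ?_⟩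
    have := key t ht
    exact ⟨by omega, by omega⟩
  rcases le_or_gt r (b - a) with hra | hra
  · refine Or.inl ⟨c, fun t ht => ?_⟩
    have := key t ht
    exact ⟨by omega, by omega⟩
  · right
    have hsub : {t : ℕ | t % n ≤ b - 1} ∩ Set.Ico j (j + w) ⊆
        ↑(Finset.Ico j (c + b) ∪ Finset.Ico (c + n) (j + w)) := by
      intro t ht
      have := key t ht
      simp only [Finset.coe_union, Finset.coe_Ico, Set.mem_union, Set.mem_Ico]
      omega
    refine (Set.ncard_le_ncard hsub (Finset.finite_toSet _)).trans ?_
    rw [Set.ncard_coe_finset]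
    refine (Finset.card_union_le _ _).trans ?_
    simp only [Nat.card_Ico]
    omega
end

section
/- Let F be a finite field, let 1 ≤ b ≤ ν and k ≥ 1, τ ≥ 0 be integers, and let E = {t ∈ ℕ : (t mod ν) ≤ b-1} be the periodic erasure pattern of period ν erasing the first b slots of each period. If a (k,n) streaming code over F recovers every packet t ∈ ℕ from E with delay τ, then k·ν ≤ n·(ν - b). -/
/-- The message stream with the given first `L` packets and zero packets afterwards. -/
def extendByZero {A : Type*} [Zero A] {L : ℕ} (u : Fin L → A) (t : ℕ) : A :=
  if h : t < L then u ⟨t, h⟩ else 0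

/-- An injection between spaces of vector-valued families over a finite field forces the
inequality of dimensions. -/
theorem mul_card_le_of_injective {F ι κ : Type*} [Field F] [Fintype F] [Fintype ι] [Fintype κ]
    {k n : ℕ} (f : (ι → Fin k → F) → κ → Fin n → F) (hf : Function.Injective f) :
    k * Fintype.card ι ≤ n * Fintype.card κ := by
  classical
  have h := Fintype.card_le_of_injective f hf
  simp only [Fintype.card_fun, Fintype.card_fin, ← pow_mul] at h
  exact (Nat.pow_le_pow_iff_right Fintype.one_lt_card).1 h

/-- If `a m ≤ c (m + d)` for all `m`, then `a ≤ c`. -/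
theorem le_of_forall_mul_le_mul_add {a c d : ℕ} (h : ∀ m, a * m ≤ c * (m + d)) : a ≤ c := by
  by_contra! hlt
  have h₁ := h (c * d + 1)
  have h₂ := Nat.mul_le_mul_right (c * d + 1) (Nat.succ_le_of_lt hlt)
  rw [Nat.succ_mul] at h₂
  rw [mul_add c] at h₁
  omega

/-- Capacity bound for the periodic erasure channel: let
`1 ≤ b ≤ ν`, and let `E = {t : t mod ν ≤ b-1}` be the periodic erasure pattern of
period `ν` erasing the first `b` slots of each period.  If a `(k,n)` streaming code
(a causal systematic encoder `enc`) recovers every packet from `E` with delay `τ`,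
then `k ν ≤ n (ν - b)`, i.e. the rate `k/n` is at most `(ν - b)/ν`. -/
theorem statement8 {F : Type*} [Field F] [Fintype F]
    (k n b ν τ : ℕ) (hb : 1 ≤ b) (hbν : b ≤ ν) (hk : 1 ≤ k) (hkn : k ≤ n)
    (enc : (ℕ → Fin k → F) → ℕ → Fin n → F)
    (hcausal : ∀ (s s' : ℕ → Fin k → F) (t : ℕ),
      (∀ t' ≤ t, s t' = s' t') → enc s t = enc s' t)
    (hsystematic : ∀ (s : ℕ → Fin k → F) (t : ℕ) (i : Fin k),
      enc s t (Fin.castLE hkn i) = s t i)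
    (hrecover : ∀ (t : ℕ) (s s' : ℕ → Fin k → F),
      (∀ t' ≤ t + τ, t' ∉ {t'' : ℕ | t'' % ν ≤ b - 1} → enc s t' = enc s' t') →
      s t = s' t) :
    k * ν ≤ n * (ν - b) := by
  have hν : 0 < ν := by omega
  refine le_of_forall_mul_le_mul_add (d := τ + 1) fun m => ?_
  let f : (Fin (m * ν) → Fin k → F) → Fin (m + (τ + 1)) × Fin (ν - b) → Fin n → F :=
    fun u p => enc (extendByZero u) (p.1 * ν + (b + p.2))
  have hf : Function.Injective f := by
    intro u v huv
    funext t
    have key : extendByZero u t = extendByZero v t := by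
      refine hrecover t _ _ fun t' ht' hE => ?_
      have hmod : b ≤ t' % ν := by
        simp only [Set.mem_ofPred_eq] at hE
        omega
      have hlt : t' % ν < ν := Nat.mod_lt _ hν
      have hdiv : t' / ν < m + (τ + 1) := by
        rw [Nat.div_lt_iff_lt_mul hν]
        have ht := t.isLt
        have hτ : τ + 1 ≤ (τ + 1) * ν := Nat.le_mul_of_pos_right _ hν
        rw [add_mul m]
        omega
      have h := congrFun huv (⟨t' / ν, hdiv⟩, ⟨t' % ν - b, by omega⟩)
      have htime : t' / ν * ν + (b + (t' % ν - b)) = t' := by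
        rw [Nat.add_sub_cancel' hmod, Nat.div_add_mod']
      simpa only [f, htime] using h
    simpa [extendByZero] using key
  have h := mul_card_le_of_injective f hf
  simp only [Fintype.card_prod, Fintype.card_fin] at h
  calc k * ν * m = k * (m * ν) := by ring
    _ ≤ n * ((m + (τ + 1)) * (ν - b)) := h
    _ = n * (ν - b) * (m + (τ + 1)) := by ring
end

section
/- For all integers 1 ≤ a ≤ b ≤ τ and every prime power q ≥ τ+1, there exists a linear code C of length n = τ+b-a+1 and dimension τ-a+1 over the finite field with q² elements that is (a,b,τ)-delay-recoverable. -/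
/-- A linear code `C ⊆ F^n` (with `n = τ + b - a + 1`) is `(a,b,τ)`-delay-recoverable
if (i) [burst recovery] for every coordinate `ℓ`, any two codewords agreeing on all
coordinates `j < ℓ` and on all coordinates `j` with `ℓ + b ≤ j ≤ ℓ + τ` agree at `ℓ`,
and (ii) [random-erasure recovery] for every `ℓ` and every erasure set
`E ⊆ [ℓ, ℓ+τ]` with `ℓ ∈ E` and `|E| ≤ a`, any two codewords agreeing on all
coordinates `j < ℓ` and on all coordinates `j ∈ (ℓ, ℓ+τ] \ E` agree at `ℓ`. -/
def DelayRecoverable {F : Type*} [Field F] {n : ℕ} (a b τ : ℕ)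
    (C : Submodule F (Fin n → F)) : Prop :=
  (∀ (ℓ : Fin n) (c c' : Fin n → F), c ∈ C → c' ∈ C →
      (∀ j : Fin n, (j : ℕ) < (ℓ : ℕ) → c j = c' j) →
      (∀ j : Fin n, (ℓ : ℕ) + b ≤ (j : ℕ) → (j : ℕ) ≤ (ℓ : ℕ) + τ → c j = c' j) →
      c ℓ = c' ℓ) ∧
  (∀ (ℓ : Fin n) (E : Finset (Fin n)), ℓ ∈ E →
      (∀ j ∈ E, (ℓ : ℕ) ≤ (j : ℕ) ∧ (j : ℕ) ≤ (ℓ : ℕ) + τ) → E.card ≤ a →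
      ∀ (c c' : Fin n → F), c ∈ C → c' ∈ C →
        (∀ j : Fin n, (j : ℕ) < (ℓ : ℕ) → c j = c' j) →
        (∀ j : Fin n, (ℓ : ℕ) < (j : ℕ) → (j : ℕ) ≤ (ℓ : ℕ) + τ → j ∉ E → c j = c' j) →
        c ℓ = c' ℓ)

open Polynomial

/-- The monic polynomial vanishing exactly at the points of the last `δ` coordinates. -/
noncomputable def tailPoly {K : Type*} [Field K] (x : ℕ → K) (δ τ : ℕ) : K[X] :=
  Lagrange.nodal (Finset.Ioc τ (τ + δ)) x

/-- The coordinates beyond `δ` at which the `i`-th burst check vanishes. -/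
def burstZeros (s δ τ i : ℕ) : Finset ℕ :=
  Finset.Ioc δ (s + δ + i) ∪ Finset.Ioc (τ + i) (τ + δ)

/-- The polynomial whose values are the entries of the `i`-th burst check beyond `δ`. -/
noncomputable def burstPoly {K : Type*} [Field K] (x : ℕ → K) (s δ τ i : ℕ) : K[X] :=
  Lagrange.nodal (burstZeros s δ τ i) x

/-- The entries of the subfield check attached to the polynomial `u`. -/
noncomputable def subfieldCheck {K : Type*} [Field K] (x : ℕ → K) (δ τ : ℕ) (u : K[X])
    (j : ℕ) : K :=
  if j ≤ δ then u.eval (x j) else (u * tailPoly x δ τ).eval (x j)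

/-- The entries in the subfield of the `i`-th burst check. -/
noncomputable def burstCheck {K : Type*} [Field K] (x : ℕ → K) (s δ τ i j : ℕ) : K :=
  if j ≤ δ then 0 else (burstPoly x s δ τ i).eval (x j)

/-- The parity-check matrix: `s` rows over the subfield `K` and `δ + 1` burst checks,
each involving `α` at a single coordinate. -/
noncomputable def streamingParityCheck {K F : Type*} [Field K] [Field F] [Algebra K F]
    (x : ℕ → K) (α : F) (s δ τ : ℕ) :
    Matrix (Fin s ⊕ Fin (δ + 1)) (Fin (τ + δ + 1)) F :=
  Matrix.of fun r j => Sum.elim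
    (fun m : Fin s => algebraMap K F (subfieldCheck x δ τ (X ^ (m : ℕ)) j))
    (fun i : Fin (δ + 1) => (if (j : ℕ) = i then α else 0) +
      algebraMap K F (burstCheck x s δ τ i j)) r

/-- The code with parity-check matrix `streamingParityCheck`. -/
noncomputable def streamingCode {K F : Type*} [Field K] [Field F] [Algebra K F]
    (x : ℕ → K) (α : F) (s δ τ : ℕ) : Submodule F (Fin (τ + δ + 1) → F) :=
  LinearMap.ker (streamingParityCheck x α s δ τ).mulVecLin

theorem nodal_dvd_of_eval_eq_zero {K ι : Type*} [Field K] {t : Finset ι} {v : ι → K} {f : K[X]}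
    (hv : Set.InjOn v t) (hf : ∀ i ∈ t, f.eval (v i) = 0) : Lagrange.nodal t v ∣ f := by
  rw [Lagrange.nodal_eq]
  refine Finset.prod_dvd_of_coprime (fun i hi j hj hij => ?_) fun i hi =>
    dvd_iff_isRoot.2 (hf i hi)
  exact isCoprime_X_sub_C_of_isUnit_sub (sub_ne_zero.2 fun h => hij (hv hi hj h)).isUnit

section StreamingCode

variable {K F : Type*} [Field K] [Field F] [Algebra K F] {x : ℕ → K} {α : F} {s δ τ : ℕ}
  {c : Fin (τ + δ + 1) → F}

theorem eval_tailPoly_eq_zero {j : ℕ} (h1 : τ < j) (h2 : j ≤ τ + δ) :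
    (tailPoly x δ τ).eval (x j) = 0 :=
  Lagrange.eval_nodal_at_node (Finset.mem_Ioc.2 ⟨h1, h2⟩)

theorem eval_tailPoly_ne_zero (hx : Set.InjOn x (Set.Ioc δ (τ + δ))) {j : ℕ} (h1 : δ < j)
    (h2 : j ≤ τ) : (tailPoly x δ τ).eval (x j) ≠ 0 := by
  refine Lagrange.eval_nodal_not_at_node fun i hi h => ?_
  rw [Finset.mem_Ioc] at hi
  have := hx ⟨h1, by omega⟩ ⟨by omega, hi.2⟩ h
  omega

theorem eval_burstPoly_eq_zero {i j : ℕ} (h : j ∈ burstZeros s δ τ i) :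
    (burstPoly x s δ τ i).eval (x j) = 0 :=
  Lagrange.eval_nodal_at_node h

theorem eval_burstPoly_ne_zero (hx : Set.InjOn x (Set.Ioc δ (τ + δ))) {i j : ℕ}
    (hi : i ≤ δ) (hτ : s + δ < τ)
    (h1 : δ < j) (h2 : j ≤ τ + δ) (h : j ∉ burstZeros s δ τ i) :
    (burstPoly x s δ τ i).eval (x j) ≠ 0 := by
  refine Lagrange.eval_nodal_not_at_node fun m hm he => ?_
  have hm' := hm
  simp only [burstZeros, Finset.mem_union, Finset.mem_Ioc] at hm'
  have := hx ⟨h1, h2⟩ ⟨by omega, by omega⟩ he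
  exact h (this ▸ hm)

theorem natDegree_burstPoly {i : ℕ} (hi : i ≤ δ) (hτ : s + δ < τ) :
    (burstPoly x s δ τ i).natDegree = s + δ := by
  rw [burstPoly, Lagrange.natDegree_nodal, burstZeros, Finset.card_union_of_disjoint]
  · simp only [Nat.card_Ioc]; omega
  · rw [Finset.disjoint_left]
    intro j
    simp only [Finset.mem_Ioc]
    omega

theorem burstPoly_zero (hτ : s + δ < τ) :
    burstPoly x s δ τ 0 = tailPoly x δ τ * Lagrange.nodal (Finset.Ioc δ (s + δ)) x := by
  rw [burstPoly, burstZeros, Lagrange.nodal_eq, Finset.prod_union, mul_comm]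
  · rfl
  · rw [Finset.disjoint_left]
    intro j
    simp only [Finset.mem_Ioc]
    omega

theorem sum_subfieldCheck_eq_zero (hc : c ∈ streamingCode x α s δ τ) {u : K[X]}
    (hu : u.degree < s) :
    ∑ j : Fin (τ + δ + 1), algebraMap K F (subfieldCheck x δ τ u j) * c j = 0 := by
  classical
  rw [← mem_degreeLT, degreeLT_eq_span_X_pow] at hu
  induction hu using Submodule.span_induction with
  | mem u hu =>
    simp only [Finset.coe_image, Finset.coe_range, Set.mem_image, Set.mem_Iio] at hu
    obtain ⟨m, hm, rfl⟩ := hu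
    simpa [streamingParityCheck, Matrix.mulVec, dotProduct] using
      congrFun (LinearMap.mem_ker.1 hc) (Sum.inl ⟨m, hm⟩)
  | zero => simp [subfieldCheck]
  | add u v _ _ hu hv =>
    refine Eq.trans ?_ ((congrArg₂ (· + ·) hu hv).trans (add_zero 0))
    rw [← Finset.sum_add_distrib]
    refine Finset.sum_congr rfl fun j _ => ?_
    rw [← add_mul, ← map_add]
    congr 2
    unfold subfieldCheck
    split_ifs <;> simp [add_mul]
  | smul k u _ hu =>
    rw [← mul_zero (algebraMap K F k), ← hu, Finset.mul_sum]
    refine Finset.sum_congr rfl fun j _ => ?_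
    rw [← mul_assoc, ← map_mul]
    congr 2
    unfold subfieldCheck
    split_ifs <;> simp

theorem sum_burstCheck_eq_zero (hc : c ∈ streamingCode x α s δ τ) {i : Fin (τ + δ + 1)}
    (hi : (i : ℕ) ≤ δ) :
    α * c i + ∑ j : Fin (τ + δ + 1), algebraMap K F (burstCheck x s δ τ i j) * c j = 0 := by
  have h := congrFun (LinearMap.mem_ker.1 hc) (Sum.inr ⟨i, by omega⟩)
  simpa [streamingParityCheck, Matrix.mulVec, dotProduct, add_mul, Finset.sum_add_distrib,
    Fin.val_inj] using h

theorem card_sub_le_finrank_streamingCode :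
    τ + δ + 1 ≤ Module.finrank F (streamingCode x α s δ τ) + (s + δ + 1) := by
  have h := (streamingParityCheck x α s δ τ).mulVecLin.finrank_range_add_finrank_ker
  have h' := Submodule.finrank_le (LinearMap.range (streamingParityCheck x α s δ τ).mulVecLin)
  simp only [Module.finrank_fintype_fun_eq_card, Fintype.card_fin, Fintype.card_sum] at h h'
  rw [streamingCode]
  omega

theorem apply_eq_zero_of_tail_erasure (hx : Set.InjOn x (Set.Iic τ)) (hτ : s + δ < τ)
    (hc : c ∈ streamingCode x α s δ τ) {ℓ e : Fin (τ + δ + 1)} (hℓ : (ℓ : ℕ) ≤ δ)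
    {E : Finset (Fin (τ + δ + 1))} (hℓE : ℓ ∈ E) (hcard : E.card ≤ s + 1) (heE : e ∈ E)
    (he : τ < (e : ℕ)) (h0 : ∀ j, c j ≠ 0 → j ∈ E ∨ (ℓ : ℕ) + τ < j) : c ℓ = 0 := by
  classical
  have hinj {i j : Fin (τ + δ + 1)} (hi : (i : ℕ) ≤ τ) (hj : (j : ℕ) ≤ τ) (h : x i = x j) :
      i = j := Fin.ext (hx hi hj h)
  set E' : Finset (Fin (τ + δ + 1)) :=
    (E.filter fun j : Fin (τ + δ + 1) => (j : ℕ) ≤ τ).erase ℓ with hE'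
  have hcardE : E'.card < s := by
    have hsub : E' ⊆ (E.erase e).erase ℓ := by
      intro j hj
      simp only [hE', Finset.mem_erase, Finset.mem_filter] at hj ⊢
      refine ⟨hj.1, ?_, hj.2.1⟩
      rintro rfl
      omega
    have hne : ℓ ≠ e := by
      rintro rfl
      omega
    have h1 := Finset.card_le_card hsub
    have h2 := Finset.card_erase_add_one (Finset.mem_erase.2 ⟨hne, hℓE⟩)
    have h3 := Finset.card_erase_add_one heE
    omega
  set u : K[X] := Lagrange.nodal E' (fun j : Fin (τ + δ + 1) => x j) with hu
  have hudeg : u.degree < s := by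
    rw [hu, Lagrange.degree_nodal]
    exact_mod_cast hcardE
  have hsum := sum_subfieldCheck_eq_zero hc hudeg
  rw [Finset.sum_eq_single ℓ] at hsum
  · refine (mul_eq_zero.1 hsum).resolve_left ?_
    rw [map_eq_zero, subfieldCheck, if_pos hℓ]
    refine Lagrange.eval_nodal_not_at_node fun i hi h => ?_
    simp only [hE', Finset.mem_erase, Finset.mem_filter] at hi
    exact hi.1 (hinj (by omega) hi.2.2 h).symm
  · intro j _ hj
    by_cases hcj : c j = 0
    · rw [hcj, mul_zero]
    by_cases hjτ : (j : ℕ) ≤ τ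
    · have hjE : j ∈ E' := by
        simp only [hE', Finset.mem_erase, Finset.mem_filter]
        exact ⟨hj, (h0 j hcj).resolve_right (by omega), hjτ⟩
      have : u.eval (x j) = 0 := Lagrange.eval_nodal_at_node (v := fun j : Fin _ => x j) hjE
      simp [subfieldCheck, this]
    · simp [subfieldCheck,
        eval_tailPoly_eq_zero (x := x) (δ := δ) (not_le.1 hjτ) (Nat.lt_succ_iff.1 j.2),
        show ¬ (j : ℕ) ≤ δ by omega]
  · simp

theorem apply_eq_zero_of_body_erasure (hx : Set.InjOn x (Set.Iic τ))
    (hx' : Set.InjOn x (Set.Ioc δ (τ + δ))) (hα : ∀ k : K, algebraMap K F k ≠ α)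
    (hτ : s + δ < τ) (hc : c ∈ streamingCode x α s δ τ) {ℓ : Fin (τ + δ + 1)}
    (hℓ : (ℓ : ℕ) ≤ δ) {E : Finset (Fin (τ + δ + 1))} (hℓE : ℓ ∈ E) (hcard : E.card ≤ s + 1)
    (hE : ∀ j ∈ E, (j : ℕ) ≤ τ)
    (h0 : ∀ j, c j ≠ 0 → j ∈ E ∨ (ℓ : ℕ) + τ < j) : c ℓ = 0 := by
  classical
  set p := burstPoly x s δ τ ℓ with hp
  set r : Fin (τ + δ + 1) → K := fun j =>
    if (j : ℕ) ≤ δ then 0 else p.eval (x j) / (tailPoly x δ τ).eval (x j) with hr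
  have hinj : Set.InjOn (fun j : Fin (τ + δ + 1) => x j) (E.erase ℓ : Finset _) :=
    fun i hi j hj h => Fin.ext <|
      hx (hE i (Finset.mem_of_mem_erase hi)) (hE j (Finset.mem_of_mem_erase hj)) h
  set u : K[X] := Lagrange.interpolate (E.erase ℓ) (fun j => x j) r with hu
  have hudeg : u.degree < s := by
    refine (Lagrange.degree_interpolate_lt r hinj).trans_le ?_
    have := Finset.card_erase_add_one hℓE
    exact_mod_cast (by omega : (E.erase ℓ).card ≤ s)
  have hsum := sum_subfieldCheck_eq_zero hc hudeg
  have hburst := sum_burstCheck_eq_zero hc hℓ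
  have hdiff : ∑ j : Fin (τ + δ + 1),
      algebraMap K F (burstCheck x s δ τ ℓ j - subfieldCheck x δ τ u j) * c j =
      algebraMap K F (-u.eval (x ℓ)) * c ℓ := by
    rw [Finset.sum_eq_single ℓ]
    · simp [burstCheck, subfieldCheck, hℓ]
    · intro j _ hj
      by_cases hcj : c j = 0
      · rw [hcj, mul_zero]
      have hz : burstCheck x s δ τ ℓ j - subfieldCheck x δ τ u j = 0 := by
        rcases h0 j hcj with hjE | hjτ
        · have hev : u.eval (x j) = r j :=
            Lagrange.eval_interpolate_at_node r hinj (Finset.mem_erase.2 ⟨hj, hjE⟩)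
          by_cases hjδ : (j : ℕ) ≤ δ
          · simp [burstCheck, subfieldCheck, hjδ, hev, hr]
          · have := eval_tailPoly_ne_zero hx' (not_le.1 hjδ) (hE j hjE)
            simp [burstCheck, subfieldCheck, hjδ, hev, hr, ← hp, this]
        · have h1 : ¬ (j : ℕ) ≤ δ := by omega
          have h2 := eval_tailPoly_eq_zero (x := x) (δ := δ) (show τ < (j : ℕ) by omega)
            (by omega)
          have h3 := eval_burstPoly_eq_zero (x := x) (s := s) (δ := δ) (τ := τ) (i := ℓ)
            (j := j) (by simp only [burstZeros, Finset.mem_union, Finset.mem_Ioc]; omega)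
          simp [burstCheck, subfieldCheck, h1, h2, h3]
      rw [hz, map_zero, zero_mul]
    · simp
  simp only [map_sub, sub_mul, Finset.sum_sub_distrib, hsum, sub_zero] at hdiff
  rw [hdiff, ← add_mul] at hburst
  refine (mul_eq_zero.1 hburst).resolve_left fun h => hα (u.eval (x ℓ)) ?_
  rw [map_neg] at h
  exact (eq_of_sub_eq_zero (by rw [sub_eq_add_neg, h])).symm

theorem apply_eq_zero_of_burst (hc : c ∈ streamingCode x α s δ τ) (hα : α ≠ 0)
    {ℓ : Fin (τ + δ + 1)} (hℓ : (ℓ : ℕ) ≤ δ)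
    (h0 : ∀ j : Fin (τ + δ + 1), (ℓ : ℕ) + (s + 1 + δ) ≤ j → (j : ℕ) ≤ ℓ + τ → c j = 0) :
    c ℓ = 0 := by
  have h := sum_burstCheck_eq_zero hc hℓ
  rw [Finset.sum_eq_zero, add_zero] at h
  · exact (mul_eq_zero.1 h).resolve_left hα
  · intro j _
    by_cases hj : (ℓ : ℕ) + (s + 1 + δ) ≤ j ∧ (j : ℕ) ≤ ℓ + τ
    · rw [h0 j hj.1 hj.2, mul_zero]
    · by_cases hjδ : (j : ℕ) ≤ δ
      · simp [burstCheck, hjδ]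
      · have := eval_burstPoly_eq_zero (x := x) (s := s) (δ := δ) (τ := τ) (i := ℓ)
          (j := j) (by simp only [burstZeros, Finset.mem_union, Finset.mem_Ioc]; omega)
        simp [burstCheck, hjδ, this]

/-- On codewords vanishing up to coordinate `δ`, all polynomials of degree at most `s + δ`
give valid parity checks. -/
theorem sum_eval_eq_zero (hx : Set.InjOn x (Set.Ioc δ (τ + δ))) (hτ : s + δ < τ)
    (hc : c ∈ streamingCode x α s δ τ) (h0 : ∀ j : Fin (τ + δ + 1), (j : ℕ) ≤ δ → c j = 0)
    {f : K[X]} (hf : f.natDegree ≤ s + δ) :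
    ∑ j : Fin (τ + δ + 1), algebraMap K F (f.eval (x j)) * c j = 0 := by
  have hP (i : ℕ) (hi : i ≤ δ) :
      ∑ j : Fin (τ + δ + 1), algebraMap K F ((burstPoly x s δ τ i).eval (x j)) * c j = 0 := by
    have h := sum_burstCheck_eq_zero hc (i := ⟨i, by omega⟩) hi
    rw [h0 _ hi, mul_zero, zero_add] at h
    rw [← h]
    refine Finset.sum_congr rfl fun j _ => ?_
    by_cases hj : (j : ℕ) ≤ δ
    · simp [h0 j hj]
    · simp [burstCheck, hj]
  have hQ (u : K[X]) (hu : u.degree < s) : ∑ j : Fin (τ + δ + 1),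
      algebraMap K F ((u * tailPoly x δ τ).eval (x j)) * c j = 0 := by
    rw [← sum_subfieldCheck_eq_zero hc hu]
    refine Finset.sum_congr rfl fun j _ => ?_
    by_cases hj : (j : ℕ) ≤ δ
    · simp [h0 j hj]
    · simp [subfieldCheck, hj]
  have hlin (p g : K[X]) (k : K)
      (hp : ∑ j : Fin (τ + δ + 1), algebraMap K F (p.eval (x j)) * c j = 0)
      (hg : ∑ j : Fin (τ + δ + 1), algebraMap K F ((g - C k * p).eval (x j)) * c j = 0) :
      ∑ j : Fin (τ + δ + 1), algebraMap K F (g.eval (x j)) * c j = 0 := by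
    simpa [sub_mul, mul_assoc, ← Finset.mul_sum, hp] using hg
  have key (k : ℕ) (hk : k ≤ δ) : ∀ f : K[X], f.natDegree ≤ s + δ →
      (∀ i ∈ Finset.Ioc (τ + k) (τ + δ), f.eval (x i) = 0) →
      ∑ j : Fin (τ + δ + 1), algebraMap K F (f.eval (x j)) * c j = 0 := by
    induction k with
    | zero =>
      intro f hf hz
      have hdvd : tailPoly x δ τ ∣ f := by
        refine nodal_dvd_of_eval_eq_zero (hx.mono fun i hi => ?_) hz
        have := Finset.mem_Ioc.1 hi
        exact ⟨by omega, by omega⟩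
      obtain ⟨v, rfl⟩ := hdvd
      set w : K[X] := Lagrange.nodal (Finset.Ioc δ (s + δ)) x with hw
      have hwdeg : w.natDegree = s := by
        rw [hw, Lagrange.natDegree_nodal, Nat.card_Ioc, Nat.add_sub_cancel]
      refine hlin (burstPoly x s δ τ 0) _ (v.coeff s) (hP 0 (Nat.zero_le _)) ?_
      rw [burstPoly_zero hτ, ← hw, show tailPoly x δ τ * v - C (v.coeff s) * (tailPoly x δ τ * w)
        = (v - C (v.coeff s) * w) * tailPoly x δ τ by ring]
      refine hQ _ ?_
      have hv : v.natDegree ≤ s := by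
        rcases eq_or_ne v 0 with rfl | hv
        · simp
        have htail : (tailPoly x δ τ).natDegree = δ := by
          rw [tailPoly, Lagrange.natDegree_nodal, Nat.card_Ioc, Nat.add_sub_cancel_left]
        rw [natDegree_mul (p := tailPoly x δ τ) Lagrange.nodal_ne_zero hv, htail] at hf
        omega
      rw [degree_lt_iff_coeff_zero]
      intro m hm
      rcases hm.eq_or_lt with rfl | hm
      · have hlead : w.coeff w.natDegree = 1 := (Lagrange.nodal_monic : w.Monic)
        rw [hwdeg] at hlead
        simp [hlead]
      · rw [coeff_sub, coeff_C_mul, coeff_eq_zero_of_natDegree_lt (by omega),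
          coeff_eq_zero_of_natDegree_lt (p := w) (by omega), mul_zero, sub_zero]
    | succ k ih =>
      intro f hf hz
      set p := burstPoly x s δ τ (k + 1) with hp
      have hne : p.eval (x (τ + (k + 1))) ≠ 0 := by
        refine eval_burstPoly_ne_zero hx hk hτ (by omega) (by omega) ?_
        simp only [burstZeros, Finset.mem_union, Finset.mem_Ioc]
        omega
      refine hlin p f (f.eval (x (τ + (k + 1))) / p.eval (x (τ + (k + 1)))) (hP _ hk)
        (ih (by omega) _ ?_ ?_)
      · refine (natDegree_sub_le _ _).trans (max_le hf ((natDegree_C_mul_le _ _).trans ?_))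
        exact (natDegree_burstPoly hk hτ).le
      · intro i hi
        rw [Finset.mem_Ioc] at hi
        rcases eq_or_ne i (τ + (k + 1)) with rfl | hik
        · simp [div_mul_cancel₀ _ hne]
        · have hi' : i ∈ Finset.Ioc (τ + (k + 1)) (τ + δ) := Finset.mem_Ioc.2 ⟨by omega, hi.2⟩
          have : p.eval (x i) = 0 := eval_burstPoly_eq_zero (Finset.mem_union_right _ hi')
          simp [hz i hi', this]
  exact key δ le_rfl f hf (by simp)

theorem apply_eq_zero_of_late_erasure (hx : Set.InjOn x (Set.Ioc δ (τ + δ))) (hτ : s + δ < τ)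
    (hc : c ∈ streamingCode x α s δ τ) {ℓ : Fin (τ + δ + 1)} (hℓ : δ < (ℓ : ℕ))
    {E : Finset (Fin (τ + δ + 1))} (hℓE : ℓ ∈ E) (hcard : E.card ≤ s + 1 + δ)
    (hE : ∀ j ∈ E, ℓ ≤ j) (h0 : ∀ j, j ∉ E → c j = 0) : c ℓ = 0 := by
  classical
  have hδ (j : Fin (τ + δ + 1)) (hj : (j : ℕ) ≤ δ) : c j = 0 :=
    h0 j fun h => by have := Fin.le_def.1 (hE j h); omega
  set f : K[X] := Lagrange.nodal (E.erase ℓ) fun j => x j with hf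
  have hfdeg : f.natDegree ≤ s + δ := by
    rw [hf, Lagrange.natDegree_nodal]
    have := Finset.card_erase_add_one hℓE
    omega
  have hsum := sum_eval_eq_zero hx hτ hc hδ hfdeg
  rw [Finset.sum_eq_single ℓ] at hsum
  · refine (mul_eq_zero.1 hsum).resolve_left ?_
    rw [map_eq_zero]
    refine Lagrange.eval_nodal_not_at_node fun i hi h => ?_
    have hi' := Fin.le_def.1 (hE i (Finset.mem_of_mem_erase hi))
    exact Finset.ne_of_mem_erase hi (Fin.ext
      (hx ⟨hℓ, Nat.lt_succ_iff.1 (by omega)⟩ ⟨by omega, by omega⟩ h)).symm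
  · intro j _ hj
    by_cases hjE : j ∈ E
    · have : f.eval (x j) = 0 := Lagrange.eval_nodal_at_node (v := fun j : Fin _ => x j)
        (Finset.mem_erase.2 ⟨hj, hjE⟩)
      rw [this, map_zero, zero_mul]
    · rw [h0 j hjE, mul_zero]
  · simp

theorem delayRecoverable_streamingCode (hx : Set.InjOn x (Set.Iic τ))
    (hx' : Set.InjOn x (Set.Ioc δ (τ + δ))) (hα : ∀ k : K, algebraMap K F k ≠ α)
    (hτ : s + δ < τ) :
    DelayRecoverable (s + 1) (s + 1 + δ) τ (streamingCode x α s δ τ) := by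
  classical
  have hα0 : α ≠ 0 := fun h => hα 0 (by rw [map_zero, h])
  refine ⟨fun ℓ c c' hc hc' hlt hge => ?_, fun ℓ E hℓE hE hcard c c' hc hc' hlt hge => ?_⟩
  · rw [← sub_eq_zero, ← Pi.sub_apply]
    have hd := sub_mem hc hc'
    by_cases hℓ : (ℓ : ℕ) ≤ δ
    · exact apply_eq_zero_of_burst hd hα0 hℓ fun j h1 h2 => sub_eq_zero.2 (hge j h1 h2)
    · refine apply_eq_zero_of_late_erasure hx' hτ hd (not_le.1 hℓ)
        (E := Finset.univ.filter fun j => (ℓ : ℕ) ≤ j ∧ (j : ℕ) < ℓ + (s + 1 + δ)) ?_ ?_ ?_ ?_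
      · simp
      · rw [← Finset.card_map Fin.valEmbedding]
        refine (Finset.card_le_card (t := Finset.Ico (ℓ : ℕ) (ℓ + (s + 1 + δ))) ?_).trans ?_
        · intro j hj
          simp only [Finset.mem_map, Finset.mem_filter, Fin.valEmbedding_apply] at hj
          obtain ⟨i, hi, rfl⟩ := hj
          exact Finset.mem_Ico.2 hi.2
        · simp
      · intro j hj
        exact (Finset.mem_filter.1 hj).2.1
      · intro j hj
        simp only [Finset.mem_filter, Finset.mem_univ, true_and, not_and, not_lt] at hj
        refine sub_eq_zero.2 ?_
        rcases lt_or_ge (j : ℕ) ℓ with h | h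
        · exact hlt j h
        · exact hge j (hj h) (by omega)
  · rw [← sub_eq_zero, ← Pi.sub_apply]
    have hd := sub_mem hc hc'
    have h0 (j : Fin (τ + δ + 1)) (hj : (c - c') j ≠ 0) : j ∈ E ∨ (ℓ : ℕ) + τ < j := by
      by_contra! h
      refine hj (sub_eq_zero.2 ?_)
      rcases lt_trichotomy (j : ℕ) ℓ with h' | h' | h'
      · exact hlt j h'
      · exact absurd (Fin.ext h' ▸ hℓE) h.1
      · exact hge j h' h.2 h.1
    by_cases hℓ : (ℓ : ℕ) ≤ δ
    · by_cases ht : ∃ e ∈ E, τ < (e : ℕ)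
      · obtain ⟨e, heE, he⟩ := ht
        exact apply_eq_zero_of_tail_erasure hx hτ hd hℓ hℓE hcard heE he h0
      · push Not at ht
        exact apply_eq_zero_of_body_erasure hx hx' hα hτ hd hℓ hℓE hcard ht h0
    · refine apply_eq_zero_of_late_erasure hx' hτ hd (not_le.1 hℓ) hℓE (by omega)
        (fun j hj => (hE j hj).1) fun j hj => ?_
      by_contra h
      rcases h0 j h with h | h
      · exact hj h
      · omega

end StreamingCode

/-- Burst recovery alone bounds the dimension: a codeword is determined by its coordinates
outside the last `b`. -/
theorem DelayRecoverable.finrank_le {F : Type*} [Field F] {n a b τ : ℕ}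
    {C : Submodule F (Fin n → F)} (hC : DelayRecoverable a b τ C) :
    Module.finrank F C ≤ n - b := by
  let π : C →ₗ[F] (Fin (n - b) → F) :=
    (LinearMap.funLeft F F (Fin.castLE (Nat.sub_le n b))).comp C.subtype
  have hπ : Function.Injective π := by
    rw [← LinearMap.ker_eq_bot, LinearMap.ker_eq_bot']
    rintro ⟨c, hc⟩ hπc
    have hzero (m : ℕ) (hm : m < n) : c ⟨m, hm⟩ = 0 := by
      induction m using Nat.strong_induction_on with
      | _ m ih =>
        by_cases hmb : m < n - b
        · exact congrFun hπc ⟨m, hmb⟩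
        · refine hC.1 ⟨m, hm⟩ c 0 hc C.zero_mem (fun j hj => ih j hj j.2) fun j hj => ?_
          have := j.2
          simp only at hj
          omega
    exact Subtype.ext (funext fun j => hzero j j.2)
  simpa using LinearMap.finrank_le_finrank_of_injective hπ

theorem exists_injOn_Iic_injOn_Ioc {K : Type*} [Fintype K] {δ τ : ℕ} (hδ : δ ≤ τ)
    (h : τ + 1 ≤ Fintype.card K) :
    ∃ x : ℕ → K, Set.InjOn x (Set.Iic τ) ∧ Set.InjOn x (Set.Ioc δ (τ + δ)) := by
  obtain ⟨e⟩ : Nonempty (Fin (τ + 1) ↪ K) :=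
    Function.Embedding.nonempty_of_card_le (by simpa using h)
  refine ⟨fun j => if hj : j ≤ τ then e ⟨j, by omega⟩ else e ⟨(j - τ) % (τ + 1),
    Nat.mod_lt _ (by omega)⟩, ?_, ?_⟩
  · intro i hi j hj hij
    simpa [Set.mem_Iic.1 hi, Set.mem_Iic.1 hj] using hij
  · rintro i ⟨hi, hi'⟩ j ⟨hj, hj'⟩ hij
    have hmod (m : ℕ) (hm : m ≤ τ + δ) : (m - τ) % (τ + 1) = m - τ :=
      Nat.mod_eq_of_lt (by omega)
    dsimp only at hij
    split_ifs at hij <;> simp [hmod i hi', hmod j hj'] at hij <;> omega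

theorem exists_subfield_of_card_eq_sq {q : ℕ} (hq : IsPrimePow q) (F : Type*) [Field F]
    [Fintype F] (hF : Fintype.card F = q ^ 2) : ∃ K : Subfield F, Nat.card K = q := by
  obtain ⟨p, k, hp, hk, rfl⟩ := hq
  have : Fact p.Prime := ⟨hp.nat_prime⟩
  rw [← pow_mul] at hF
  have : CharP F p := charP_of_card_eq_prime_pow hF
  let := ZMod.algebra F p
  have hrank : Module.finrank (ZMod p) F = k * 2 := by
    have := FiniteField.pow_finrank_eq_card p F
    rw [hF] at this
    exact Nat.pow_right_injective hp.nat_prime.two_le this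
  obtain ⟨f⟩ := FiniteField.nonempty_algHom_of_finrank_dvd (F := ZMod p) (K := GaloisField p k)
    (L := F) (by rw [hrank, GaloisField.finrank p hk.ne']; exact dvd_mul_right _ _)
  refine ⟨f.toRingHom.fieldRange, ?_⟩
  rw [← GaloisField.card p k hk.ne']
  exact Nat.card_congr (Equiv.ofInjective f f.injective).symm

/-- Construction A.  For all `1 ≤ a ≤ b ≤ τ` and every prime power
`q ≥ τ + 1`, there is a linear code of length `n = τ + b - a + 1` and dimension
`τ - a + 1` over the field with `q²` elements that is `(a,b,τ)`-delay-recoverable. -/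
theorem statement9 (a b τ q : ℕ) (ha : 1 ≤ a) (hab : a ≤ b) (hbτ : b ≤ τ)
    (hq : IsPrimePow q) (hqτ : τ + 1 ≤ q)
    (F : Type*) [Field F] [Fintype F] (hF : Fintype.card F = q ^ 2) :
    ∃ C : Submodule F (Fin (τ + b - a + 1) → F),
      Module.finrank F C = τ - a + 1 ∧ DelayRecoverable a b τ C := by
  obtain ⟨s, rfl⟩ : ∃ s, a = s + 1 := ⟨a - 1, by omega⟩
  obtain ⟨δ, rfl⟩ := Nat.exists_eq_add_of_le hab
  obtain ⟨K, hK⟩ := exists_subfield_of_card_eq_sq hq F hF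
  obtain ⟨α, hα⟩ : ∃ α : F, α ∉ K := by
    by_contra! h
    have htop : K = ⊤ := eq_top_iff.2 fun y _ => h y
    have hcard : Nat.card K = Fintype.card F := by
      rw [htop, ← Nat.card_eq_fintype_card]
      exact Nat.card_congr Subfield.topEquiv.toEquiv
    have := hq.one_lt
    rw [hK, hF] at hcard
    nlinarith
  have := Fintype.ofFinite K
  obtain ⟨x, hx, hx'⟩ := exists_injOn_Iic_injOn_Ioc (K := K) (δ := δ) (τ := τ) (by omega)
    (by rw [← Nat.card_eq_fintype_card, hK]; exact hqτ)
  have hN : τ + (s + 1 + δ) - (s + 1) = τ + δ := by omega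
  rw [hN]
  have hrec := delayRecoverable_streamingCode (F := F) (α := α) (s := s) hx hx'
    (fun k h => hα (by rw [← h]; exact k.2)) (by omega : s + δ < τ)
  refine ⟨streamingCode x α s δ τ, ?_, hrec⟩
  have h1 := hrec.finrank_le
  have h2 := card_sub_le_finrank_streamingCode (x := x) (α := α) (s := s) (δ := δ) (τ := τ)
  omega
end

section
/- For all integers a ≥ 1 and τ with a+1 ≤ τ, and every prime power q ≥ τ+1, there exists a linear code C of length n = τ+2 and dimension τ-a+1 over the finite field with q elements that is (a, a+1, τ)-delay-recoverable. -/
open Polynomial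

/-- Over a field with more than `card ι` elements, some functional kills `w` and is nonzero on
every member of a family `v` avoiding the line through `w`. -/
lemma exists_dual_apply_eq_zero_and_forall_apply_ne_zero {ι K V : Type*} [Fintype ι] [Field K]
    [AddCommGroup V] [Module K V] (v : ι → V) (w : V)
    (hv : ∀ i, v i ∉ Submodule.span K {w}) (hcard : (Fintype.card ι : ℕ∞) < ENat.card K) :
    ∃ φ : V →ₗ[K] K, φ w = 0 ∧ ∀ i, φ (v i) ≠ 0 := by
  let W : Submodule K (V →ₗ[K] K) := LinearMap.ker (Module.Dual.eval K V w)
  let p : ι → Submodule K W := fun i ↦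
    LinearMap.ker ((Module.Dual.eval K V (v i)).domRestrict W)
  have hp : ∀ i, p i ≠ ⊤ := by
    intro i hi
    obtain ⟨f, hfv, hf⟩ := Submodule.exists_le_ker_of_notMem (hv i)
    have hfW : f ∈ W := hf (Submodule.mem_span_singleton_self w)
    have hmem : (⟨f, hfW⟩ : W) ∈ p i := hi ▸ Submodule.mem_top
    exact hfv hmem
  have hss := Submodule.iUnion_ssubset_of_forall_ne_top_of_card_lt (K := K) (M := W)
    Finset.univ p hp
    (by simpa using hcard)
  obtain ⟨φ, -, hφ⟩ := Set.exists_of_ssubset hss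
  refine ⟨φ.1, φ.2, fun i hi ↦ hφ ?_⟩
  simp only [Set.mem_iUnion]
  exact ⟨i, Finset.mem_univ i, hi⟩

section EvaluationCode

variable {F ι : Type*} [Field F] (x : ι ↪ F)

lemma eq_zero_of_mem_degreeLT_of_eval_eq_zero {k : ℕ} {p : F[X]} (hp : p ∈ degreeLT F k)
    {S : Finset ι} (hS : k ≤ S.card) (h : ∀ j ∈ S, p.eval (x j) = 0) : p = 0 := by
  refine eq_zero_of_degree_lt_of_eval_index_eq_zero S x.injective.injOn ?_ h
  exact (mem_degreeLT.1 hp).trans_le (by exact_mod_cast hS)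

lemma eval_nodal_ne_zero {S : Finset ι} {i : ι} (hi : i ∉ S) :
    (Lagrange.nodal S x).eval (x i) ≠ 0 :=
  Lagrange.eval_nodal_not_at_node fun _ hj h ↦ hi (x.injective h ▸ hj)

lemma eq_smul_nodal_of_eval_eq_zero {k : ℕ} {p : F[X]} (hp : p ∈ degreeLT F k)
    {S : Finset ι} (hS : S.card + 1 = k) (h : ∀ j ∈ S, p.eval (x j) = 0) {i : ι} (hi : i ∉ S) :
    p = (p.eval (x i) / (Lagrange.nodal S x).eval (x i)) • Lagrange.nodal S x := by
  classical
  have hN : Lagrange.nodal S x ∈ degreeLT F k := by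
    rw [mem_degreeLT, Lagrange.degree_nodal, ← hS]
    exact_mod_cast Nat.lt_succ_self _
  refine sub_eq_zero.1 (eq_zero_of_mem_degreeLT_of_eval_eq_zero x
    (sub_mem hp (Submodule.smul_mem _ _ hN)) (S := insert i S) ?_ ?_)
  · rw [Finset.card_insert_of_notMem hi, hS]
  · intro j hj
    rcases Finset.mem_insert.1 hj with rfl | hj
    · simp [div_mul_cancel₀ _ (eval_nodal_ne_zero x hi)]
    · simp [h j hj, Lagrange.eval_nodal_at_node hj]

end EvaluationCode

section ExtendedCode

variable {F : Type*} [Field F] {m : ℕ}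

/-- Evaluation at the points `x`, preceded by the value of the functional `φ`. -/
noncomputable def extendedEval (φ : F[X] →ₗ[F] F) (x : Fin m ↪ F) : F[X] →ₗ[F] (Fin (m + 1) → F) :=
  LinearMap.pi (Fin.cons φ fun i ↦ leval (x i))

@[simp]
lemma extendedEval_zero (φ : F[X] →ₗ[F] F) (x : Fin m ↪ F) (p : F[X]) :
    extendedEval φ x p 0 = φ p := rfl

@[simp]
lemma extendedEval_succ (φ : F[X] →ₗ[F] F) (x : Fin m ↪ F) (p : F[X]) (i : Fin m) :
    extendedEval φ x p i.succ = p.eval (x i) := rfl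

lemma finrank_map_extendedEval (φ : F[X] →ₗ[F] F) (x : Fin m ↪ F) {k : ℕ} (hk : k ≤ m) :
    Module.finrank F ((degreeLT F k).map (extendedEval φ x)) = k := by
  have hinj : Function.Injective ((extendedEval φ x).domRestrict (degreeLT F k)) := by
    rw [injective_iff_map_eq_zero]
    rintro ⟨p, hp⟩ h
    refine Subtype.ext (eq_zero_of_mem_degreeLT_of_eval_eq_zero x hp (S := Finset.univ)
      (by simpa using hk) fun j _ ↦ ?_)
    exact congrFun h j.succ
  rw [← LinearMap.range_domRestrict, LinearMap.finrank_range_of_inj hinj,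
    (degreeLTEquiv F k).finrank_eq, Module.finrank_fin_fun]

end ExtendedCode

/-- For a linear code, delay-recoverability only has to be checked against the zero codeword. -/
lemma delayRecoverable_of_forall_eq_zero {F : Type*} [Field F] {n a b τ : ℕ}
    {C : Submodule F (Fin n → F)}
    (hburst : ∀ (ℓ : Fin n), ∀ c ∈ C, (∀ j : Fin n, (j : ℕ) < ℓ → c j = 0) →
      (∀ j : Fin n, (ℓ : ℕ) + b ≤ j → (j : ℕ) ≤ ℓ + τ → c j = 0) → c ℓ = 0)
    (hrandom : ∀ (ℓ : Fin n) (E : Finset (Fin n)), ℓ ∈ E → E.card ≤ a → ∀ c ∈ C,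
      (∀ j : Fin n, (j : ℕ) < ℓ → c j = 0) →
      (∀ j : Fin n, (ℓ : ℕ) < j → (j : ℕ) ≤ ℓ + τ → j ∉ E → c j = 0) → c ℓ = 0) :
    DelayRecoverable a b τ C := by
  constructor
  · intro ℓ c c' hc hc' h₁ h₂
    exact sub_eq_zero.1 (hburst ℓ (c - c') (sub_mem hc hc')
      (fun j hj ↦ sub_eq_zero.2 (h₁ j hj)) fun j hj hj' ↦ sub_eq_zero.2 (h₂ j hj hj'))
  · intro ℓ E hE _ hcard c c' hc hc' h₁ h₂
    exact sub_eq_zero.1 (hrandom ℓ E hE hcard (c - c') (sub_mem hc hc')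
      (fun j hj ↦ sub_eq_zero.2 (h₁ j hj)) fun j hj hj' hjE ↦ sub_eq_zero.2 (h₂ j hj hj' hjE))

/-- The positions outside the window `{i, ..., i + a}`. -/
def windowCompl (τ a i : ℕ) : Finset (Fin (τ + 1)) :=
  {j | (j : ℕ) < i ∨ i + a < j}

lemma card_windowCompl {τ a i : ℕ} (h : i + a ≤ τ) : (windowCompl τ a i).card = τ - a := by
  have : windowCompl τ a i =
      (Finset.Icc (⟨i, by omega⟩ : Fin (τ + 1)) ⟨i + a, by omega⟩)ᶜ := by
    ext j
    simp [windowCompl, Fin.le_def]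
    omega
  rw [this, Finset.card_compl, Fin.card_Icc, Fintype.card_fin]
  simp only
  omega

/-- The positions `{a, ..., τ - 1}`. -/
def middleBlock (τ a : ℕ) : Finset (Fin (τ + 1)) :=
  {j | a ≤ (j : ℕ) ∧ (j : ℕ) < τ}

lemma card_middleBlock {τ a : ℕ} (h : a ≤ τ) : (middleBlock τ a).card = τ - a := by
  have : middleBlock τ a = Finset.Ico (⟨a, by omega⟩ : Fin (τ + 1)) ⟨τ, by omega⟩ := by
    ext j
    simp [middleBlock, Fin.le_def, Fin.lt_def]
  rw [this, Fin.card_Ico]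

lemma nodal_windowCompl_notMem_span {F : Type*} [Field F] {τ a i : ℕ} (haτ : a < τ)
    (x : Fin (τ + 1) ↪ F) (hi : i + a ≤ τ) (ha : 1 ≤ a) :
    Lagrange.nodal (windowCompl τ a i) x ∉
      Submodule.span F {Lagrange.nodal (middleBlock τ a) x} := by
  rw [Submodule.mem_span_singleton]
  rintro ⟨c, hc⟩
  have hlt : max i a < τ + 1 := by omega
  have hmid : (⟨max i a, hlt⟩ : Fin (τ + 1)) ∈ middleBlock τ a := by
    simp [middleBlock]; omega
  have hwin : (⟨max i a, hlt⟩ : Fin (τ + 1)) ∉ windowCompl τ a i := by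
    simp [windowCompl]
  apply eval_nodal_ne_zero x hwin
  rw [← hc, eval_smul, Lagrange.eval_nodal_at_node hmid, smul_zero]

lemma card_filter_succ_notMem {m : ℕ} (E : Finset (Fin (m + 1))) :
    m ≤ (Finset.univ.filter fun j : Fin m ↦ j.succ ∉ E).card + (E.erase 0).card := by
  have h := Finset.card_filter_add_card_filter_not (s := (Finset.univ : Finset (Fin m)))
    (fun j ↦ j.succ ∈ E)
  have h' : (Finset.univ.filter fun j : Fin m ↦ j.succ ∈ E).card ≤ (E.erase 0).card :=
    Finset.card_le_card_of_injOn Fin.succ (fun j hj ↦ by simpa using hj)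
      (Fin.succ_injective m).injOn
  rw [Finset.card_univ, Fintype.card_fin] at h
  omega

lemma delayRecoverable_map_extendedEval {F : Type*} [Field F] {τ a : ℕ} (ha : 1 ≤ a)
    (haτ : a < τ) (x : Fin (τ + 1) ↪ F) (φ : F[X] →ₗ[F] F)
    (hφ : φ (Lagrange.nodal (middleBlock τ a) x) = 0)
    (hφ' : ∀ i, i + a ≤ τ → φ (Lagrange.nodal (windowCompl τ a i) x) ≠ 0) :
    DelayRecoverable a (a + 1) τ ((degreeLT F (τ - a + 1)).map (extendedEval φ x)) := by
  refine delayRecoverable_of_forall_eq_zero ?_ ?_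
  · rintro ℓ _ ⟨p, hp, rfl⟩ h₁ h₂
    cases ℓ using Fin.cases with
    | zero =>
      have hp' := eq_smul_nodal_of_eval_eq_zero x hp (S := middleBlock τ a)
        (by rw [card_middleBlock haτ.le]) (fun j hj ↦ ?_) (i := Fin.last τ)
        (by simp [middleBlock])
      · rw [extendedEval_zero, hp', map_smul, hφ, smul_zero]
      · simp only [middleBlock, Finset.mem_filter_univ] at hj
        exact h₂ j.succ (by simp; omega) (by simp; omega)
    | succ i =>
      rw [extendedEval_succ]
      by_cases hi : (i : ℕ) + a ≤ τ
      · have hiS : i ∉ windowCompl τ a i := by simp [windowCompl]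
        have hp' := eq_smul_nodal_of_eval_eq_zero x hp (S := windowCompl τ a i)
          (by rw [card_windowCompl hi]) (fun j hj ↦ ?_) hiS
        · have h₀ : φ p = 0 := h₁ 0 (by simp)
          rw [hp', map_smul, smul_eq_mul, mul_eq_zero, or_iff_left (hφ' i hi), div_eq_zero_iff,
            or_iff_left (eval_nodal_ne_zero x hiS)] at h₀
          exact h₀
        · simp only [windowCompl, Finset.mem_filter_univ] at hj
          rcases hj with hj | hj
          · exact h₁ j.succ (by simpa using hj)
          · exact h₂ j.succ (by simp; omega) (by simp; omega)
      · rw [eq_zero_of_mem_degreeLT_of_eval_eq_zero x hp (S := Finset.Iio i)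
          (by rw [Fin.card_Iio]; omega) fun j hj ↦ h₁ j.succ (by simpa using hj), eval_zero]
  · rintro ℓ E hE hcard _ ⟨p, hp, rfl⟩ h₁ h₂
    have hlarge := card_filter_succ_notMem E
    suffices p = 0 by simp [this]
    cases ℓ using Fin.cases with
    | zero =>
      refine eq_zero_of_mem_degreeLT_of_eval_eq_zero x hp
        (S := (Finset.univ.filter fun j : Fin (τ + 1) ↦ j.succ ∉ E).erase (Fin.last τ)) ?_ ?_
      · have := Finset.pred_card_le_card_erase (a := Fin.last τ)
          (s := Finset.univ.filter fun j : Fin (τ + 1) ↦ j.succ ∉ E)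
        rw [Finset.card_erase_of_mem hE] at hlarge
        omega
      · intro j hj
        simp only [Finset.mem_erase, Finset.mem_filter_univ] at hj
        have := Fin.val_lt_last hj.1
        exact h₂ j.succ (by simp) (by simp; omega) hj.2
    | succ i =>
      refine eq_zero_of_mem_degreeLT_of_eval_eq_zero x hp
        (S := Finset.univ.filter fun j : Fin (τ + 1) ↦ j.succ ∉ E) ?_ ?_
      · have := Finset.card_erase_le (s := E) (a := 0)
        omega
      · intro j hj
        simp only [Finset.mem_filter_univ] at hj
        rcases lt_trichotomy j i with hji | rfl | hji
        · exact h₁ j.succ (by simpa using hji)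
        · exact absurd hE hj
        · exact h₂ j.succ (by simpa using hji) (by simp; omega) hj

/-- Construction A for `b - a = 1`, linear field size.  For all
`a ≥ 1`, `τ ≥ a + 1` and every prime power `q ≥ τ + 1`, there is a linear code of
length `n = τ + 2` and dimension `τ - a + 1` over the field with `q` elements that
is `(a, a+1, τ)`-delay-recoverable. -/
theorem statement10 (a τ q : ℕ) (ha : 1 ≤ a) (haτ : a + 1 ≤ τ)
    (hq : IsPrimePow q) (hqτ : τ + 1 ≤ q)
    (F : Type*) [Field F] [Fintype F] (hF : Fintype.card F = q) :
    ∃ C : Submodule F (Fin (τ + 2) → F),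
      Module.finrank F C = τ - a + 1 ∧ DelayRecoverable a (a + 1) τ C := by
  obtain ⟨x⟩ : Nonempty (Fin (τ + 1) ↪ F) :=
    Function.Embedding.nonempty_of_card_le (by simpa [hF] using hqτ)
  obtain ⟨φ, hφ, hφ'⟩ := exists_dual_apply_eq_zero_and_forall_apply_ne_zero (K := F)
    (fun i : Fin (τ - a + 1) ↦ Lagrange.nodal (windowCompl τ a i) x)
    (Lagrange.nodal (middleBlock τ a) x)
    (fun i ↦ nodal_windowCompl_notMem_span haτ x (by omega) ha)
    (by
      rw [ENat.card_eq_coe_fintype_card, hF, Fintype.card_fin]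
      exact_mod_cast (by omega : τ - a + 1 < q))
  exact ⟨_, finrank_map_extendedEval φ x (by omega), delayRecoverable_map_extendedEval ha haτ x φ hφ
    fun i hi ↦ hφ' ⟨i, by omega⟩⟩
end

section
/- For all integers 1 ≤ a ≤ b ≤ τ satisfying b - a ≥ a (i.e., b ≥ 2a) and τ + 1 ≥ b + (b-a), and every prime power q ≥ τ+1, there exists a linear code C of length n = τ+b-a+1 and dimension τ-a+1 over the finite field with q elements that is (a,b,τ)-delay-recoverable. -/
open Polynomial Lagrange

theorem Polynomial.degree_C_mul_lt {R : Type*} [Semiring R] (u : R) {p : R[X]} {d : WithBot ℕ}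
    (hp : p.degree < d) : (C u * p).degree < d := by
  rw [← smul_eq_C_mul]
  exact (degree_smul_le u p).trans_lt hp

section Construction

variable {F : Type*} [Field F] (a δ m : ℕ) (x : ℕ → F)

/-- The monic polynomial of degree `k` vanishing at the points `x (a + δ), …, x (a + δ + k - 1)`. -/
noncomputable def headNodal (k : ℕ) : F[X] := nodal (Finset.Ico (a + δ) (a + δ + k)) x

theorem headNodal_monic (k : ℕ) : (headNodal a δ x k).Monic := nodal_monic

theorem headNodal_natDegree (k : ℕ) : (headNodal a δ x k).natDegree = k := by
  simp [headNodal, natDegree_nodal]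

theorem headNodal_degree (k : ℕ) : (headNodal a δ x k).degree = k := by
  simp [headNodal, degree_nodal]

theorem headNodal_eval_eq_zero {k j : ℕ} (h₁ : a + δ ≤ j) (h₂ : j < a + δ + k) :
    (headNodal a δ x k).eval (x j) = 0 :=
  eval_nodal_at_node (Finset.mem_Ico.2 ⟨h₁, h₂⟩)

variable {a δ m x} in
theorem headNodal_eval_ne_zero (hx : Set.InjOn x (Set.Iio (a + δ + m))) {k j : ℕ} (hk : k ≤ m)
    (hj : j < a + δ + m) (h : j < a + δ ∨ a + δ + k ≤ j) :
    (headNodal a δ x k).eval (x j) ≠ 0 := by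
  refine eval_nodal_not_at_node fun i hi e => ?_
  rw [Finset.mem_Ico] at hi
  have := hx (Set.mem_Iio.2 hj) (Set.mem_Iio.2 (by omega)) e
  omega

/-- The polynomial multiplying the `i`-th auxiliary parameter, for `a ≤ i < δ`. -/
noncomputable def auxPoly (i : ℕ) : F[X] :=
  if i = a then headNodal a δ x a
  else if i < a + δ - i then headNodal a δ x i + headNodal a δ x (a + δ - i)
  else headNodal a δ x (a + δ - i)

theorem auxPoly_self : auxPoly a δ x a = headNodal a δ x a := if_pos rfl

variable {a δ}

theorem auxPoly_monic (i : ℕ) : (auxPoly a δ x i).Monic := by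
  unfold auxPoly
  split_ifs with h₁ h₂
  · exact headNodal_monic _ _ _ _
  · rw [add_comm]
    refine (headNodal_monic _ _ _ _).add_of_left ?_
    simp only [headNodal_degree]
    exact_mod_cast h₂
  · exact headNodal_monic _ _ _ _

theorem auxPoly_natDegree {i : ℕ} (hi : i ≠ a) :
    (auxPoly a δ x i).natDegree = a + δ - i := by
  unfold auxPoly
  rw [if_neg hi]
  split_ifs with h₂
  · rw [add_comm, natDegree_add_eq_left_of_natDegree_lt, headNodal_natDegree]
    simpa only [headNodal_natDegree] using h₂
  · exact headNodal_natDegree _ _ _ _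

theorem auxPoly_natDegree_self : (auxPoly a δ x a).natDegree = a := by
  rw [auxPoly_self, headNodal_natDegree]

/-- The auxiliary polynomials are linearly independent modulo polynomials of degree `< a`. -/
theorem auxPoly_independent {f : F[X]} (hf : f.degree < a) (s : ℕ → F)
    (h : f + ∑ i ∈ Finset.Ico a δ, C (s i) * auxPoly a δ x i = 0) :
    f = 0 ∧ ∀ i ∈ Finset.Ico a δ, s i = 0 := by
  have hfc : ∀ k, a ≤ k → f.coeff k = 0 := fun k hk =>
    coeff_eq_zero_of_degree_lt (hf.trans_le (by exact_mod_cast hk))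
  have hc : ∀ k, a ≤ k → ∑ i ∈ Finset.Ico a δ, s i * (auxPoly a δ x i).coeff k = 0 := by
    intro k hk
    have := congrArg (fun p => coeff p k) h
    simpa [finsetSum_coeff, hfc k hk] using this
  have hs : ∀ i, a < i → i < δ → s i = 0 := by
    intro i
    induction i using Nat.strong_induction_on with
    | _ i ih =>
      intro h₁ h₂
      have := hc (a + δ - i) (by omega)
      rw [Finset.sum_eq_single_of_mem i (Finset.mem_Ico.2 ⟨h₁.le, h₂⟩)] at this
      · have hm := (auxPoly_monic (a := a) (δ := δ) x i).coeff_natDegree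
        rw [auxPoly_natDegree x h₁.ne'] at hm
        simpa [hm] using this
      · intro j hj hji
        rw [Finset.mem_Ico] at hj
        rcases eq_or_ne j a with rfl | hja
        · rw [coeff_eq_zero_of_natDegree_lt, mul_zero]
          rw [auxPoly_natDegree_self]
          omega
        · rcases lt_or_gt_of_ne hji with hlt | hgt
          · rw [ih j hlt (by omega) hj.2, zero_mul]
          · rw [coeff_eq_zero_of_natDegree_lt, mul_zero]
            rw [auxPoly_natDegree x hja]
            omega
  have hsa : a < δ → s a = 0 := by
    intro haδ
    have := hc a le_rfl
    rw [Finset.sum_eq_single_of_mem a (Finset.mem_Ico.2 ⟨le_rfl, haδ⟩)] at this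
    · have hm := (auxPoly_monic (a := a) (δ := δ) x a).coeff_natDegree
      rw [auxPoly_natDegree_self x] at hm
      simpa [hm] using this
    · intro j hj hja
      rw [Finset.mem_Ico] at hj
      rw [hs j (by omega) hj.2, zero_mul]
  have hall : ∀ i ∈ Finset.Ico a δ, s i = 0 := by
    intro i hi
    rw [Finset.mem_Ico] at hi
    rcases eq_or_lt_of_le hi.1 with rfl | hlt
    · exact hsa hi.2
    · exact hs i hlt hi.2
  refine ⟨?_, hall⟩
  rwa [Finset.sum_eq_zero, add_zero] at h
  intro i hi
  rw [hall i hi, C_0, zero_mul]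

variable (a δ)

/-- The value at coordinate `j` of the functional attached to the pair `(g, h)`. -/
noncomputable def pairEval (g h : F[X]) (j : ℕ) : F :=
  if j < a + δ then h.eval (x j) else (g + headNodal a δ x δ * h).eval (x j)

variable {a δ m x}

theorem pairEval_sub (g₁ h₁ g₂ h₂ : F[X]) (u v : F) (j : ℕ) :
    pairEval a δ x (C u * g₁ - C v * g₂) (C u * h₁ - C v * h₂) j =
      u * pairEval a δ x g₁ h₁ j - v * pairEval a δ x g₂ h₂ j := by
  unfold pairEval
  split_ifs
  · simp
  · simp only [eval_add, eval_sub, eval_mul, eval_C]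
    ring

theorem eq_zero_of_add_headNodal_mul_eq_zero {g h : F[X]} (hg : g.degree < δ)
    (H : g + headNodal a δ x δ * h = 0) : g = 0 ∧ h = 0 := by
  have hh : h = 0 := by
    by_contra hh
    have h₁ : g = -(headNodal a δ x δ * h) := eq_neg_of_add_eq_zero_left H
    rw [h₁, degree_neg, degree_mul, headNodal_degree] at hg
    have : (0 : WithBot ℕ) ≤ h.degree := zero_le_degree_iff.2 hh
    exact absurd hg (not_lt.2 (le_add_of_nonneg_right this))
  exact ⟨by simpa [hh] using H, hh⟩

theorem degree_add_headNodal_mul_lt {g h : F[X]} (hg : g.degree < δ) (hh : h.degree < a) :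
    (g + headNodal a δ x δ * h).degree < (a + δ : ℕ) := by
  refine (degree_add_le _ _).trans_lt (max_lt (hg.trans_le (by exact_mod_cast (by omega))) ?_)
  rcases eq_or_ne h 0 with rfl | h0
  · simp
  · rw [degree_mul, headNodal_degree]
    rw [degree_eq_natDegree h0] at hh ⊢
    have : h.natDegree < a := by exact_mod_cast hh
    exact_mod_cast (by omega : δ + h.natDegree < a + δ)

section Windows

variable (hx : Set.InjOn x (Set.Iio (a + δ + m)))
include hx

theorem eq_zero_of_eval_Ico {p : F[X]} {d l : ℕ} (hd : p.degree < d) (hl : l + d ≤ a + δ + m)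
    (h : ∀ j, l ≤ j → j < l + d → p.eval (x j) = 0) : p = 0 := by
  refine eq_zero_of_degree_lt_of_eval_index_eq_zero (s := Finset.Ico l (l + d)) (v := x)
    (hx.mono fun j hj => ?_) (by simpa using hd) fun j hj => ?_
  · have := Finset.mem_Ico.1 hj
    exact Set.mem_Iio.2 (by omega)
  · have := Finset.mem_Ico.1 hj
    exact h j this.1 this.2

theorem pair_eq_zero_of_window (hδm : δ ≤ m) {g h : F[X]} (hg : g.degree < δ)
    (hh : h.degree < a) {l : ℕ} (hl₁ : δ ≤ l) (hl₂ : l ≤ m)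
    (H : ∀ j, l ≤ j → j < l + (a + δ) → pairEval a δ x g h j = 0) : g = 0 ∧ h = 0 := by
  rcases lt_or_ge l (a + δ) with hl | hl
  · have hg0 : g = 0 := by
      refine eq_zero_of_eval_Ico hx (l := a + δ) hg (by omega) fun j hj₁ hj₂ => ?_
      have := H j (by omega) (by omega)
      rw [pairEval, if_neg (by omega), eval_add, eval_mul,
        headNodal_eval_eq_zero a δ x hj₁ hj₂] at this
      simpa using this
    refine ⟨hg0, ?_⟩
    have hsub : Finset.Ico (a + δ) (a + δ + δ) ⊆ Finset.Ico l (l + (a + δ)) :=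
      Finset.Ico_subset_Ico (by omega) (by omega)
    refine eq_zero_of_degree_lt_of_eval_index_eq_zero
      (s := Finset.Ico l (l + (a + δ)) \ Finset.Ico (a + δ) (a + δ + δ)) (v := x)
      (hx.mono fun j hj => ?_) ?_ fun j hj => ?_
    · have := Finset.mem_Ico.1 (Finset.mem_sdiff.1 hj).1
      exact Set.mem_Iio.2 (by omega)
    · rw [Finset.card_sdiff_of_subset hsub]
      simpa using hh
    · simp only [Finset.mem_sdiff, Finset.mem_Ico] at hj
      have := H j hj.1.1 hj.1.2
      unfold pairEval at this
      split_ifs at this with hj'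
      · exact this
      · rw [hg0, zero_add, eval_mul] at this
        exact (mul_eq_zero.1 this).resolve_left
          (headNodal_eval_ne_zero hx (by omega) (by omega) (by omega))
  · refine eq_zero_of_add_headNodal_mul_eq_zero (x := x) hg
      (eq_zero_of_eval_Ico hx (l := l) (degree_add_headNodal_mul_lt hg hh) (by omega) ?_)
    intro j hj₁ hj₂
    have := H j hj₁ hj₂
    rwa [pairEval, if_neg (by omega)] at this

/-- Greedy choice of evaluation points completing the windows that overlap the tail. -/
theorem exists_greedy_points [Fintype F] (ha : 1 ≤ a) (haδ : a ≤ δ) (hδm : δ ≤ m)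
    (hF : a + δ + m ≤ Fintype.card F) (T : ℕ) (hT : T ≤ a - 1) :
    ∃ μ : ℕ → F, Set.InjOn μ (Set.Iio T) ∧
      (∀ v < T, ∀ j, a ≤ j → j < a + δ → μ v ≠ x j) ∧
      ∀ t ≤ T, ∀ g h : F[X], g.degree < δ → h.degree < a →
        (∀ j, m + t ≤ j → j < a + δ + m → pairEval a δ x g h j = 0) →
        (∀ v < t, h.eval (μ v) = 0) → h = 0 := by
  classical
  induction T with
  | zero =>
    refine ⟨0, by simp, by simp, ?_⟩
    intro t ht g h hg hh H _
    obtain rfl : t = 0 := by omega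
    exact (pair_eq_zero_of_window hx hδm hg hh (l := m) hδm le_rfl
      fun j hj₁ hj₂ => H j hj₁ (by omega)).2
  | succ T ih =>
    obtain ⟨μ, hinj, hav, hμ⟩ := ih (by omega)
    obtain ⟨y, hyx, hyμ, hy⟩ : ∃ y : F, (∀ j, a ≤ j → j < a + δ → y ≠ x j) ∧
        (∀ v < T, y ≠ μ v) ∧ ∀ g h : F[X], g.degree < δ → h.degree < a →
          (∀ j, m + (T + 1) ≤ j → j < a + δ + m → pairEval a δ x g h j = 0) →
          (∀ v < T, h.eval (μ v) = 0) → h.eval y = 0 → h = 0 := by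
      have key : ∀ h₀ : F[X], h₀ ≠ 0 → h₀.degree < a → ∃ y : F,
          (∀ j, a ≤ j → j < a + δ → y ≠ x j) ∧ (∀ v < T, y ≠ μ v) ∧ h₀.eval y ≠ 0 := by
        intro h₀ h₀0 h₀d
        have hr : h₀.roots.toFinset.card < a := by
          refine (Multiset.toFinset_card_le _).trans_lt ((card_roots' _).trans_lt ?_)
          exact (natDegree_lt_iff_degree_lt h₀0).2 h₀d
        have hcard : ((Finset.Ico a (a + δ)).image x ∪ (Finset.range T).image μ ∪
            h₀.roots.toFinset).card < (Finset.univ : Finset F).card := by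
          have h₁ := Finset.card_union_le ((Finset.Ico a (a + δ)).image x ∪
            (Finset.range T).image μ) h₀.roots.toFinset
          have h₂ := Finset.card_union_le ((Finset.Ico a (a + δ)).image x)
            ((Finset.range T).image μ)
          have h₃ := Finset.card_image_le (s := Finset.Ico a (a + δ)) (f := x)
          have h₄ := Finset.card_image_le (s := Finset.range T) (f := μ)
          rw [Nat.card_Ico] at h₃
          rw [Finset.card_range] at h₄
          rw [Finset.card_univ]
          omega
        obtain ⟨y, -, hy⟩ := Finset.exists_mem_notMem_of_card_lt_card hcard
        simp only [Finset.mem_union, Finset.mem_image, Finset.mem_Ico, Finset.mem_range,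
          Multiset.mem_toFinset, mem_roots h₀0, IsRoot.def, not_or, not_exists, not_and] at hy
        exact ⟨y, fun j h₁ h₂ e => hy.1.1 j ⟨h₁, h₂⟩ e.symm,
          fun v hv e => hy.1.2 v hv e.symm, hy.2⟩
      by_cases hex : ∃ g h : F[X], g.degree < δ ∧ h.degree < a ∧
          (∀ j, m + (T + 1) ≤ j → j < a + δ + m → pairEval a δ x g h j = 0) ∧
          (∀ v < T, h.eval (μ v) = 0) ∧ h ≠ 0
      · obtain ⟨g₀, h₀, hg₀, hh₀, hz₀, hr₀, hne⟩ := hex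
        obtain ⟨y, hy₁, hy₂, hy₃⟩ := key h₀ hne hh₀
        refine ⟨y, hy₁, hy₂, fun g h hg hh hz hr hhy => ?_⟩
        set u := pairEval a δ x g h (m + T) with hu
        set w := pairEval a δ x g₀ h₀ (m + T) with hw
        have hcomb : C w * h - C u * h₀ = 0 := by
          refine hμ T le_rfl (C w * g - C u * g₀) _ ?_ ?_ ?_ ?_
          · exact (degree_sub_le _ _).trans_lt
              (max_lt (degree_C_mul_lt _ hg) (degree_C_mul_lt _ hg₀))
          · exact (degree_sub_le _ _).trans_lt
              (max_lt (degree_C_mul_lt _ hh) (degree_C_mul_lt _ hh₀))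
          · intro j hj₁ hj₂
            rw [pairEval_sub]
            rcases eq_or_lt_of_le hj₁ with rfl | hlt
            · rw [← hu, ← hw]
              ring
            · rw [hz j (by omega) hj₂, hz₀ j (by omega) hj₂]
              ring
          · intro v hv
            simp [hr v hv, hr₀ v hv]
        have hu0 : u = 0 := by
          have := congrArg (eval y) hcomb
          simp only [eval_sub, eval_mul, eval_C, hhy, mul_zero, zero_sub, eval_zero,
            neg_eq_zero] at this
          exact (mul_eq_zero.1 this).resolve_right hy₃
        refine hμ T le_rfl g h hg hh (fun j hj₁ hj₂ => ?_) hr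
        rcases eq_or_lt_of_le hj₁ with rfl | hlt
        · exact hu0
        · exact hz j (by omega) hj₂
      · obtain ⟨y, hy₁, hy₂, -⟩ := key 1 one_ne_zero (by
          rw [degree_one]; exact_mod_cast (by omega : 0 < a))
        refine ⟨y, hy₁, hy₂, fun g h hg hh hz hr _ => ?_⟩
        by_contra hne
        exact hex ⟨g, h, hg, hh, hz, hr, hne⟩
    have hlt : ∀ v < T, Function.update μ T y v = μ v := fun v hv =>
      Function.update_of_ne hv.ne _ _
    refine ⟨Function.update μ T y, ?_, ?_, ?_⟩
    · intro v hv w hw e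
      rw [Set.mem_Iio] at hv hw
      rcases Nat.lt_succ_iff_lt_or_eq.1 hv with hv' | rfl <;>
        rcases Nat.lt_succ_iff_lt_or_eq.1 hw with hw' | rfl
      · rw [hlt v hv', hlt w hw'] at e
        exact hinj hv' hw' e
      · rw [hlt v hv', Function.update_self] at e
        exact absurd e.symm (hyμ v hv')
      · rw [hlt w hw', Function.update_self] at e
        exact absurd e (hyμ w hw')
      · rfl
    · intro v hv j hj₁ hj₂
      rcases Nat.lt_succ_iff_lt_or_eq.1 hv with hv' | rfl
      · rw [hlt v hv']
        exact hav v hv' j hj₁ hj₂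
      · rw [Function.update_self]
        exact hyx j hj₁ hj₂
    · intro t ht g h hg hh hz hr
      rcases eq_or_lt_of_le ht with rfl | ht'
      · refine hy g h hg hh hz (fun v hv => ?_) ?_
        · rw [← hlt v hv]
          exact hr v (by omega)
        · simpa using hr T (by omega)
      · refine hμ t (by omega) g h hg hh hz fun v hv => ?_
        rw [← hlt v (by omega)]
        exact hr v hv

end Windows

variable (a δ m x) (μ : ℕ → F)

/-- The correction added to the low-degree part for each unit of leading coefficient of `h`. -/
noncomputable def leadCorrection : F[X] :=
  (headNodal a δ x a - headNodal a δ x δ * nodal (Finset.range (a - 1)) μ) %ₘ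
    nodal (Finset.Ico (a + m) (a + δ + m)) x

/-- The part of degree `< δ` of the polynomial evaluated on the tail coordinates. -/
noncomputable def lowPart (f : F[X]) (s : ℕ → F) (h : F[X]) : F[X] :=
  f + ∑ i ∈ Finset.Ico a δ, C (s i) * auxPoly a δ x i +
    C (h.coeff (a - 1)) * leadCorrection a δ m x μ

/-- The `j`-th column of the parity-check system, as a functional of `(f, s, h)`. -/
noncomputable def column (f : F[X]) (s : ℕ → F) (h : F[X]) (j : ℕ) : F :=
  if j < a then f.eval (x j)
  else if j < δ then s j + h.eval (x j)
  else if j < a + δ + m then pairEval a δ x (lowPart a δ m x μ f s h) h j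
  else if j - (a + δ + m) < a - 1 then h.eval (μ (j - (a + δ + m)))
  else if j - (a + δ + m) + 1 = δ then h.coeff (a - 1)
  else s (j - (a + δ + m) + 1)

variable {a δ m x μ}

theorem leadCorrection_degree_lt : (leadCorrection a δ m x μ).degree < δ := by
  refine (degree_modByMonic_lt _ nodal_monic).trans_le ?_
  rw [degree_nodal, Nat.card_Ico]
  exact_mod_cast (by omega)

theorem leadCorrection_eval {j : ℕ} (h₁ : a + m ≤ j) (h₂ : j < a + δ + m) :
    (leadCorrection a δ m x μ).eval (x j) = (headNodal a δ x a).eval (x j) -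
      (headNodal a δ x δ).eval (x j) * (nodal (Finset.range (a - 1)) μ).eval (x j) := by
  have h := congrArg (eval (x j)) (modByMonic_add_div
    (headNodal a δ x a - headNodal a δ x δ * nodal (Finset.range (a - 1)) μ)
    (nodal (Finset.Ico (a + m) (a + δ + m)) x))
  rw [eval_add, eval_mul, eval_nodal_at_node (Finset.mem_Ico.2 ⟨h₁, h₂⟩), zero_mul, add_zero,
    eval_sub, eval_mul] at h
  exact h

theorem lowPart_degree_lt (haδ : a ≤ δ) {f : F[X]} (hf : f.degree < a) (s : ℕ → F) (h : F[X]) :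
    (lowPart a δ m x μ f s h).degree < δ := by
  rw [← mem_degreeLT]
  refine Submodule.add_mem _ (Submodule.add_mem _ ?_ (Submodule.sum_mem _ fun i hi => ?_)) ?_
  · exact mem_degreeLT.2 (hf.trans_le (by exact_mod_cast haδ))
  · rw [Finset.mem_Ico] at hi
    refine mem_degreeLT.2 (degree_C_mul_lt _ ?_)
    rw [degree_eq_natDegree (auxPoly_monic x i).ne_zero]
    rcases eq_or_ne i a with rfl | hia
    · rw [auxPoly_natDegree_self]
      exact_mod_cast hi.2
    · rw [auxPoly_natDegree x hia]
      exact_mod_cast (by omega : a + δ - i < δ)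
  · exact mem_degreeLT.2 (degree_C_mul_lt _ leadCorrection_degree_lt)

theorem eq_C_coeff_mul_nodal {d : ℕ} {h : F[X]} (hh : h.degree < (d + 1 : ℕ))
    (hμ : Set.InjOn μ (Set.Iio d)) (hr : ∀ v < d, h.eval (μ v) = 0) :
    h = C (h.coeff d) * nodal (Finset.range d) μ := by
  rw [← sub_eq_zero]
  refine eq_zero_of_degree_lt_of_eval_index_eq_zero (s := Finset.range d) (v := μ)
    (by simpa [Set.InjOn] using hμ) ?_ ?_
  · rw [Finset.card_range, degree_lt_iff_coeff_zero]
    intro k hk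
    have hn : (nodal (Finset.range d) μ).natDegree = d := by simp [natDegree_nodal]
    have hm : (nodal (Finset.range d) μ).coeff d = 1 := by
      have := (nodal_monic (s := Finset.range d) (v := μ)).coeff_natDegree
      rwa [hn] at this
    rw [coeff_sub, coeff_C_mul]
    rcases eq_or_lt_of_le hk with rfl | hlt
    · rw [hm, mul_one, sub_self]
    · rw [coeff_eq_zero_of_natDegree_lt (hn.trans_lt hlt), mul_zero, sub_zero]
      exact coeff_eq_zero_of_degree_lt (hh.trans_le (by exact_mod_cast hlt))
  · intro v hv
    rw [eval_sub, eval_mul, eval_nodal_at_node hv, mul_zero, sub_zero]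
    exact hr v (Finset.mem_range.1 hv)

/-- The points `μ` complete every window that overlaps the last block in fewer than `a`
coordinates. -/
def CompletesWindows (a δ m : ℕ) (x μ : ℕ → F) : Prop :=
  ∀ t ≤ a - 1, ∀ g h : F[X], g.degree < δ → h.degree < a →
    (∀ j, m + t ≤ j → j < a + δ + m → pairEval a δ x g h j = 0) →
    (∀ v < t, h.eval (μ v) = 0) → h = 0

theorem column_window_injective (ha : 1 ≤ a) (haδ : a ≤ δ) (hδm : δ ≤ m)
    (hx : Set.InjOn x (Set.Iio (a + δ + m))) (hμ : Set.InjOn μ (Set.Iio (a - 1)))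
    (hw : CompletesWindows a δ m x μ) {f h : F[X]} {s : ℕ → F} (hf : f.degree < a)
    (hh : h.degree < a) {l : ℕ} (hl₁ : δ ≤ l) (hl₂ : l ≤ m + δ)
    (H : ∀ j, l ≤ j → j < l + (a + δ) → column a δ m x μ f s h j = 0) :
    f = 0 ∧ h = 0 ∧ ∀ i ∈ Finset.Ico a δ, s i = 0 := by
  have hlow := lowPart_degree_lt (m := m) (x := x) (μ := μ) haδ hf s h
  have hpair : ∀ j, l ≤ j → j < l + (a + δ) → j < a + δ + m →
      pairEval a δ x (lowPart a δ m x μ f s h) h j = 0 := by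
    intro j h₁ h₂ h₃
    have := H j h₁ h₂
    rwa [column, if_neg (by omega), if_neg (by omega), if_pos h₃] at this
  have hlast : ∀ v, a + δ + m + v < l + (a + δ) →
      (v < a - 1 → h.eval (μ v) = 0) ∧ (a ≤ v + 1 → v + 1 < δ → s (v + 1) = 0) ∧
        (v + 1 = δ → a ≤ v + 1 → h.coeff (a - 1) = 0) := by
    intro v hv
    have := H (a + δ + m + v) (by omega) hv
    rw [column, if_neg (by omega), if_neg (by omega), if_neg (by omega),
      Nat.add_sub_cancel_left] at this
    refine ⟨fun h₁ => ?_, fun h₁ h₂ => ?_, fun h₁ h₂ => ?_⟩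
    · rwa [if_pos h₁] at this
    · rwa [if_neg (by omega), if_neg (by omega)] at this
    · rwa [if_neg (by omega), if_pos h₁] at this
  have finish : lowPart a δ m x μ f s h = 0 → h = 0 →
      f = 0 ∧ h = 0 ∧ ∀ i ∈ Finset.Ico a δ, s i = 0 := by
    intro h₁ h₂
    rw [lowPart, h₂, coeff_zero, C_0, zero_mul, add_zero] at h₁
    have := auxPoly_independent x hf s h₁
    exact ⟨this.1, h₂, this.2⟩
  rcases le_or_gt l m with hlm | hlm
  · have := pair_eq_zero_of_window hx hδm hlow hh hl₁ hlm
      fun j h₁ h₂ => hpair j h₁ h₂ (by omega)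
    exact finish this.1 this.2
  obtain ⟨t, rfl⟩ := Nat.exists_eq_add_of_le hlm.le
  rcases lt_or_ge t a with hta | hta
  · have hh0 : h = 0 := hw t (by omega) _ h hlow hh (fun j h₁ h₂ => hpair j h₁ (by omega) h₂)
      fun v hv => (hlast v (by omega)).1 (by omega)
    refine finish (eq_zero_of_eval_Ico hx (l := a + m) hlow (by omega) fun j h₁ h₂ => ?_) hh0
    have := hpair j (by omega) (by omega) (by omega)
    rw [pairEval, if_neg (by omega), hh0, mul_zero, add_zero] at this
    rwa [hh0]
  have hh' : h = C (h.coeff (a - 1)) * nodal (Finset.range (a - 1)) μ :=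
    eq_C_coeff_mul_nodal (hh.trans_le (by exact_mod_cast (by omega))) hμ
      fun v hv => (hlast v (by omega)).1 hv
  have hs : ∀ i, a ≤ i → i ≤ t → i < δ → s i = 0 := by
    intro i h₁ h₂ h₃
    have := (hlast (i - 1) (by omega)).2.1
    rw [Nat.sub_add_cancel (by omega)] at this
    exact this h₁ h₃
  have heval : ∀ j, m + t ≤ j → j < a + δ + m →
      (f + ∑ i ∈ Finset.Ico a δ, C (s i) * auxPoly a δ x i +
        C (h.coeff (a - 1)) * headNodal a δ x a).eval (x j) = 0 := by
    intro j h₁ h₂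
    have := hpair j h₁ (by omega) h₂
    rw [pairEval, if_neg (by omega), hh', lowPart, coeff_C_mul] at this
    simp only [eval_add, eval_mul, eval_C, leadCorrection_eval (by omega : a + m ≤ j) h₂] at this ⊢
    have hm : (nodal (Finset.range (a - 1)) μ).coeff (a - 1) = 1 := by
      have hn : (nodal (Finset.range (a - 1)) μ).natDegree = a - 1 := by simp [natDegree_nodal]
      have := (nodal_monic (s := Finset.range (a - 1)) (v := μ)).coeff_natDegree
      rwa [hn] at this
    rw [hm] at this
    rw [← this]
    ring
  rcases lt_or_eq_of_le (by omega : t ≤ δ) with htδ | rfl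
  · have hsum : ∑ i ∈ Finset.Ico a δ, C (Function.update s a (h.coeff (a - 1)) i) *
        auxPoly a δ x i = ∑ i ∈ Finset.Ico a δ, C (s i) * auxPoly a δ x i +
          C (h.coeff (a - 1)) * headNodal a δ x a := by
      have hmem : a ∈ Finset.Ico a δ := Finset.mem_Ico.2 ⟨le_rfl, by omega⟩
      rw [← Finset.add_sum_erase _ _ hmem, ← Finset.add_sum_erase _ (fun i => C (s i) * _) hmem,
        Function.update_self, hs a le_rfl hta (by omega), C_0, zero_mul, zero_add, auxPoly_self,
        add_comm]
      congr 1
      refine Finset.sum_congr rfl fun i hi => ?_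
      rw [Function.update_of_ne (Finset.ne_of_mem_erase hi)]
    have hP : f + ∑ i ∈ Finset.Ico a δ, C (Function.update s a (h.coeff (a - 1)) i) *
        auxPoly a δ x i = 0 := by
      refine eq_zero_of_eval_Ico hx (l := m + t) (d := a + δ - t) ?_ (by omega) ?_
      · rw [← mem_degreeLT]
        refine Submodule.add_mem _ ?_ (Submodule.sum_mem _ fun i hi => ?_)
        · exact mem_degreeLT.2 (hf.trans_le (by exact_mod_cast (by omega)))
        · rw [Finset.mem_Ico] at hi
          rw [mem_degreeLT]
          rcases eq_or_ne i a with rfl | hia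
          · refine degree_C_mul_lt _ ?_
            rw [degree_eq_natDegree (auxPoly_monic x i).ne_zero, auxPoly_natDegree_self]
            exact_mod_cast (by omega)
          rw [Function.update_of_ne hia]
          rcases le_or_gt i t with hit | hit
          · simp [hs i hi.1 hit hi.2]
          · refine degree_C_mul_lt _ ?_
            rw [degree_eq_natDegree (auxPoly_monic x i).ne_zero, auxPoly_natDegree x hia]
            exact_mod_cast (by omega)
      · intro j h₁ h₂
        rw [hsum, ← add_assoc]
        exact heval j h₁ (by omega)
    obtain ⟨hf0, hs'⟩ := auxPoly_independent x hf _ hP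
    have hκ : h.coeff (a - 1) = 0 := by
      simpa using hs' a (Finset.mem_Ico.2 ⟨le_rfl, by omega⟩)
    refine ⟨hf0, by rw [hh', hκ, C_0, zero_mul], fun i hi => ?_⟩
    rcases eq_or_ne i a with rfl | hia
    · exact hs i le_rfl hta (by omega)
    · simpa [Function.update_of_ne hia] using hs' i hi
  · have hκ : h.coeff (a - 1) = 0 :=
      (hlast (t - 1) (by omega)).2.2 (by omega) (by omega)
    have hs0 : ∀ i ∈ Finset.Ico a t, s i = 0 := fun i hi => by
      rw [Finset.mem_Ico] at hi
      exact hs i hi.1 hi.2.le hi.2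
    refine ⟨eq_zero_of_eval_Ico hx (l := m + t) hf (by omega) fun j h₁ h₂ => ?_,
      by rw [hh', hκ, C_0, zero_mul], hs0⟩
    have := heval j h₁ (by omega)
    rwa [hκ, C_0, zero_mul, add_zero, Finset.sum_eq_zero, add_zero] at this
    intro i hi
    rw [hs0 i hi, C_0, zero_mul]

section Columns

variable (f : F[X]) (s : ℕ → F) (h : F[X]) {j : ℕ}

theorem column_of_lt (hj : j < a) : column a δ m x μ f s h j = f.eval (x j) := if_pos hj

theorem column_aux (h₁ : a ≤ j) (h₂ : j < δ) :
    column a δ m x μ f s h j = s j + h.eval (x j) := by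
  rw [column, if_neg (by omega), if_pos h₂]

theorem column_mid (haδ : a ≤ δ) (h₁ : δ ≤ j) (h₂ : j < a + δ) :
    column a δ m x μ f s h j = h.eval (x j) := by
  rw [column, if_neg (by omega), if_neg (by omega), if_pos (by omega), pairEval, if_pos h₂]

theorem column_tail (h₁ : a + δ ≤ j) (h₂ : j < a + δ + m) :
    column a δ m x μ f s h j =
      (lowPart a δ m x μ f s h + headNodal a δ x δ * h).eval (x j) := by
  rw [column, if_neg (by omega), if_neg (by omega), if_pos h₂, pairEval, if_neg (by omega)]

theorem column_last_lt (h₁ : a + δ + m ≤ j) (h₂ : j - (a + δ + m) < a - 1) :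
    column a δ m x μ f s h j = h.eval (μ (j - (a + δ + m))) := by
  rw [column, if_neg (by omega), if_neg (by omega), if_neg (by omega), if_pos h₂]

theorem column_last_eq (haδ : a ≤ δ) (h₁ : a + δ + m ≤ j) (h₂ : j - (a + δ + m) + 1 = δ) :
    column a δ m x μ f s h j = h.coeff (a - 1) := by
  rw [column, if_neg (by omega), if_neg (by omega), if_neg (by omega), if_neg (by omega),
    if_pos h₂]

theorem column_last (h₁ : a + δ + m ≤ j) (h₂ : a ≤ j - (a + δ + m) + 1)
    (h₃ : j - (a + δ + m) + 1 < δ) :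
    column a δ m x μ f s h j = s (j - (a + δ + m) + 1) := by
  rw [column, if_neg (by omega), if_neg (by omega), if_neg (by omega), if_neg (by omega),
    if_neg (by omega)]

theorem column_tail_zero (h₁ : a + δ ≤ j) (h₂ : j < a + δ + m) :
    column a δ m x μ f s 0 j =
      f.eval (x j) + ∑ i ∈ Finset.Ico a δ, s i * (auxPoly a δ x i).eval (x j) := by
  rw [column_tail _ _ _ h₁ h₂]
  simp [lowPart, eval_finsetSum]

theorem column_zero_zero (h₁ : a ≤ j) (h₂ : j < a + δ + m → j < a + δ) :
    column a δ m x μ f 0 0 j = 0 := by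
  unfold column pairEval
  split_ifs <;> first | omega | simp

theorem column_tail_eq_zero_of_root (h₁ : a + δ ≤ j) (h₂ : j < a + δ + m)
    (hf : f.eval (x j) = 0) : column a δ m x μ f 0 0 j = 0 := by
  rw [column_tail_zero _ _ h₁ h₂, hf]
  simp

end Columns

/-- Any prescribed set of at most `a` tail columns can be annihilated by the choice of `f`. -/
theorem exists_column_tail_eq_zero (hx : Set.InjOn x (Set.Iio (a + δ + m))) (s : ℕ → F)
    (h : F[X]) {E : Finset ℕ} (hE : E.card ≤ a) :
    ∃ f : F[X], f.degree < a ∧ ∀ j ∈ E, a + δ ≤ j → j < a + δ + m →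
      column a δ m x μ f s h j = 0 := by
  set S := E.filter fun j => a + δ ≤ j ∧ j < a + δ + m with hS
  have hinj : Set.InjOn x S := hx.mono fun j hj => by
    have := (Finset.mem_filter.1 hj).2
    exact Set.mem_Iio.2 this.2
  set r : ℕ → F := fun j =>
    -(lowPart a δ m x μ 0 s h + headNodal a δ x δ * h).eval (x j) with hr
  refine ⟨interpolate S x r, (degree_interpolate_lt r hinj).trans_le ?_, fun j hj h₁ h₂ => ?_⟩
  · exact_mod_cast (Finset.card_filter_le _ _).trans hE
  · have := eval_interpolate_at_node r hinj (Finset.mem_filter.2 ⟨hj, h₁, h₂⟩ : j ∈ S)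
    rw [column_tail _ _ _ h₁ h₂]
    simp only [hr, lowPart, eval_add, zero_add] at this ⊢
    rw [this]
    ring

theorem sum_single_mul {i : ℕ} (hi : i ∈ Finset.Ico a δ) (g : ℕ → F) :
    ∑ k ∈ Finset.Ico a δ, (Pi.single i 1 : ℕ → F) k * g k = g i := by
  rw [Finset.sum_eq_single_of_mem i hi]
  · simp
  · intro k _ hk
    simp [Pi.single_eq_of_ne hk]

theorem exists_burst_witness_of_aux {l : ℕ} (h₁ : a ≤ l)
    (h₂ : l < δ) : ∃ s : ℕ → F, s l = 1 ∧ (∀ j, l < j → s j = 0) ∧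
      ∀ j, a + δ ≤ j → j < a + δ + l →
        ∑ i ∈ Finset.Ico a δ, s i * (auxPoly a δ x i).eval (x j) = 0 := by
  by_cases hc : l = a ∨ l ≤ a + δ - l
  · refine ⟨Pi.single l 1, by simp, fun j hj => Pi.single_eq_of_ne hj.ne' _, fun j hj₁ hj₂ => ?_⟩
    rw [sum_single_mul (Finset.mem_Ico.2 ⟨h₁, h₂⟩)]
    unfold auxPoly
    split_ifs with h₃ h₄
    · exact headNodal_eval_eq_zero a δ x hj₁ (by omega)
    · rw [eval_add, headNodal_eval_eq_zero a δ x hj₁ (by omega),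
        headNodal_eval_eq_zero a δ x hj₁ (by omega), add_zero]
    · exact headNodal_eval_eq_zero a δ x hj₁ (by omega)
  · refine ⟨Pi.single l 1 - Pi.single (a + δ - l) 1, ?_, fun j hj => ?_, fun j hj₁ hj₂ => ?_⟩
    · rw [Pi.sub_apply, Pi.single_eq_same, Pi.single_eq_of_ne (by omega), sub_zero]
    · rw [Pi.sub_apply, Pi.single_eq_of_ne (by omega), Pi.single_eq_of_ne (by omega), sub_zero]
    · simp only [Pi.sub_apply, sub_mul, Finset.sum_sub_distrib]
      rw [sum_single_mul (Finset.mem_Ico.2 ⟨h₁, h₂⟩),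
        sum_single_mul (Finset.mem_Ico.2 ⟨by omega, by omega⟩)]
      have e₁ : auxPoly a δ x l = headNodal a δ x (a + δ - l) := by
        rw [auxPoly, if_neg (by omega), if_neg (by omega)]
      have e₂ : auxPoly a δ x (a + δ - l) = headNodal a δ x (a + δ - l) + headNodal a δ x l := by
        rw [auxPoly, if_neg (by omega), if_pos (by omega),
          show a + δ - (a + δ - l) = l by omega]
      rw [e₁, e₂, eval_add, headNodal_eval_eq_zero a δ x (k := l) hj₁ hj₂]
      ring

theorem nodal_eval_ne_zero_of_notMem (hx : Set.InjOn x (Set.Iio (a + δ + m))) {S : Finset ℕ}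
    (hS : ∀ j ∈ S, j < a + δ + m) {l : ℕ} (hl : l < a + δ + m) (hlS : l ∉ S) :
    (nodal S x).eval (x l) ≠ 0 :=
  eval_nodal_not_at_node fun j hj e => hlS <| by
    rwa [hx (Set.mem_Iio.2 hl) (Set.mem_Iio.2 (hS j hj)) e]

/-- Parity checks recovering a coordinate `l < δ` from a burst starting at `l`. -/
theorem exists_burst_witness (haδ : a ≤ δ) (hδm : δ ≤ m)
    (hx : Set.InjOn x (Set.Iio (a + δ + m))) {l : ℕ} (hl : l < δ) :
    ∃ (f : F[X]) (s : ℕ → F) (h : F[X]), f.degree < a ∧ h.degree < a ∧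
      column a δ m x μ f s h l ≠ 0 ∧
      (∀ j, l < j → j < l + (a + δ) → column a δ m x μ f s h j = 0) ∧
      ∀ j, a + δ + m + l ≤ j → j < a + δ + m + δ → column a δ m x μ f s h j = 0 := by
  rcases lt_or_ge l a with hla | hla
  · set S := Finset.Ico (l + 1) a ∪ Finset.Ico (a + δ) (a + δ + l) with hS
    refine ⟨nodal S x, 0, 0, ?_, by simp, ?_, fun j h₁ h₂ => ?_, fun j h₁ h₂ => ?_⟩
    · rw [degree_nodal]
      have := Finset.card_union_le (Finset.Ico (l + 1) a) (Finset.Ico (a + δ) (a + δ + l))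
      rw [← hS, Nat.card_Ico, Nat.card_Ico] at this
      exact_mod_cast (by omega : S.card < a)
    · rw [column_of_lt _ _ _ hla]
      refine nodal_eval_ne_zero_of_notMem hx (fun j hj => ?_) (by omega) ?_
      · simp only [hS, Finset.mem_union, Finset.mem_Ico] at hj
        omega
      · simp only [hS, Finset.mem_union, Finset.mem_Ico]
        omega
    · rcases lt_or_ge j a with hja | hja
      · rw [column_of_lt _ _ _ hja]
        exact eval_nodal_at_node (by simp only [hS, Finset.mem_union, Finset.mem_Ico]; omega)
      rcases lt_or_ge j (a + δ) with hjb | hjb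
      · exact column_zero_zero _ hja fun _ => hjb
      · exact column_tail_eq_zero_of_root _ hjb (by omega)
          (eval_nodal_at_node (by simp only [hS, Finset.mem_union, Finset.mem_Ico]; omega))
    · exact column_zero_zero _ (by omega) (by omega)
  · obtain ⟨s, hs₁, hs₂, hs₃⟩ := exists_burst_witness_of_aux (x := x) hla hl
    refine ⟨0, s, 0, by simp, by simp, ?_, fun j h₁ h₂ => ?_, fun j h₁ h₂ => ?_⟩
    · rw [column_aux _ _ _ hla hl, hs₁, eval_zero, add_zero]
      exact one_ne_zero
    · rcases lt_or_ge j δ with hjδ | hjδ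
      · rw [column_aux _ _ _ (by omega) hjδ, hs₂ j h₁, eval_zero, add_zero]
      rcases lt_or_ge j (a + δ) with hjb | hjb
      · rw [column_mid _ _ _ haδ hjδ hjb, eval_zero]
      · rw [column_tail_zero _ _ hjb (by omega), hs₃ j hjb (by omega), eval_zero, add_zero]
    · rcases eq_or_ne (j - (a + δ + m) + 1) δ with he | he
      · rw [column_last_eq _ _ _ haδ (by omega) he, coeff_zero]
      · rw [column_last _ _ _ (by omega) (by omega) (by omega), hs₂ _ (by omega)]

/-- The evaluation point of `h` at a coordinate which is not on the tail. -/
def sidePoint (a δ m : ℕ) (x μ : ℕ → F) (j : ℕ) : F :=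
  if j < a + δ then x j else μ (j - (a + δ + m))

theorem exists_erasure_witness_of_side (haδ : a ≤ δ)
    (hx : Set.InjOn x (Set.Iio (a + δ + m))) (hμ : Set.InjOn μ (Set.Iio (a - 1)))
    (hμx : ∀ v < a - 1, ∀ j, a ≤ j → j < a + δ → μ v ≠ x j) {l : ℕ} (hal : a ≤ l)
    (hl : l < a + δ ∨ a + δ + m ≤ l ∧ l - (a + δ + m) < a - 1)
    {E : Finset ℕ} (hE : ∀ j ∈ E, l < j ∧ j < a + δ + m + δ) (hEc : E.card < a)
    (hlead : (∃ j ∈ E, a + δ + m + (a - 1) ≤ j) ∨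
      δ ≤ l ∧ ∀ j ∈ E, j < a + δ + m + (a - 1)) :
    ∃ (f : F[X]) (s : ℕ → F) (h : F[X]), f.degree < a ∧ h.degree < a ∧
      column a δ m x μ f s h l ≠ 0 ∧ (∀ j ∈ E, column a δ m x μ f s h j = 0) ∧
      ∀ j, a + δ + m + l ≤ j → j < a + δ + m + δ → column a δ m x μ f s h j = 0 := by
  set S := E.filter fun j => j < a + δ ∨ a + δ + m ≤ j ∧ j - (a + δ + m) < a - 1 with hS
  set h := nodal S (sidePoint a δ m x μ) with hh
  have hSc : S.card ≤ E.card := Finset.card_filter_le _ _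
  have hhd : h.degree = (S.card : ℕ) := degree_nodal
  have hlead' : (δ ≤ l ∧ ∀ j ∈ E, j < a + δ + m + (a - 1)) ∨ h.coeff (a - 1) = 0 := by
    rcases hlead with ⟨j, hj, hja⟩ | hlead
    · right
      refine coeff_eq_zero_of_degree_lt ?_
      have : S.card < E.card := Finset.card_lt_card <| Finset.filter_ssubset.2
        ⟨j, hj, by omega⟩
      rw [hhd]
      exact_mod_cast (by omega)
    · exact Or.inl hlead
  clear hlead
  obtain ⟨f, hf, hfE⟩ := exists_column_tail_eq_zero (μ := μ) hx 0 h hEc.le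
  have hne : h.eval (sidePoint a δ m x μ l) ≠ 0 := by
    refine eval_nodal_not_at_node fun j hj e => ?_
    obtain ⟨hjE, hj⟩ := Finset.mem_filter.1 hj
    have hlj := hE j hjE
    unfold sidePoint at e
    split_ifs at e with h₁ h₂ h₂
    · have := hx (Set.mem_Iio.2 (by omega)) (Set.mem_Iio.2 (by omega)) e
      omega
    · exact hμx _ (by omega) l hal h₁ e.symm
    · omega
    · have := hμ (Set.mem_Iio.2 (by omega)) (Set.mem_Iio.2 (by omega)) e
      omega
  have hroot : ∀ j ∈ S, h.eval (sidePoint a δ m x μ j) = 0 := fun j hj => eval_nodal_at_node hj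
  refine ⟨f, 0, h, hf, ?_, ?_, fun j hj => ?_, fun j h₁ h₂ => ?_⟩
  · rw [hhd]
    exact_mod_cast hSc.trans_lt hEc
  · rcases lt_or_ge l (a + δ) with hlb | hlb
    · rw [sidePoint, if_pos hlb] at hne
      rcases lt_or_ge l δ with hlδ | hlδ
      · simpa [column_aux _ _ _ hal hlδ] using hne
      · rwa [column_mid _ _ _ haδ hlδ hlb]
    · rw [sidePoint, if_neg (by omega)] at hne
      rwa [column_last_lt _ _ _ (by omega) (by omega)]
  · have hlj := hE j hj
    rcases lt_or_ge j (a + δ) with hjb | hjb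
    · have := hroot j (Finset.mem_filter.2 ⟨hj, Or.inl hjb⟩)
      rw [sidePoint, if_pos hjb] at this
      rcases lt_or_ge j δ with hjδ | hjδ
      · simpa [column_aux _ _ _ (hal.trans hlj.1.le) hjδ] using this
      · rwa [column_mid _ _ _ haδ hjδ hjb]
    rcases lt_or_ge j (a + δ + m) with hjm | hjm
    · exact hfE j hj hjb hjm
    rcases lt_or_ge (j - (a + δ + m)) (a - 1) with hjl | hjl
    · have := hroot j (Finset.mem_filter.2 ⟨hj, Or.inr ⟨hjm, hjl⟩⟩)
      rw [sidePoint, if_neg (by omega)] at this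
      rwa [column_last_lt _ _ _ hjm hjl]
    rcases eq_or_ne (j - (a + δ + m) + 1) δ with he | he
    · rw [column_last_eq _ _ _ haδ hjm he]
      refine hlead'.resolve_left fun hc => ?_
      have := hc.2 j hj
      omega
    · rw [column_last _ _ _ hjm (by omega) (by omega), Pi.zero_apply]
  · rcases eq_or_ne (j - (a + δ + m) + 1) δ with he | he
    · rw [column_last_eq _ _ _ haδ (by omega) he]
      exact hlead'.resolve_left fun hc => by omega
    · rw [column_last _ _ _ (by omega) (by omega) (by omega), Pi.zero_apply]

/-- Parity checks recovering a coordinate `l` from fewer than `a` further erasures. -/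
theorem exists_erasure_witness (ha : 1 ≤ a) (haδ : a ≤ δ)
    (hx : Set.InjOn x (Set.Iio (a + δ + m))) (hμ : Set.InjOn μ (Set.Iio (a - 1)))
    (hμx : ∀ v < a - 1, ∀ j, a ≤ j → j < a + δ → μ v ≠ x j) {l : ℕ}
    (hl : l < a + δ + m + δ)
    {E : Finset ℕ} (hE : ∀ j ∈ E, l < j ∧ j < a + δ + m + δ) (hEc : E.card < a) :
    ∃ (f : F[X]) (s : ℕ → F) (h : F[X]), f.degree < a ∧ h.degree < a ∧
      column a δ m x μ f s h l ≠ 0 ∧ (∀ j ∈ E, column a δ m x μ f s h j = 0) ∧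
      ∀ j, a + δ + m + l ≤ j → j < a + δ + m + δ → column a δ m x μ f s h j = 0 := by
  by_cases hpoint : l < a ∨ a + δ ≤ l ∧ l < a + δ + m
  · set S := E.filter fun j => j < a + δ + m with hS
    have hne : (nodal S x).eval (x l) ≠ 0 := by
      refine nodal_eval_ne_zero_of_notMem hx (fun j hj => (Finset.mem_filter.1 hj).2)
        (by omega) fun hlS => ?_
      exact (hE l (Finset.mem_filter.1 hlS).1).1.ne rfl
    refine ⟨nodal S x, 0, 0, ?_, by simp, ?_, fun j hj => ?_, fun j h₁ h₂ => ?_⟩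
    · rw [degree_nodal]
      exact_mod_cast (Finset.card_filter_le _ _).trans_lt hEc
    · rcases hpoint with hla | hlt
      · rwa [column_of_lt _ _ _ hla]
      · rw [column_tail_zero _ _ hlt.1 hlt.2]
        simpa using hne
    · have hroot : j < a + δ + m → (nodal S x).eval (x j) = 0 := fun hjm =>
        eval_nodal_at_node (Finset.mem_filter.2 ⟨hj, hjm⟩)
      rcases lt_or_ge j a with hja | hja
      · rw [column_of_lt _ _ _ hja]
        exact hroot (by omega)
      by_cases hjt : a + δ ≤ j ∧ j < a + δ + m
      · exact column_tail_eq_zero_of_root _ hjt.1 hjt.2 (hroot hjt.2)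
      · exact column_zero_zero _ hja (by omega)
    · exact column_zero_zero _ (by omega) (by omega)
  have hla : a ≤ l := by omega
  by_cases haux : l < δ ∧ a + δ + m + (l - 1) ∉ E
  · obtain ⟨f, hf, hfE⟩ := exists_column_tail_eq_zero (μ := μ) hx (Pi.single l 1) 0 hEc.le
    have hlast : ∀ j, a + δ + m ≤ j → j < a + δ + m + δ → j ≠ a + δ + m + (l - 1) →
        column a δ m x μ f (Pi.single l 1) 0 j = 0 := by
      intro j h₁ h₂ h₃
      rcases lt_or_ge (j - (a + δ + m)) (a - 1) with hjl | hjl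
      · rw [column_last_lt _ _ _ h₁ hjl, eval_zero]
      rcases eq_or_ne (j - (a + δ + m) + 1) δ with he | he
      · rw [column_last_eq _ _ _ haδ h₁ he, coeff_zero]
      · rw [column_last _ _ _ h₁ (by omega) (by omega), Pi.single_eq_of_ne (by omega)]
    refine ⟨f, Pi.single l 1, 0, hf, by simp, ?_, fun j hj => ?_, fun j h₁ h₂ => ?_⟩
    · simp [column_aux _ _ _ hla haux.1]
    · have hlj := hE j hj
      rcases lt_or_ge j δ with hjδ | hjδ
      · rw [column_aux _ _ _ (by omega) hjδ, Pi.single_eq_of_ne (by omega), eval_zero, add_zero]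
      rcases lt_or_ge j (a + δ) with hjb | hjb
      · rw [column_mid _ _ _ haδ hjδ hjb, eval_zero]
      rcases lt_or_ge j (a + δ + m) with hjm | hjm
      · exact hfE j hj hjb hjm
      · exact hlast j hjm hlj.2 fun e => haux.2 (e ▸ hj)
    · exact hlast j (by omega) h₂ (by omega)
  by_cases hside : l < a + δ ∨ l - (a + δ + m) < a - 1
  · refine exists_erasure_witness_of_side haδ hx hμ hμx hla (by omega) hE hEc ?_
    by_cases hex : ∃ j ∈ E, a + δ + m + (a - 1) ≤ j
    · exact Or.inl hex
    · refine Or.inr ⟨?_, fun j hj => ?_⟩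
      · by_contra hlδ
        refine haux ⟨by omega, fun hj => hex ⟨_, hj, by omega⟩⟩
      · by_contra hjc
        exact hex ⟨j, hj, by omega⟩
  rcases eq_or_ne (l - (a + δ + m) + 1) δ with he | he
  · refine ⟨0, 0, X ^ (a - 1), by simp, ?_, ?_, fun j hj => ?_, fun j h₁ h₂ => ?_⟩
    · rw [degree_X_pow]
      exact_mod_cast (by omega)
    · simp [column_last_eq _ _ _ haδ (by omega) he]
    · have := hE j hj
      omega
    · omega
  · refine ⟨0, Pi.single (l - (a + δ + m) + 1) 1, 0, by simp, by simp, ?_, fun j hj => ?_,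
      fun j h₁ h₂ => by omega⟩
    · simp [column_last _ _ _ (by omega) (by omega : a ≤ l - (a + δ + m) + 1) (by omega)]
    · have hlj := hE j hj
      rcases eq_or_ne (j - (a + δ + m) + 1) δ with hje | hje
      · rw [column_last_eq _ _ _ haδ (by omega) hje, coeff_zero]
      · rw [column_last _ _ _ (by omega) (by omega) (by omega), Pi.single_eq_of_ne (by omega)]

theorem column_add (f₁ f₂ : F[X]) (s₁ s₂ : ℕ → F) (h₁ h₂ : F[X]) (j : ℕ) :
    column a δ m x μ (f₁ + f₂) (s₁ + s₂) (h₁ + h₂) j =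
      column a δ m x μ f₁ s₁ h₁ j + column a δ m x μ f₂ s₂ h₂ j := by
  unfold column pairEval lowPart
  split_ifs <;> simp [eval_finsetSum, add_mul, mul_add, Finset.sum_add_distrib] <;> ring

theorem column_smul (u : F) (f : F[X]) (s : ℕ → F) (h : F[X]) (j : ℕ) :
    column a δ m x μ (u • f) (u • s) (u • h) j = u * column a δ m x μ f s h j := by
  unfold column pairEval lowPart
  split_ifs <;> simp [eval_finsetSum, mul_add, mul_assoc, Finset.mul_sum]

theorem column_congr (haδ : a ≤ δ) {s s' : ℕ → F} (hs : ∀ i, a ≤ i → i < δ → s i = s' i)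
    (f h : F[X]) {j : ℕ} (hj : j < a + δ + m + δ) :
    column a δ m x μ f s h j = column a δ m x μ f s' h j := by
  have hsum : ∑ i ∈ Finset.Ico a δ, C (s i) * auxPoly a δ x i =
      ∑ i ∈ Finset.Ico a δ, C (s' i) * auxPoly a δ x i :=
    Finset.sum_congr rfl fun i hi => by
      rw [hs i (Finset.mem_Ico.1 hi).1 (Finset.mem_Ico.1 hi).2]
  unfold column pairEval lowPart
  rw [hsum]
  split_ifs <;> first | rfl | rw [hs _ (by omega) (by omega)]

/-- Extension by zero of a vector indexed by `[a, δ)`. -/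
def extendAux (s : Fin (δ - a) → F) (i : ℕ) : F :=
  if h : a ≤ i ∧ i < δ then s ⟨i - a, by omega⟩ else 0

variable (a δ m x μ) in
/-- The transpose of the parity-check matrix of the code. -/
noncomputable def parityMap (n : ℕ) :
    (degreeLT F a × (Fin (δ - a) → F) × degreeLT F a) →ₗ[F] (Fin n → F) where
  toFun y j := column a δ m x μ y.1 (extendAux y.2.1) y.2.2 j
  map_add' y z := by
    ext j
    rw [Pi.add_apply, ← column_add]
    congr 1
    ext i
    simp only [extendAux, Pi.add_apply]
    split_ifs <;> simp
  map_smul' u y := by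
    ext j
    rw [Pi.smul_apply, RingHom.id_apply, smul_eq_mul, ← column_smul]
    congr 1
    ext i
    simp only [extendAux, Pi.smul_apply]
    split_ifs <;> simp

theorem exists_parityMap_eq (haδ : a ≤ δ) {f h : F[X]} (hf : f.degree < a) (hh : h.degree < a)
    (s : ℕ → F) {n : ℕ} (hn : n = a + δ + m + δ) :
    ∃ y, ∀ j : Fin n, parityMap a δ m x μ n y j = column a δ m x μ f s h j := by
  refine ⟨(⟨f, mem_degreeLT.2 hf⟩, fun i => s (a + i), ⟨h, mem_degreeLT.2 hh⟩), fun j => ?_⟩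
  refine column_congr haδ (fun i h₁ h₂ => ?_) f h (hn ▸ j.2)
  simp only [extendAux]
  rw [dif_pos ⟨h₁, h₂⟩, Nat.add_sub_cancel' h₁]

theorem finrank_parameters (haδ : a ≤ δ) :
    Module.finrank F (degreeLT F a × (Fin (δ - a) → F) × degreeLT F a) = a + δ := by
  have hfr : Module.finrank F (degreeLT F a) = a := by
    rw [(degreeLTEquiv F a).finrank_eq, Module.finrank_fin_fun]
  have hfin : Module.Finite F (degreeLT F a) := Module.Finite.equiv (degreeLTEquiv F a).symm
  rw [Module.finrank_prod, Module.finrank_prod, Module.finrank_fin_fun, hfr]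
  omega

end Construction

section Orthogonal

variable {F V : Type*} [Field F] [AddCommGroup V] [Module F V] {n : ℕ}

/-- The vectors orthogonal to the range of a linear map. -/
noncomputable def orthogonalCode (Φ : V →ₗ[F] (Fin n → F)) : Submodule F (Fin n → F) :=
  LinearMap.ker (Φ.dualMap ∘ₗ (dotProductEquiv F (Fin n)).toLinearMap)

theorem mem_orthogonalCode {Φ : V →ₗ[F] (Fin n → F)} {c : Fin n → F} :
    c ∈ orthogonalCode Φ ↔ ∀ y, ∑ j, c j * Φ y j = 0 := by
  rw [orthogonalCode, LinearMap.mem_ker, LinearMap.ext_iff]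
  rfl

theorem finrank_orthogonalCode [FiniteDimensional F V] {Φ : V →ₗ[F] (Fin n → F)}
    (hΦ : Function.Injective Φ) :
    Module.finrank F (orthogonalCode Φ) + Module.finrank F V = n := by
  set L := Φ.dualMap ∘ₗ (dotProductEquiv F (Fin n)).toLinearMap with hL
  have hsurj : Function.Surjective L := by
    rw [hL, LinearMap.coe_comp]
    exact (LinearMap.dualMap_surjective_of_injective hΦ).comp
      (dotProductEquiv F (Fin n)).surjective
  have := LinearMap.finrank_range_add_finrank_ker L
  rw [LinearMap.range_eq_top.2 hsurj, finrank_top, Subspace.dual_finrank_eq,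
    Module.finrank_fin_fun] at this
  rw [orthogonalCode, ← hL]
  omega

theorem eq_of_mem_orthogonalCode {Φ : V →ₗ[F] (Fin n → F)} {c c' : Fin n → F}
    (hc : c ∈ orthogonalCode Φ) (hc' : c' ∈ orthogonalCode Φ) {l : Fin n} {y : V}
    (hl : Φ y l ≠ 0) (h : ∀ j, j ≠ l → c j = c' j ∨ Φ y j = 0) : c l = c' l := by
  have hd := mem_orthogonalCode.1 (Submodule.sub_mem _ hc hc') y
  rw [Finset.sum_eq_single_of_mem l (Finset.mem_univ l)] at hd
  · exact sub_eq_zero.1 ((mul_eq_zero.1 hd).resolve_right hl)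
  · intro j _ hj
    rcases h j hj with h | h
    · simp [h]
    · rw [h, mul_zero]

end Orthogonal

section Code

variable {F : Type*} [Field F] {a δ m n : ℕ} {x μ : ℕ → F}

theorem parityMap_window_injective (ha : 1 ≤ a) (haδ : a ≤ δ) (hδm : δ ≤ m)
    (hn : n = a + δ + m + δ)
    (hx : Set.InjOn x (Set.Iio (a + δ + m))) (hμ : Set.InjOn μ (Set.Iio (a - 1)))
    (hw : CompletesWindows a δ m x μ) {l : ℕ} (hl₁ : δ ≤ l) (hl₂ : l ≤ m + δ)
    {y : degreeLT F a × (Fin (δ - a) → F) × degreeLT F a}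
    (H : ∀ j : Fin n, l ≤ j → (j : ℕ) < l + (a + δ) → parityMap a δ m x μ n y j = 0) :
    y = 0 := by
  obtain ⟨f, s, h⟩ := y
  obtain ⟨hf, hh, hs⟩ := column_window_injective ha haδ hδm hx hμ hw (mem_degreeLT.1 f.2)
    (mem_degreeLT.1 h.2) (s := extendAux s) hl₁ hl₂
    fun j h₁ h₂ => H ⟨j, by omega⟩ h₁ h₂
  refine Prod.ext (Subtype.ext hf) (Prod.ext (funext fun i => ?_) (Subtype.ext hh))
  have := hs (a + i) (Finset.mem_Ico.2 ⟨by omega, by omega⟩)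
  rw [extendAux, dif_pos ⟨by omega, by omega⟩] at this
  simpa using this

theorem exists_parityMap_window (ha : 1 ≤ a) (haδ : a ≤ δ) (hδm : δ ≤ m)
    (hn : n = a + δ + m + δ)
    (hx : Set.InjOn x (Set.Iio (a + δ + m))) (hμ : Set.InjOn μ (Set.Iio (a - 1)))
    (hw : CompletesWindows a δ m x μ) {l : Fin n} (hl : δ ≤ l) :
    ∃ y, parityMap a δ m x μ n y l ≠ 0 ∧ ∀ j : Fin n, l < j → (j : ℕ) < l + (a + δ) →
      parityMap a δ m x μ n y j = 0 := by
  set k := min (l : ℕ) (m + δ) with hk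
  have hln := l.2
  have hkδ : δ ≤ k := le_min hl (by omega)
  have hkm : k ≤ m + δ := min_le_right _ _
  have hlk : k ≤ l ∧ l < k + (a + δ) := by omega
  let e : Fin (a + δ) → Fin n := fun i => ⟨k + i, by omega⟩
  let W := (LinearMap.funLeft F F e) ∘ₗ parityMap a δ m x μ n
  have hfin : Module.Finite F (degreeLT F a) := Module.Finite.equiv (degreeLTEquiv F a).symm
  have hinj : Function.Injective W := by
    rw [injective_iff_map_eq_zero]
    intro y hy
    refine parityMap_window_injective ha haδ hδm hn hx hμ hw hkδ hkm fun j h₁ h₂ => ?_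
    have := congrFun hy ⟨j - k, by omega⟩
    have hej : e ⟨j - k, by omega⟩ = j := Fin.ext (Nat.add_sub_cancel' h₁)
    rw [← hej]
    exact this
  have hsurj : Function.Surjective W :=
    (LinearMap.injective_iff_surjective_of_finrank_eq_finrank
      (by rw [finrank_parameters haδ, Module.finrank_fin_fun])).1 hinj
  obtain ⟨y, hy⟩ := hsurj (Pi.single ⟨l - k, by omega⟩ 1)
  have hval : ∀ j : Fin n, ∀ h₁ : k ≤ j, ∀ h₂ : (j : ℕ) < k + (a + δ),
      parityMap a δ m x μ n y j =
        (Pi.single ⟨l - k, by omega⟩ 1 : Fin (a + δ) → F) ⟨j - k, by omega⟩ := by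
    intro j h₁ h₂
    rw [← hy]
    have hej : e ⟨j - k, by omega⟩ = j := Fin.ext (Nat.add_sub_cancel' h₁)
    conv_lhs => rw [← hej]
    rfl
  refine ⟨y, ?_, fun j h₁ h₂ => ?_⟩
  · rw [hval l hlk.1 hlk.2, Pi.single_eq_same]
    exact one_ne_zero
  · have h₁' : (l : ℕ) < j := h₁
    rw [hval j (by omega) (by omega)]
    refine Pi.single_eq_of_ne (fun e => ?_) _
    have := congrArg Fin.val e
    simp only at this
    omega

theorem orthogonalCode_parityMap_delayRecoverable (ha : 1 ≤ a) (haδ : a ≤ δ) (hδm : δ ≤ m)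
    (hn : n = a + δ + m + δ) {τ : ℕ} (hτ : τ + 1 = a + δ + m)
    (hx : Set.InjOn x (Set.Iio (a + δ + m))) (hμ : Set.InjOn μ (Set.Iio (a - 1)))
    (hμx : ∀ v < a - 1, ∀ j, a ≤ j → j < a + δ → μ v ≠ x j)
    (hw : CompletesWindows a δ m x μ) :
    DelayRecoverable a (a + δ) τ (orthogonalCode (parityMap a δ m x μ n)) := by
  refine ⟨fun l c c' hc hc' hlt hge => ?_, fun l E hlE hE hEc c c' hc hc' hlt hne => ?_⟩
  · obtain ⟨y, hy, hy', hy''⟩ : ∃ y, parityMap a δ m x μ n y l ≠ 0 ∧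
        (∀ j : Fin n, l < j → (j : ℕ) < l + (a + δ) → parityMap a δ m x μ n y j = 0) ∧
        ∀ j : Fin n, a + δ + m + l ≤ j → parityMap a δ m x μ n y j = 0 := by
      rcases lt_or_ge (l : ℕ) δ with hl | hl
      · obtain ⟨f, s, h, hf, hh, h₁, h₂, h₃⟩ :=
          exists_burst_witness (μ := μ) haδ hδm hx hl
        obtain ⟨y, hy⟩ := exists_parityMap_eq (x := x) (μ := μ) haδ hf hh s hn
        refine ⟨y, by rwa [hy], fun j hj₁ hj₂ => ?_, fun j hj => ?_⟩
        · rw [hy, h₂ j hj₁ hj₂]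
        · rw [hy, h₃ j hj (hn ▸ j.2)]
      · obtain ⟨y, hy, hy'⟩ := exists_parityMap_window ha haδ hδm hn hx hμ hw hl
        exact ⟨y, hy, hy', fun j hj => by omega⟩
    refine eq_of_mem_orthogonalCode hc hc' hy fun j hj => ?_
    rcases lt_or_gt_of_ne hj with hjl | hjl
    · exact Or.inl (hlt j hjl)
    rcases lt_or_ge (j : ℕ) (l + (a + δ)) with h₁ | h₁
    · exact Or.inr (hy' j hjl h₁)
    rcases le_or_gt (j : ℕ) (l + τ) with h₂ | h₂
    · exact Or.inl (hge j h₁ h₂)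
    · exact Or.inr (hy'' j (by omega))
  · obtain ⟨f, s, h, hf, hh, h₁, h₂, h₃⟩ := exists_erasure_witness (μ := μ) (l := l)
      (E := (E.erase l).map Fin.valEmbedding) ha haδ hx hμ hμx (hn ▸ l.2) (fun j hj => by
        obtain ⟨i, hi, rfl⟩ := Finset.mem_map.1 hj
        obtain ⟨hil, hiE⟩ := Finset.mem_erase.1 hi
        exact ⟨lt_of_le_of_ne (hE i hiE).1 fun e => hil (Fin.ext e.symm), hn ▸ i.2⟩) (by
        rw [Finset.card_map, Finset.card_erase_of_mem hlE]
        omega)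
    obtain ⟨y, hy⟩ := exists_parityMap_eq (x := x) (μ := μ) haδ hf hh s hn
    refine eq_of_mem_orthogonalCode hc hc' (y := y) (by rwa [hy]) fun j hj => ?_
    rw [hy]
    rcases lt_or_gt_of_ne hj with hjl | hjl
    · exact Or.inl (hlt j hjl)
    rcases le_or_gt (j : ℕ) (l + τ) with hjτ | hjτ
    · by_cases hjE : j ∈ E
      · exact Or.inr (h₂ j (Finset.mem_map.2 ⟨j, Finset.mem_erase.2 ⟨hj, hjE⟩, rfl⟩))
      · exact Or.inl (hne j hjl hjτ hjE)
    · exact Or.inr (h₃ j (by omega) (hn ▸ j.2))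

theorem exists_delayRecoverable [Fintype F] (ha : 1 ≤ a) (haδ : a ≤ δ) (hδm : δ ≤ m)
    (hn : n = a + δ + m + δ) {τ : ℕ} (hτ : τ + 1 = a + δ + m)
    (hF : a + δ + m ≤ Fintype.card F) :
    ∃ C : Submodule F (Fin n → F),
      Module.finrank F C = m + δ ∧ DelayRecoverable a (a + δ) τ C := by
  obtain ⟨x, hx⟩ : ∃ x : ℕ → F, Set.InjOn x (Set.Iio (a + δ + m)) := by
    obtain ⟨e⟩ : Nonempty (Fin (a + δ + m) ↪ F) :=
      Function.Embedding.nonempty_of_card_le (by simpa using hF)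
    refine ⟨fun j => if h : j < a + δ + m then e ⟨j, h⟩ else 0, fun i hi j hj hij => ?_⟩
    simp only [dif_pos (Set.mem_Iio.1 hi), dif_pos (Set.mem_Iio.1 hj)] at hij
    exact congrArg Fin.val (e.injective hij)
  obtain ⟨μ, hμ, hμx, hw⟩ := exists_greedy_points hx ha haδ hδm hF (a - 1) le_rfl
  refine ⟨orthogonalCode (parityMap a δ m x μ n), ?_,
    orthogonalCode_parityMap_delayRecoverable ha haδ hδm hn hτ hx hμ hμx hw⟩
  have hfin : Module.Finite F (degreeLT F a) := Module.Finite.equiv (degreeLTEquiv F a).symm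
  have hinj : Function.Injective (parityMap a δ m x μ n) := by
    rw [injective_iff_map_eq_zero]
    intro y hy
    exact parityMap_window_injective ha haδ hδm hn hx hμ hw le_rfl (by omega)
      fun j _ _ => congrFun hy j
  have := finrank_orthogonalCode hinj
  rw [finrank_parameters haδ] at this
  omega

end Code

/-- Construction B.  For all `1 ≤ a ≤ b ≤ τ` with `b - a ≥ a`
(i.e. `b ≥ 2a`) and `τ + 1 ≥ b + (b - a)`, and every prime power `q ≥ τ + 1`, there
is a linear code of length `n = τ + b - a + 1` and dimension `τ - a + 1` over the
field with `q` elements that is `(a,b,τ)`-delay-recoverable. -/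
theorem statement11 (a b τ q : ℕ) (ha : 1 ≤ a) (hab : a ≤ b) (hbτ : b ≤ τ)
    (hδa : a ≤ b - a) (hτb : b + (b - a) ≤ τ + 1)
    (hq : IsPrimePow q) (hqτ : τ + 1 ≤ q)
    (F : Type*) [Field F] [Fintype F] (hF : Fintype.card F = q) :
    ∃ C : Submodule F (Fin (τ + b - a + 1) → F),
      Module.finrank F C = τ - a + 1 ∧ DelayRecoverable a b τ C := by
  obtain ⟨C, hC, hR⟩ := exists_delayRecoverable (F := F) (a := a) (δ := b - a) (m := τ + 1 - b)
    (n := τ + b - a + 1) (τ := τ) ha hδa (by omega) (by omega) (by omega) (by omega)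
  refine ⟨C, by omega, ?_⟩
  rwa [Nat.add_sub_cancel' hab] at hR
end

section
/- Let a, b, τ be integers with 1 ≤ a ≤ b ≤ τ, a dividing b, and b dividing τ-a+1. Set α = b/a, n = τ+b-a+1 and β = n/b (note b divides n). Let F be a finite field and let G be an a × (aβ) matrix over F every a columns of which are linearly independent (i.e., G is the generator matrix of an [aβ, a] MDS code). Define the b × n matrix H over F by H(ia+r, mb+ia+s) = G(r, ma+s) for all i ∈ {0,...,α-1}, m ∈ {0,...,β-1}, r, s ∈ {0,...,a-1}, and H equal to 0 at every other entry. Then the code C = {x ∈ F^n : Hx = 0} has dimension τ-a+1 and is (a,b,τ)-delay-recoverable. -/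
/-- A linear dependency with at most `a` nonzero coefficients among vectors of which every `a`
are linearly independent is trivial. -/
theorem eq_zero_of_card_support_le {F V ι : Type*} [Field F] [AddCommGroup V] [Module F V]
    [Fintype ι] {a : ℕ} {v : ι → V}
    (hv : ∀ S : Finset ι, S.card = a → LinearIndepOn F v (S : Set ι))
    (ha : a ≤ Fintype.card ι) {y : ι → F} {T : Finset ι} (hT : T.card ≤ a)
    (hyT : ∀ j, y j ≠ 0 → j ∈ T) (h : ∑ j, y j • v j = 0) : y = 0 := by
  obtain ⟨S, hTS, hS⟩ := Finset.exists_superset_card_eq hT ha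
  have hout : ∀ j, j ∉ S → y j = 0 := fun j hj => by
    by_contra hne
    exact hj (hTS (hyT j hne))
  have hsum : ∑ j ∈ S, y j • v j = 0 := by
    rw [← h]
    exact Finset.sum_subset (Finset.subset_univ S) fun j _ hj => by rw [hout j hj, zero_smul]
  funext j
  by_cases hj : j ∈ S
  · exact linearIndepOn_finset_iff.mp (hv S hS) y hsum j hj
  · exact hout j hj

/-- Two positions `m * b + c + s` and `m' * b + c + s` in a window of length `b` are equal. -/
theorem eq_of_mem_window {b m m' c l : ℕ} (h₁ : l ≤ m * b + c) (h₂ : m * b + c < l + b)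
    (h₃ : l ≤ m' * b + c) (h₄ : m' * b + c < l + b) : m = m' := by
  rcases lt_trichotomy m m' with h | h | h
  · have := Nat.mul_le_mul_right b (Nat.succ_le_of_lt h)
    rw [Nat.succ_mul] at this
    omega
  · exact h
  · have := Nat.mul_le_mul_right b (Nat.succ_le_of_lt h)
    rw [Nat.succ_mul] at this
    omega

/-- A matrix that is block diagonal with respect to `I`, all of whose blocks are the matrix `K`,
has full row rank as soon as `K` has linearly independent rows. -/
theorem linearIndependent_rows_of_blocks {F X Y I R P : Type*} [Field F] [Fintype X]
    [Fintype I] [DecidableEq I] [Fintype R] (H : Matrix X Y F) (K : R → P → F)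
    (e₁ : I × R ≃ X) (e₂ : I × P ≃ Y)
    (hH : ∀ i r i' p, H (e₁ (i, r)) (e₂ (i', p)) = if i = i' then K r p else 0)
    (hK : LinearIndependent F K) : LinearIndependent F H.row := by
  rw [Fintype.linearIndependent_iff] at hK ⊢
  intro g hg x
  obtain ⟨⟨i, r⟩, rfl⟩ := e₁.surjective x
  refine hK (fun r => g (e₁ (i, r))) ?_ r
  funext p
  have h := congrFun hg (e₂ (i, p))
  rw [Finset.sum_apply, ← e₁.sum_comp, Fintype.sum_prod_type] at h
  simpa [hH, Matrix.row, Finset.sum_apply, Finset.sum_ite_irrel] using h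

/-- The kernel of a block diagonal matrix with all blocks equal to `K` consists of the vectors
each of whose blocks lies in the kernel of `K`. -/
theorem sum_block_eq_zero {F X Y I R P : Type*} [Field F] [Fintype Y]
    [Fintype I] [DecidableEq I] [Fintype P] (H : Matrix X Y F) (K : R → P → F)
    (e₁ : I × R ≃ X) (e₂ : I × P ≃ Y)
    (hH : ∀ i r i' p, H (e₁ (i, r)) (e₂ (i', p)) = if i = i' then K r p else 0)
    {d : Y → F} (hd : H.mulVec d = 0) (i : I) :
    ∑ p, d (e₂ (i, p)) • (fun r => K r p) = 0 := by
  funext r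
  have h := congrFun hd (e₁ (i, r))
  rw [Matrix.mulVec, dotProduct, ← e₂.sum_comp, Fintype.sum_prod_type] at h
  simpa [hH, Finset.sum_apply, Finset.sum_ite_irrel, mul_comm] using h

/-- Construction C: interleaving MDS codes.  Let `1 ≤ a ≤ b ≤ τ`
with `a ∣ b` and `b ∣ (τ - a + 1)`, set `α = b/a`, `n = τ + b - a + 1`, `β = n/b`
(so `b = α·a` and `n = β·b`).  Let `G` be an `a × (aβ)` matrix over a finite field
`F` every `a` columns of which are linearly independent (the generator matrix of an
`[aβ, a]` MDS code), and let `H` be the `b × n` matrix with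
`H(ia+r, mb+ia+s) = G(r, ma+s)` for `i < α`, `m < β`, `r, s < a`, and `H = 0` at
every other entry.  Then the kernel code `C = {x : Hx = 0}` has dimension
`τ - a + 1` and is `(a,b,τ)`-delay-recoverable. -/
theorem statement12 (a b τ : ℕ) (ha : 1 ≤ a) (hab : a ≤ b) (hbτ : b ≤ τ)
    (hadvd : a ∣ b) (hbdvd : b ∣ (τ - a + 1))
    (α β : ℕ) (hα : b = α * a) (hβ : τ + b - a + 1 = β * b)
    {F : Type*} [Field F] [Fintype F]
    (G : Matrix (Fin a) (Fin (a * β)) F)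
    (hG : ∀ S : Finset (Fin (a * β)), S.card = a →
      LinearIndependent F (fun j : S => fun r => G r j.1))
    (H : Matrix (Fin b) (Fin (τ + b - a + 1)) F)
    (hH1 : ∀ (x : Fin b) (y : Fin (τ + b - a + 1)) (r : Fin a) (jG : Fin (a * β))
        (i m s : ℕ), i < α → m < β → s < a →
        (x : ℕ) = i * a + (r : ℕ) → (y : ℕ) = m * b + i * a + s →
        (jG : ℕ) = m * a + s → H x y = G r jG)
    (hH0 : ∀ (x : Fin b) (y : Fin (τ + b - a + 1)),
        (¬ ∃ i m r s : ℕ, i < α ∧ m < β ∧ r < a ∧ s < a ∧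
            (x : ℕ) = i * a + r ∧ (y : ℕ) = m * b + i * a + s) → H x y = 0) :
    Module.finrank F (LinearMap.ker H.mulVecLin) = τ - a + 1 ∧
      DelayRecoverable a b τ (LinearMap.ker H.mulVecLin) := by
  have hb : 0 < b := by omega
  have hβ0 : 0 < β := Nat.pos_of_ne_zero fun h => by
    rw [h, Nat.zero_mul] at hβ
    omega
  let e₁ : Fin α × Fin a ≃ Fin b := finProdFinEquiv.trans (finCongr hα.symm)
  let e₂ : Fin α × (Fin β × Fin a) ≃ Fin (τ + b - a + 1) :=
    (((Equiv.prodAssoc _ _ _).symm.trans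
      (((Equiv.prodComm _ _).prodCongr (Equiv.refl _)).trans (Equiv.prodAssoc _ _ _))).trans
      (((Equiv.refl _).prodCongr e₁).trans finProdFinEquiv)).trans (finCongr hβ.symm)
  let e₃ : Fin β × Fin a ≃ Fin (a * β) := finProdFinEquiv.trans (finCongr (Nat.mul_comm β a))
  have he₁ : ∀ i r, (e₁ (i, r) : ℕ) = i * a + r := fun i r => by
    simp [e₁]; ring
  have he₂ : ∀ i m s, (e₂ (i, (m, s)) : ℕ) = m * b + i * a + s := fun i m s => by
    simp [e₂, e₁]; ring
  have he₃ : ∀ m s, (e₃ (m, s) : ℕ) = m * a + s := fun m s => by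
    simp [e₃]; ring
  let K : Fin a → Fin β × Fin a → F := fun r p => G r (e₃ p)
  have hHK : ∀ i r i' p, H (e₁ (i, r)) (e₂ (i', p)) = if i = i' then K r p else 0 := by
    rintro i r i' ⟨m, s⟩
    split_ifs with h
    · subst h
      exact hH1 _ _ _ _ i m s i.2 m.2 s.2 (he₁ i r) (he₂ i m s) (he₃ m s)
    · refine hH0 _ _ ?_
      rintro ⟨j, m', r', s', hj, hm', hr', hs', hx, hy⟩
      have hx' : e₁ (i, r) = e₁ (⟨j, hj⟩, ⟨r', hr'⟩) := Fin.ext (hx.trans (he₁ ⟨j, hj⟩ ⟨r', hr'⟩).symm)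
      have hy' : e₂ (i', (m, s)) = e₂ (⟨j, hj⟩, (⟨m', hm'⟩, ⟨s', hs'⟩)) :=
        Fin.ext (hy.trans (he₂ ⟨j, hj⟩ ⟨m', hm'⟩ ⟨s', hs'⟩).symm)
      exact h ((congrArg Prod.fst (e₁.injective hx')).trans
        (congrArg Prod.fst (e₂.injective hy')).symm)
  have hK : ∀ S : Finset (Fin β × Fin a), S.card = a →
      LinearIndepOn F (fun p r => K r p) (S : Set (Fin β × Fin a)) := fun S hS => by
    have h : LinearIndepOn F (fun j r => G r j) ((S.map e₃.toEmbedding : Finset _) : Set _) :=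
      hG (S.map e₃.toEmbedding) (by rw [Finset.card_map, hS])
    rw [Finset.coe_map] at h
    exact h.comp_of_image e₃.injective.injOn
  have hcard : a ≤ Fintype.card (Fin β × Fin a) := by
    simpa using Nat.le_mul_of_pos_left a hβ0
  have hzero : ∀ d : Fin (τ + b - a + 1) → F, H.mulVec d = 0 → ∀ (i : Fin α)
      (T : Finset (Fin β × Fin a)), T.card ≤ a → (∀ p, d (e₂ (i, p)) ≠ 0 → p ∈ T) →
      ∀ p, d (e₂ (i, p)) = 0 := fun d hd i T hT hdT =>
    congrFun (eq_zero_of_card_support_le hK hcard hT hdT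
      (sum_block_eq_zero H K e₁ e₂ hHK hd i))
  have hKrows : LinearIndependent F K := by
    let A : Matrix (Fin a) (Fin a) F := Matrix.of fun r s => K r (⟨0, hβ0⟩, s)
    have hinj : Function.Injective fun s : Fin a => ((⟨0, hβ0⟩, s) : Fin β × Fin a) :=
      fun _ _ h => congrArg Prod.snd h
    have hcols : LinearIndependent F A.col := by
      have h := hK (Finset.univ.map ⟨_, hinj⟩) (by simp)
      rw [Finset.coe_map, Finset.coe_univ] at h
      exact linearIndepOn_univ_iff.mp (h.comp_of_image hinj.injOn)
    have hrows : LinearIndependent F A.row :=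
      Matrix.linearIndependent_rows_iff_isUnit.mpr
        (Matrix.linearIndependent_cols_iff_isUnit.mp hcols)
    exact LinearIndependent.of_comp
      (LinearMap.funLeft F F fun s : Fin a => ((⟨0, hβ0⟩, s) : Fin β × Fin a)) hrows
  have hin : ∀ i m s, (e₂ (i, (m, s)) : ℕ) ≤ i * a + s + (τ - a + 1) := fun i m s => by
    have h := Nat.mul_le_mul_right b (Nat.succ_le_of_lt m.2)
    rw [Nat.succ_mul, ← hβ] at h
    rw [he₂]
    omega
  have hdelay : ∀ i m s m' s',
      (e₂ (i, (m', s')) : ℕ) ≤ (e₂ (i, (m, s)) : ℕ) + τ := fun i m s m' s' => by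
    have h := hin i m' s'
    have h' := s'.2
    rw [he₂ i m s]
    omega
  refine ⟨?_, ?_, ?_⟩
  · have hrank : H.rank = b := by
      simpa using (linearIndependent_rows_of_blocks H K e₁ e₂ hHK hKrows).rank_matrix
    have h := H.mulVecLin.finrank_range_add_finrank_ker
    rw [Module.finrank_fin_fun] at h
    rw [Matrix.rank] at hrank
    omega
  · intro ℓ c c' hc hc' hpast hfut
    obtain ⟨⟨i, m, s⟩, rfl⟩ := e₂.surjective ℓ
    have hd : H.mulVec (c - c') = 0 := sub_mem hc hc'
    refine sub_eq_zero.mp (hzero _ hd i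
      {p | (e₂ (i, (m, s)) : ℕ) ≤ e₂ (i, p) ∧ (e₂ (i, p) : ℕ) < e₂ (i, (m, s)) + b} ?_ ?_ (m, s))
    · refine (Finset.card_le_card_of_injOn (t := Finset.univ) Prod.snd (by simp) ?_).trans
        (by simp)
      rintro ⟨m₁, s₁⟩ h₁ ⟨m₂, s₂⟩ h₂ (rfl : s₁ = s₂)
      simp only [Finset.coe_filter, Finset.mem_univ, true_and, Set.mem_ofPred_eq] at h₁ h₂
      rw [he₂ i m₁, Nat.add_assoc] at h₁
      rw [he₂ i m₂, Nat.add_assoc] at h₂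
      rw [Fin.ext (eq_of_mem_window h₁.1 h₁.2 h₂.1 h₂.2)]
    · rintro ⟨m', s'⟩ hne
      have hne' := sub_ne_zero.mp hne
      simp only [Finset.mem_filter, Finset.mem_univ, true_and]
      constructor
      · by_contra! h
        exact hne' (hpast _ h)
      · by_contra! h
        exact hne' (hfut _ h (hdelay i m s m' s'))
  · intro ℓ E hℓ _ hEcard c c' hc hc' hpast hfut
    obtain ⟨⟨i, m, s⟩, rfl⟩ := e₂.surjective ℓ
    have hd : H.mulVec (c - c') = 0 := sub_mem hc hc'
    refine sub_eq_zero.mp (hzero _ hd i {p | e₂ (i, p) ∈ E} ?_ ?_ (m, s))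
    · refine (Finset.card_le_card_of_injOn (fun p => e₂ (i, p)) (by simp [Set.MapsTo]) ?_).trans
        hEcard
      exact fun p _ q _ h => congrArg Prod.snd (e₂.injective h)
    · rintro ⟨m', s'⟩ hne
      have hne' := sub_ne_zero.mp hne
      simp only [Finset.mem_filter, Finset.mem_univ, true_and]
      by_contra hE
      rcases lt_trichotomy (e₂ (i, (m', s')) : ℕ) (e₂ (i, (m, s))) with h | h | h
      · exact hne' (hpast _ h)
      · exact hE (Fin.ext h ▸ hℓ)
      · exact hne' (hfut _ h (hdelay i m s m' s') hE)
end

section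
/- For all integers a ≥ 1, b = 2a-1, and τ ≥ b such that b divides τ + 1 - (a-1) (equivalently, τ = a + γb - 2 for some integer γ ≥ 1), and every prime power q ≥ τ+2, there exists a linear code C of length n = τ+a and dimension τ-a+1 over the finite field with q elements that is (a,b,τ)-delay-recoverable. -/
open Polynomial in
theorem eq_zero_of_sum_eval_mul_eq_zero {F ι : Type*} [Field F] (S : Finset ι)
    (u c : ι → F) (m : ℕ) (hu : Set.InjOn u S)
    (h : ∀ p : F[X], p.degree < m → ∑ j ∈ S, p.eval (u j) * c j = 0)
    (T : Finset ι) (hT : ∀ j ∈ S, c j ≠ 0 → j ∈ T) (hcard : T.card ≤ m) :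
    ∀ j ∈ S, c j = 0 := by
  classical
  intro j hj
  by_contra hcj
  let s := S.filter (fun i => c i ≠ 0)
  have hjs : j ∈ s := Finset.mem_filter.2 ⟨hj, hcj⟩
  have hs : s.card ≤ m := (Finset.card_le_card fun i hi =>
    hT i (Finset.mem_filter.1 hi).1 (Finset.mem_filter.1 hi).2).trans hcard
  have hpos : 0 < s.card := Finset.card_pos.2 ⟨j, hjs⟩
  have hsum := h (∏ i ∈ s.erase j, (X - C (u i))) (by
    rw [degree_prod_of_monic _ _ fun i _ => monic_X_sub_C _]
    simp only [degree_X_sub_C, Finset.sum_const, Finset.card_erase_of_mem hjs, nsmul_eq_mul,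
      mul_one]
    exact_mod_cast (by omega : s.card - 1 < m))
  rw [Finset.sum_eq_single j] at hsum
  · rcases mul_eq_zero.1 hsum with h0 | h0
    · rw [eval_prod, Finset.prod_eq_zero_iff] at h0
      obtain ⟨i, hi, hi0⟩ := h0
      obtain ⟨hij, hi⟩ := Finset.mem_erase.1 hi
      simp only [eval_sub, eval_X, eval_C, sub_eq_zero] at hi0
      exact hij (hu (Finset.mem_filter.1 hi).1 hj hi0.symm)
    · exact hcj h0
  · intro i hi hij
    by_cases hci : c i = 0
    · simp [hci]
    · have : i ∈ s.erase j := Finset.mem_erase.2 ⟨hij, Finset.mem_filter.2 ⟨hi, hci⟩⟩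
      rw [eval_prod, Finset.prod_eq_zero this (by simp), zero_mul]
  · exact fun h' => absurd hj h'

open Polynomial in
theorem sum_eval_mul_eq_zero_of_moments {F ι : Type*} [Field F] (S : Finset ι)
    (u c : ι → F) (m : ℕ) (h : ∀ k < m, ∑ j ∈ S, u j ^ k * c j = 0)
    (p : F[X]) (hp : p.degree < m) : ∑ j ∈ S, p.eval (u j) * c j = 0 := by
  rcases eq_or_ne p 0 with rfl | hp0
  · simp
  have hnd : p.natDegree < m := (natDegree_lt_iff_degree_lt hp0).2 hp
  simp_rw [eval_eq_sum_range' hnd, Finset.sum_mul]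
  rw [Finset.sum_comm]
  refine Finset.sum_eq_zero fun k hk => ?_
  simp_rw [mul_assoc]
  rw [← Finset.mul_sum, h k (Finset.mem_range.1 hk), mul_zero]

open Polynomial in
theorem sum_eval_mul_eq_zero_of_monic {F ι : Type*} [Field F] (S : Finset ι)
    (u c : ι → F) (m : ℕ) (Q : F[X]) (hQ : Q.Monic) (hQm : Q.natDegree = m)
    (h : ∀ p : F[X], p.degree < m → ∑ j ∈ S, p.eval (u j) * c j = 0)
    (hQs : ∑ j ∈ S, Q.eval (u j) * c j = 0)
    (p : F[X]) (hp : p.degree < (m + 1 : ℕ)) : ∑ j ∈ S, p.eval (u j) * c j = 0 := by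
  have hr : (p - C (p.coeff m) * Q).degree < m := by
    rw [degree_lt_iff_coeff_zero] at hp ⊢
    intro k hk
    rcases hk.eq_or_lt with rfl | hk
    · have : Q.coeff m = 1 := hQm ▸ hQ.coeff_natDegree
      simp [this]
    · rw [coeff_sub, hp k hk, coeff_C_mul, coeff_eq_zero_of_natDegree_lt (hQm.trans_lt hk)]
      simp
  have := h _ hr
  simp only [eval_sub, eval_mul, eval_C, sub_mul, Finset.sum_sub_distrib, mul_assoc] at this
  rwa [← Finset.mul_sum, hQs, mul_zero, sub_zero] at this

open Polynomial in
/-- The syndrome map gluing two Reed–Solomon parity checks with `m + 1` rows each, one on the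
coordinates in `A` and one on those outside `A`, along their top-degree rows. -/
noncomputable def gluedSyndrome {F ι : Type*} [Field F] [Fintype ι] [DecidableEq ι]
    (A : Finset ι) (u : ι → F) (m : ℕ) (Q : F[X]) :
    (ι → F) →ₗ[F] (Fin m → F) × (Fin m → F) × F :=
  (LinearMap.pi fun k : Fin m => ∑ j ∈ A, u j ^ (k : ℕ) • LinearMap.proj (φ := fun _ => F) j).prod
    ((LinearMap.pi fun k : Fin m => ∑ j ∈ Aᶜ, u j ^ (k : ℕ) • LinearMap.proj (φ := fun _ => F) j).prod
      (∑ j ∈ A, u j ^ m • LinearMap.proj j + ∑ j ∈ Aᶜ, Q.eval (u j) • LinearMap.proj j))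

section Glued

open Polynomial

variable {F ι : Type*} [Field F] [Fintype ι] [DecidableEq ι] {A : Finset ι} {u : ι → F} {m : ℕ}
  {Q : F[X]} {c : ι → F}

theorem gluedSyndrome_eq_zero_iff :
    gluedSyndrome A u m Q c = 0 ↔
      (∀ k < m, ∑ j ∈ A, u j ^ k * c j = 0) ∧ (∀ k < m, ∑ j ∈ Aᶜ, u j ^ k * c j = 0) ∧
        ∑ j ∈ A, u j ^ m * c j + ∑ j ∈ Aᶜ, Q.eval (u j) * c j = 0 := by
  simp [gluedSyndrome, Prod.ext_iff, funext_iff, Fin.forall_iff, LinearMap.sum_apply]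

theorem gluedSyndrome_zero_on (hu : Set.InjOn u A) (hc : gluedSyndrome A u m Q c = 0)
    (T : Finset ι) (hT : ∀ j ∈ A, c j ≠ 0 → j ∈ T) (hcard : T.card ≤ m) :
    ∀ j ∈ A, c j = 0 :=
  eq_zero_of_sum_eval_mul_eq_zero A u c m hu
    (sum_eval_mul_eq_zero_of_moments A u c m (gluedSyndrome_eq_zero_iff.1 hc).1) T hT hcard

theorem gluedSyndrome_zero_on_of_roots (hu : Set.InjOn u A) (hc : gluedSyndrome A u m Q c = 0)
    (hroot : ∀ j ∉ A, c j ≠ 0 → Q.eval (u j) = 0)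
    (T : Finset ι) (hT : ∀ j ∈ A, c j ≠ 0 → j ∈ T) (hcard : T.card ≤ m + 1) :
    ∀ j ∈ A, c j = 0 := by
  obtain ⟨h1, -, h3⟩ := gluedSyndrome_eq_zero_iff.1 hc
  have h0 : ∑ j ∈ Aᶜ, Q.eval (u j) * c j = 0 := Finset.sum_eq_zero fun j hj => by
    by_cases hcj : c j = 0
    · simp [hcj]
    · rw [hroot j (Finset.mem_compl.1 hj) hcj, zero_mul]
  rw [h0, add_zero] at h3
  refine eq_zero_of_sum_eval_mul_eq_zero A u c (m + 1) hu
    (sum_eval_mul_eq_zero_of_moments A u c (m + 1) fun k hk => ?_) T hT hcard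
  rcases (Nat.lt_succ_iff.1 hk).eq_or_lt with rfl | hk
  · exact h3
  · exact h1 k hk

theorem gluedSyndrome_zero_off (hu : Set.InjOn u (Aᶜ : Finset ι)) (hQ : Q.Monic)
    (hQm : Q.natDegree = m) (hc : gluedSyndrome A u m Q c = 0) (hA : ∀ j ∈ A, c j = 0)
    (T : Finset ι) (hT : ∀ j ∉ A, c j ≠ 0 → j ∈ T) (hcard : T.card ≤ m + 1) :
    ∀ j ∉ A, c j = 0 := by
  obtain ⟨-, h2, h3⟩ := gluedSyndrome_eq_zero_iff.1 hc
  rw [Finset.sum_eq_zero (fun j hj => by rw [hA j hj, mul_zero]), zero_add] at h3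
  have := eq_zero_of_sum_eval_mul_eq_zero Aᶜ u c (m + 1) hu
    (sum_eval_mul_eq_zero_of_monic Aᶜ u c m Q hQ hQm
      (sum_eval_mul_eq_zero_of_moments Aᶜ u c m h2) h3) T
    (fun j hj => hT j (Finset.mem_compl.1 hj)) hcard
  exact fun j hj => this j (Finset.mem_compl.2 hj)

/-- If `B` meets `A` in at most `m` and its complement in at most `m + 1` coordinates, then a
codeword supported on `B` vanishes. -/
theorem gluedSyndrome_eq_zero_of_support (huA : Set.InjOn u A)
    (hu : Set.InjOn u (Aᶜ : Finset ι)) (hQ : Q.Monic) (hQm : Q.natDegree = m)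
    (hc : gluedSyndrome A u m Q c = 0) (B : Finset ι) (hB : ∀ j, c j ≠ 0 → j ∈ B)
    (hBA : (B ∩ A).card ≤ m) (hBA' : (B \ A).card ≤ m + 1) : c = 0 := by
  have h1 := gluedSyndrome_zero_on huA hc (B ∩ A)
    (fun j hj hcj => Finset.mem_inter.2 ⟨hB j hcj, hj⟩) hBA
  have h2 := gluedSyndrome_zero_off hu hQ hQm hc h1 (B \ A)
    (fun j hj hcj => Finset.mem_sdiff.2 ⟨hB j hcj, hj⟩) hBA'
  funext j
  by_cases hj : j ∈ A
  · exact h1 j hj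
  · exact h2 j hj

theorem finrank_ker_gluedSyndrome (huA : Set.InjOn u A)
    (hu : Set.InjOn u (Aᶜ : Finset ι)) (hQ : Q.Monic) (hQm : Q.natDegree = m)
    (B : Finset ι) (hB : B.card = 2 * m + 1)
    (hBA : (B ∩ A).card ≤ m) (hBA' : (B \ A).card ≤ m + 1) :
    Module.finrank F (LinearMap.ker (gluedSyndrome A u m Q)) + (2 * m + 1) = Fintype.card ι := by
  let e : (B → F) →ₗ[F] (ι → F) := Function.ExtendByZero.linearMap F (Subtype.val : B → ι)
  have he (v : B → F) (j : B) : e v j = v j := by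
    simp [e, Function.ExtendByZero.linearMap_apply]
  have he' (v : B → F) (j : ι) (hj : j ∉ B) : e v j = 0 := by
    simp only [e, Function.ExtendByZero.linearMap_apply]
    rw [Function.extend_apply' _ _ _ (by rintro ⟨i, rfl⟩; exact hj i.2)]
    rfl
  have hinj : Function.Injective (gluedSyndrome A u m Q ∘ₗ e) := by
    rw [← LinearMap.ker_eq_bot, LinearMap.ker_eq_bot']
    intro v hv
    have := gluedSyndrome_eq_zero_of_support huA hu hQ hQm hv B
      (fun j hj => by_contra fun h => hj (he' v j h)) hBA hBA'
    funext j
    rw [← he v j, this]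
    rfl
  have hfr : Module.finrank F (B → F) = Module.finrank F ((Fin m → F) × (Fin m → F) × F) := by
    simp [hB]
    omega
  have hsurj := (LinearMap.injective_iff_surjective_of_finrank_eq_finrank hfr).1 hinj
  have hs : Function.Surjective (gluedSyndrome A u m Q) := fun w =>
    let ⟨v, hv⟩ := hsurj w
    ⟨e v, hv⟩
  have := LinearMap.finrank_range_add_finrank_ker (gluedSyndrome A u m Q)
  rw [LinearMap.range_eq_top.2 hs, finrank_top, ← hfr] at this
  simp [hB] at this
  omega

end Glued

theorem card_window_filter_mod_le {n : ℕ} (b ℓ r s : ℕ) (B : Finset (Fin n))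
    (hB : ∀ j ∈ B, ℓ ≤ (j : ℕ) ∧ (j : ℕ) < ℓ + b ∧ r ≤ (j : ℕ) % b ∧ (j : ℕ) % b < s) :
    B.card ≤ s - r := by
  rw [← Nat.card_Ico r s]
  refine Finset.card_le_card_of_injOn (fun j => (j : ℕ) % b)
    (fun j hj => Finset.mem_coe.2 (Finset.mem_Ico.2 (hB j hj).2.2)) fun i hi j hj hij => ?_
  obtain ⟨hi1, hi2, -⟩ := hB i hi
  obtain ⟨hj1, hj2, -⟩ := hB j hj
  apply Fin.ext
  rcases le_total (i : ℕ) j with h | h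
  · have := (Nat.modEq_iff_dvd' h).1 hij
    have := Nat.eq_zero_of_dvd_of_lt this (by omega)
    omega
  · have := (Nat.modEq_iff_dvd' h).1 (Eq.symm hij)
    have := Nat.eq_zero_of_dvd_of_lt this (by omega)
    omega

/-- Construction D.  For all `a ≥ 1`, `b = 2a - 1`, `τ ≥ b` with
`b` dividing `τ + 1 - (a - 1)` (equivalently `τ = a + γb - 2` for some `γ ≥ 1`),
and every prime power `q ≥ τ + 2`, there is a linear code of length `n = τ + a`
and dimension `τ - a + 1` over the field with `q` elements that is
`(a, 2a-1, τ)`-delay-recoverable. -/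
theorem statement13 (a τ q : ℕ) (ha : 1 ≤ a) (hbτ : 2 * a - 1 ≤ τ)
    (hdvd : (2 * a - 1) ∣ (τ + 1 - (a - 1)))
    (hq : IsPrimePow q) (hqτ : τ + 2 ≤ q)
    (F : Type*) [Field F] [Fintype F] (hF : Fintype.card F = q) :
    ∃ C : Submodule F (Fin (τ + a) → F),
      Module.finrank F C = τ - a + 1 ∧ DelayRecoverable a (2 * a - 1) τ C := by
  obtain ⟨m, rfl⟩ : ∃ m, a = m + 1 := ⟨a - 1, by omega⟩
  obtain ⟨b, hb⟩ : ∃ b, b = 2 * (m + 1) - 1 := ⟨_, rfl⟩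
  rw [← hb] at hbτ hdvd ⊢
  obtain ⟨γ, hγ⟩ := hdvd
  let f : ℕ → F := fun k => if h : k < q then (Fintype.equivFinOfCardEq hF).symm ⟨k, h⟩ else 0
  have hf (i j : ℕ) (hi : i ≤ τ) (hj : j ≤ τ) (hij : f i = f j) : i = j := by
    have hi' : i < q := by omega
    have hj' : j < q := by omega
    simpa [f, hi', hj'] using hij
  let A : Finset (Fin (τ + (m + 1))) := Finset.univ.filter fun j => (j : ℕ) % b < m
  have hA (j : Fin (τ + (m + 1))) : j ∈ A ↔ (j : ℕ) % b < m := by simp [A]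
  let u : Fin (τ + (m + 1)) → F := fun j => if j ∈ A then f j else f (j - m)
  let Q : Polynomial F :=
    ∏ t ∈ Finset.range m, (Polynomial.X - Polynomial.C (f (τ + 1 + t - m)))
  have hQ : Q.Monic := Polynomial.monic_prod_of_monic _ _ fun _ _ => Polynomial.monic_X_sub_C _
  have hQm : Q.natDegree = m := by
    simp [Q, Polynomial.natDegree_prod_of_monic, Polynomial.monic_X_sub_C]
  have hlate (j : Fin (τ + (m + 1))) (hj : τ < (j : ℕ)) : j ∉ A := by
    rw [hA]
    have hj2 := j.2
    have : (j : ℕ) = (j - b * γ) + b * γ := by omega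
    rw [this, Nat.add_mul_mod_self_left, Nat.mod_eq_of_lt (by omega)]
    omega
  have hearly (j : Fin (τ + (m + 1))) (hj : j ∉ A) : m ≤ (j : ℕ) := by
    rw [hA] at hj
    have := Nat.mod_le (j : ℕ) b
    omega
  have huA : Set.InjOn u A := by
    intro i hi j hj hij
    rw [Finset.mem_coe] at hi hj
    have h1 : (i : ℕ) ≤ τ := not_lt.1 fun h => hlate i h hi
    have h2 : (j : ℕ) ≤ τ := not_lt.1 fun h => hlate j h hj
    simp only [u, hi, hj, if_true] at hij
    exact Fin.ext (hf _ _ h1 h2 hij)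
  have hu : Set.InjOn u (Aᶜ : Finset (Fin (τ + (m + 1)))) := by
    intro i hi j hj hij
    rw [Finset.mem_coe, Finset.mem_compl] at hi hj
    simp only [u, hi, hj, if_false] at hij
    have := hearly i hi
    have := hearly j hj
    have := hf _ _ (by omega) (by omega) hij
    exact Fin.ext (by omega)
  have hroot (j : Fin (τ + (m + 1))) (hj : τ < (j : ℕ)) : Q.eval (u j) = 0 := by
    simp only [Q, Polynomial.eval_prod]
    refine Finset.prod_eq_zero (i := (j : ℕ) - (τ + 1)) (Finset.mem_range.2 (by omega)) ?_
    have : τ + 1 + ((j : ℕ) - (τ + 1)) - m = j - m := by omega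
    simp [u, hlate j hj, this]
  have hwinA (ℓ : ℕ) (B : Finset (Fin (τ + (m + 1))))
      (hB : ∀ j ∈ B, ℓ ≤ (j : ℕ) ∧ (j : ℕ) < ℓ + b) : (B ∩ A).card ≤ m :=
    card_window_filter_mod_le b ℓ 0 m _ fun j hj => by
      obtain ⟨hj, hjA⟩ := Finset.mem_inter.1 hj
      exact ⟨(hB j hj).1, (hB j hj).2, Nat.zero_le _, (hA j).1 hjA⟩
  have hwinA' (ℓ : ℕ) (B : Finset (Fin (τ + (m + 1))))
      (hB : ∀ j ∈ B, ℓ ≤ (j : ℕ) ∧ (j : ℕ) < ℓ + b) : (B \ A).card ≤ m + 1 := by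
    refine (card_window_filter_mod_le b ℓ m b _ fun j hj => ?_).trans
      (by omega : b - m ≤ m + 1)
    obtain ⟨hj, hjA⟩ := Finset.mem_sdiff.1 hj
    rw [hA, not_lt] at hjA
    exact ⟨(hB j hj).1, (hB j hj).2, hjA, Nat.mod_lt _ (by omega)⟩
  refine ⟨LinearMap.ker (gluedSyndrome A u m Q), ?_, ?_, ?_⟩
  · let B : Finset (Fin (τ + (m + 1))) := Finset.univ.filter fun j => (j : ℕ) < b
    have hB : ∀ j ∈ B, 0 ≤ (j : ℕ) ∧ (j : ℕ) < 0 + b := fun j hj => by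
      simpa [B] using hj
    have hBc : B.card = 2 * m + 1 := by
      simp only [B, Fin.card_filter_val_lt]
      omega
    have := finrank_ker_gluedSyndrome huA hu hQ hQm B hBc (hwinA 0 B hB) (hwinA' 0 B hB)
    rw [Fintype.card_fin] at this
    omega
  · intro ℓ c c' hc hc' hpast hwin
    have hd : gluedSyndrome A u m Q (c - c') = 0 :=
      LinearMap.mem_ker.1 (Submodule.sub_mem _ hc hc')
    let B : Finset (Fin (τ + (m + 1))) :=
      Finset.univ.filter fun j => (ℓ : ℕ) ≤ j ∧ (j : ℕ) < ℓ + b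
    have hB : ∀ j ∈ B, (ℓ : ℕ) ≤ (j : ℕ) ∧ (j : ℕ) < ℓ + b := fun j hj => by
      simpa [B] using hj
    have hsupp (j : Fin (τ + (m + 1))) (hj : (c - c') j ≠ 0) (hjτ : (j : ℕ) ≤ ℓ + τ) :
        j ∈ B := by
      rw [Pi.sub_apply, sub_ne_zero] at hj
      have h1 : ¬ (j : ℕ) < ℓ := fun h => hj (hpast j h)
      have h2 : ¬ (ℓ : ℕ) + b ≤ j := fun h => hj (hwin j h hjτ)
      simp only [B, Finset.mem_filter, Finset.mem_univ, true_and]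
      omega
    by_cases hℓ : ℓ ∈ A
    · refine sub_eq_zero.1 (gluedSyndrome_zero_on huA hd (B ∩ A) (fun j hjA hj => ?_)
        (hwinA ℓ B hB) ℓ hℓ)
      have : ¬ τ < (j : ℕ) := fun h => hlate j h hjA
      exact Finset.mem_inter.2 ⟨hsupp j hj (by omega), hjA⟩
    · have := hearly ℓ hℓ
      exact sub_eq_zero.1 (congrFun (gluedSyndrome_eq_zero_of_support huA hu hQ hQm hd B
        (fun j hj => hsupp j hj (by omega)) (hwinA ℓ B hB) (hwinA' ℓ B hB)) ℓ)
  · intro ℓ E hℓE hE hEc c c' hc hc' hpast hwin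
    have hd : gluedSyndrome A u m Q (c - c') = 0 :=
      LinearMap.mem_ker.1 (Submodule.sub_mem _ hc hc')
    have hsupp (j : Fin (τ + (m + 1))) (hj : (c - c') j ≠ 0) (hjτ : (j : ℕ) ≤ ℓ + τ) :
        j ∈ E := by
      rw [Pi.sub_apply, sub_ne_zero] at hj
      by_contra hjE
      rcases lt_trichotomy (j : ℕ) ℓ with h | h | h
      · exact hj (hpast j h)
      · exact hjE (Fin.ext h ▸ hℓE)
      · exact hj (hwin j h hjτ hjE)
    have hsuppA (j : Fin (τ + (m + 1))) (hjA : j ∈ A) (hj : (c - c') j ≠ 0) : j ∈ E := by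
      have : ¬ τ < (j : ℕ) := fun h => hlate j h hjA
      exact hsupp j hj (by omega)
    by_cases hEA : E ⊆ A
    · refine sub_eq_zero.1 (gluedSyndrome_zero_on_of_roots huA hd (fun j hjA hj => hroot j ?_)
        E hsuppA hEc ℓ (hEA hℓE))
      by_contra hjτ
      exact hjA (hEA (hsupp j hj (by omega)))
    · have hcard : (E ∩ A).card ≤ m := by
        have : (E ∩ A).card < E.card := Finset.card_lt_card
          ⟨Finset.inter_subset_left, fun h => hEA (h.trans Finset.inter_subset_right)⟩
        omega
      by_cases hℓ : ℓ ∈ A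
      · exact sub_eq_zero.1 (gluedSyndrome_zero_on huA hd (E ∩ A)
          (fun j hjA hj => Finset.mem_inter.2 ⟨hsuppA j hjA hj, hjA⟩) hcard ℓ hℓ)
      · have := hearly ℓ hℓ
        exact sub_eq_zero.1 (congrFun (gluedSyndrome_eq_zero_of_support huA hu hQ hQm hd E
          (fun j hj => hsupp j hj (by omega)) hcard
          ((Finset.card_le_card Finset.sdiff_subset).trans hEc)) ℓ)
end
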